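/- Let d, n ≥ 2, V(x) = |x|², and β_n > 0 with β_n/n → ∞. Let X_n ~ P_n, let v ∈ ℝ^d with |v| = 1, c ∈ ℝ, φ(x) = x·v − c, and let Y_n = (Y_{n,1},…,Y_{n,n}) be distributed as X_n conditioned on (1/n)Σ_i φ(X_{n,i}) = 0. Let μ^φ = δ_{cv} * μ_*, the uniform probability measure on the closed ball of radius 1 centered at cv. Then almost surely, for all p ≥ 1, d_{W_p}((1/n)Σ_{i=1}^n δ_{Y_{n,i}}, μ^φ) → 0 as n → ∞, regardless of the way the random variables Y_n are defined on the same probability space. -/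

import Mathlib

open MeasureTheory Filter Metric
open scoped ENNReal NNReal RealInnerProductSpace BigOperators Topology ProbabilityTheory Classical

noncomputable section

/-- `ℝ^d` as a Euclidean space. -/
abbrev Euc (d : ℕ) : Type := EuclideanSpace ℝ (Fin d)

/-- The Coulomb kernel `g`, valued in `ℝ ∪ {+∞}` (`= ⊤` at the origin). -/
noncomputable def coulombK (d : ℕ) (x : Euc d) : EReal :=
  if x = 0 then ⊤
  else if d = 2 then ((Real.log (1 / ‖x‖) : ℝ) : EReal)
  else ((1 / (((d : ℝ) - 2) * ‖x‖ ^ ((d : ℕ) - 2)) : ℝ) : EReal)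

/-- Positive part of an extended real, as an extended nonnegative real. -/
noncomputable def posP (x : EReal) : ℝ≥0∞ := if x = ⊤ then ⊤ else ENNReal.ofReal x.toReal

/-- The electrostatic energy `E(μ) = ∬ (g(x-y) + (V x + V y)/2) dμ dμ`, valued in `EReal`,
defined as the difference of the integrals of the positive and negative parts of the
integrand. -/
noncomputable def energy (d : ℕ) (V : Euc d → ℝ) (μ : Measure (Euc d)) : EReal :=
  ((∫⁻ q : Euc d × Euc d,
      posP (coulombK d (q.1 - q.2) + (((V q.1 + V q.2) / 2 : ℝ) : EReal)) ∂(μ.prod μ) : ℝ≥0∞) : EReal)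
  - ((∫⁻ q : Euc d × Euc d,
      posP (-(coulombK d (q.1 - q.2) + (((V q.1 + V q.2) / 2 : ℝ) : EReal))) ∂(μ.prod μ) : ℝ≥0∞) : EReal)

/-- Finiteness of the `p`-th moment of a measure on `ℝ^d`. -/
def FiniteMoment (d : ℕ) (p : ℝ) (μ : Measure (Euc d)) : Prop :=
  ∫⁻ x, ENNReal.ofReal (‖x‖ ^ p) ∂μ ≠ ⊤

/-- Couplings of two measures. -/
def Couplings (d : ℕ) (μ ν : Measure (Euc d)) : Set (Measure (Euc d × Euc d)) :=
  {π | π.map Prod.fst = μ ∧ π.map Prod.snd = ν}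

/-- The `p`-Wasserstein distance (valued in `ℝ≥0∞`). -/
noncomputable def wassDist (d : ℕ) (p : ℝ) (μ ν : Measure (Euc d)) : ℝ≥0∞ :=
  (⨅ π ∈ Couplings d μ ν, ∫⁻ q : Euc d × Euc d, ENNReal.ofReal (‖q.1 - q.2‖ ^ p) ∂π) ^ (1 / p)

/-- Real-valued Coulomb kernel (junk value at the origin; only used in densities with
respect to Lebesgue measure, for which the diagonal is negligible). -/
noncomputable def coulombKR (d : ℕ) (x : Euc d) : ℝ :=
  if d = 2 then Real.log (1 / ‖x‖) else 1 / (((d : ℝ) - 2) * ‖x‖ ^ ((d : ℕ) - 2))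

/-- The Coulomb gas Hamiltonian `H_n`. -/
noncomputable def hamiltonian (d n : ℕ) (V : Euc d → ℝ) (x : Fin n → Euc d) : ℝ :=
  (1 / (n : ℝ)) * ∑ i, V (x i)
    + (1 / (n : ℝ) ^ 2) *
        ∑ q ∈ Finset.univ.filter (fun q : Fin n × Fin n => q.1 ≠ q.2), coulombKR d (x q.1 - x q.2)

/-- The Gibbs measure `P_n` with density proportional to `exp(-β H_n)`. -/
noncomputable def gibbs (d n : ℕ) (β : ℝ) (V : Euc d → ℝ) : Measure (Fin n → Euc d) :=
  ((∫⁻ x, ENNReal.ofReal (Real.exp (-β * hamiltonian d n V x)) ∂(Measure.pi fun _ => volume))⁻¹) •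
    (Measure.pi fun _ => (volume : Measure (Euc d))).withDensity
      (fun x => ENNReal.ofReal (Real.exp (-β * hamiltonian d n V x)))

/-- Empirical measure of a configuration. -/
noncomputable def empMeas (d n : ℕ) (x : Fin n → Euc d) : Measure (Euc d) :=
  ((n : ℝ≥0∞))⁻¹ • ∑ i, Measure.dirac (x i)

/-- Uniform probability measure on the closed ball of radius 1 centered at `c`. -/
noncomputable def uniformBall (d : ℕ) (c : Euc d) : Measure (Euc d) :=
  (volume (Metric.closedBall c 1))⁻¹ • volume.restrict (Metric.closedBall c 1)

/-- Support of a measure. -/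
def measSupport (d : ℕ) (μ : Measure (Euc d)) : Set (Euc d) :=
  {x | ∀ U : Set (Euc d), IsOpen U → x ∈ U → μ U ≠ 0}

/-- The Coulomb interaction energy `J(μ) = ∬ g(x-y) dμ dμ` (the energy with `V = 0`). -/
noncomputable def interactionJ (d : ℕ) (μ : Measure (Euc d)) : EReal :=
  energy d (fun _ => 0) μ

/-- A set has null capacity if it contains no compact set carrying a probability measure
of finite Coulomb interaction energy. -/
def NullCapacity (d : ℕ) (A : Set (Euc d)) : Prop :=
  ∀ K : Set (Euc d), K ⊆ A → IsCompact K →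
    ∀ μ : Measure (Euc d), IsProbabilityMeasure μ → μ Kᶜ = 0 → interactionJ d μ = ⊤

/-- A property holds quasi-everywhere if it holds outside a Borel set of null capacity. -/
def QuasiEverywhere (d : ℕ) (P : Euc d → Prop) : Prop :=
  ∃ N : Set (Euc d), MeasurableSet N ∧ NullCapacity d N ∧ ∀ x ∉ N, P x

/-- The Coulomb potential `(g * μ)(x) = ∫ g(x - y) μ(dy)`, valued in `EReal`. -/
noncomputable def coulombPot (d : ℕ) (μ : Measure (Euc d)) (x : Euc d) : EReal :=
  ((∫⁻ y, posP (coulombK d (x - y)) ∂μ : ℝ≥0∞) : EReal)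
  - ((∫⁻ y, posP (-(coulombK d (x - y))) ∂μ : ℝ≥0∞) : EReal)

/-- The set `P_p(ℝ^d)` of probability measures with finite `p`-th moment. -/
def Ppd (d : ℕ) (p : ℝ) : Set (Measure (Euc d)) :=
  {μ | IsProbabilityMeasure μ ∧ FiniteMoment d p μ}

/-- `B` is closed in the `p`-Wasserstein topology (within `P_p(ℝ^d)`). -/
def WClosedIn (d : ℕ) (p : ℝ) (B : Set (Measure (Euc d))) : Prop :=
  ∀ μ ∈ Ppd d p, (∀ ε : ℝ, 0 < ε → ∃ ν ∈ B, wassDist d p μ ν < ENNReal.ofReal ε) → μ ∈ B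

/-- Interior of `B` in the `p`-Wasserstein topology (within `P_p(ℝ^d)`). -/
def wInterior (d : ℕ) (p : ℝ) (B : Set (Measure (Euc d))) : Set (Measure (Euc d)) :=
  {μ | μ ∈ B ∧ ∃ ε : ℝ, 0 < ε ∧ ∀ ν ∈ Ppd d p, wassDist d p μ ν < ENNReal.ofReal ε → ν ∈ B}

/-- The growth condition `V(x) ≥ a |x|^q - R`. -/
def GrowthCond (d : ℕ) (V : Euc d → ℝ) (a q R : ℝ) : Prop :=
  ∀ x : Euc d, a * ‖x‖ ^ q - R ≤ V x


/- Basic facts on the Coulomb kernel. -/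

lemma coulombKR_neg (d : ℕ) (x : Euc d) : coulombKR d (-x) = coulombKR d x := by
  simp [coulombKR]

lemma coulombKR_sub_comm (d : ℕ) (x y : Euc d) : coulombKR d (x - y) = coulombKR d (y - x) := by
  rw [← neg_sub, coulombKR_neg]

lemma measurable_coulombKR (d : ℕ) : Measurable (coulombKR d) := by
  unfold coulombKR
  split_ifs
  · exact Real.measurable_log.comp (measurable_const.div measurable_norm)
  · exact measurable_const.div (measurable_const.mul (measurable_norm.pow_const _))

lemma coulombKR_zero (d : ℕ) (hd : 2 ≤ d) : coulombKR d 0 = 0 := by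
  unfold coulombKR
  split_ifs with h
  · simp
  · have : d - 2 ≠ 0 := by omega
    simp [this]

lemma coulombKR_nonneg (d : ℕ) (hd : 3 ≤ d) (x : Euc d) : 0 ≤ coulombKR d x := by
  unfold coulombKR
  rw [if_neg (by omega)]
  have : (3:ℝ) ≤ d := by exact_mod_cast hd
  have : (0:ℝ) ≤ (d:ℝ) - 2 := by linarith
  positivity

/-- the dominating kernel -/
def domK (d : ℕ) (x : Euc d) : ℝ := (‖x‖ ^ (d - 1))⁻¹

lemma domK_nonneg (d : ℕ) (x : Euc d) : 0 ≤ domK d x := by unfold domK; positivity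

lemma measurable_domK (d : ℕ) : Measurable (domK d) := by
  unfold domK
  exact (measurable_norm.pow_const _).inv

lemma abs_coulombKR_le (d : ℕ) (hd : 2 ≤ d) (x : Euc d) :
    |coulombKR d x| ≤ domK d x * (1 + ‖x‖ ^ 2) := by
  by_cases hx : x = 0
  · subst hx
    rw [coulombKR_zero d hd]
    simpa using domK_nonneg d 0
  have hr : 0 < ‖x‖ := norm_pos_iff.2 hx
  set r := ‖x‖ with hrdef
  unfold coulombKR domK
  rw [← hrdef]
  split_ifs with h
  · subst h
    rw [one_div, Real.log_inv, abs_neg]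
    have h1 : Real.log r ≤ r := (Real.log_le_sub_one_of_pos hr).trans (by linarith)
    have h2 : -Real.log r ≤ r⁻¹ := by
      rw [← Real.log_inv]
      exact (Real.log_le_sub_one_of_pos (by positivity)).trans (by linarith)
    have h3 : (r ^ (2 - 1))⁻¹ * (1 + r ^ 2) = r⁻¹ + r := by
      simp; field_simp
    rw [h3, abs_le]
    have : 0 < r⁻¹ := by positivity
    constructor <;> linarith
  · have h3 : (3:ℝ) ≤ d := by exact_mod_cast (by omega : 3 ≤ d)
    have hpos : (1:ℝ) ≤ (d:ℝ) - 2 := by linarith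
    rw [abs_of_nonneg (by positivity)]
    have e : r ^ (d - 1) = r ^ (d - 2) * r := by
      rw [← pow_succ]; congr 1; omega
    rw [e]
    have : 1 / (((d:ℝ) - 2) * r ^ (d - 2)) ≤ 1 / (r ^ (d - 2)) := by
      apply one_div_le_one_div_of_le (by positivity)
      nlinarith [pow_pos hr (d - 2)]
    refine this.trans ?_
    rw [mul_inv, mul_assoc, one_div]
    apply le_mul_of_one_le_right (by positivity)
    rw [inv_mul_eq_div, le_div_iff₀ hr]
    nlinarith [sq_nonneg (r - 1)]

lemma integrableOn_domK (d : ℕ) (hd : 2 ≤ d) (r : ℝ) :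
    IntegrableOn (domK d) (ball 0 r) := by
  have : Nonempty (Fin d) := ⟨⟨0, by omega⟩⟩
  have := (integrableOn_fun_norm_addHaar (E := Euc d) (volume)
    (f := fun y : ℝ => (y ^ (d - 1))⁻¹) (r := r)).2
  refine this ?_
  have h1 : IntegrableOn (fun _ : ℝ => (1:ℝ)) (Set.Ioo 0 r) := by
    apply integrableOn_const <;> simp
  refine h1.congr_fun ?_ measurableSet_Ioo
  intro y hy
  have : y ^ (d-1) ≠ 0 := pow_ne_zero _ hy.1.ne'
  simp [this]

lemma integrableOn_domK_sub (d : ℕ) (hd : 2 ≤ d) (x c : Euc d) (r : ℝ) :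
    IntegrableOn (fun y => domK d (x - y)) (closedBall c r) := by
  have h := (integrableOn_domK d hd (‖x‖ + ‖c‖ + r + 1))
  have h2 : IntegrableOn (fun y => domK d (x - y)) ((fun y => x - y) ⁻¹' ball 0 (‖x‖ + ‖c‖ + r + 1)) := by
    have := (Measure.measurePreserving_sub_left (volume : Measure (Euc d)) x)
    exact (this.integrableOn_comp_preimage
      (MeasurableEquiv.subLeft x).measurableEmbedding).2 h
  refine h2.mono_set ?_
  intro y hy
  simp only [Set.mem_preimage, mem_ball_zero_iff]
  rw [mem_closedBall, dist_eq_norm] at hy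
  calc ‖x - y‖ = ‖x - (y - c) - c‖ := by congr 1; abel
    _ ≤ ‖x - (y - c)‖ + ‖c‖ := norm_sub_le _ _
    _ ≤ ‖x‖ + ‖y - c‖ + ‖c‖ := by gcongr; exact norm_sub_le _ _
    _ < _ := by linarith

/-- uniform bound on the integral of the dominating kernel -/
lemma setIntegral_domK_sub_le (d : ℕ) (hd : 2 ≤ d) (x : Euc d) (R : ℝ) (hx : ‖x‖ ≤ R) :
    ∫ y in closedBall (0 : Euc d) 1, domK d (x - y) ≤ ∫ z in ball (0 : Euc d) (R + 2), domK d z := by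
  have mp := (Measure.measurePreserving_sub_left (volume : Measure (Euc d)) x)
  rw [← mp.setIntegral_preimage_emb (MeasurableEquiv.subLeft x).measurableEmbedding
    (fun z => domK d z) (ball 0 (R + 2))]
  have h2 : IntegrableOn (fun y => domK d (x - y)) ((fun y => x - y) ⁻¹' ball 0 (R+2)) :=
    (mp.integrableOn_comp_preimage (MeasurableEquiv.subLeft x).measurableEmbedding).2
      (integrableOn_domK d hd _)
  apply setIntegral_mono_set h2
  · exact Eventually.of_forall fun y => domK_nonneg d _
  · apply Eventually.of_forall
    intro y hy
    have hy' : ‖y‖ ≤ 1 := mem_closedBall_zero_iff.1 hy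
    show x - y ∈ ball 0 (R+2)
    rw [mem_ball_zero_iff]
    linarith [norm_sub_le x y]

lemma integrableOn_coulombKR_sub (d : ℕ) (hd : 2 ≤ d) (x c : Euc d) (r : ℝ) :
    IntegrableOn (fun y => coulombKR d (x - y)) (closedBall c r) := by
  have h := (integrableOn_domK_sub d hd x c r).mul_const (1 + (‖x‖ + ‖c‖ + r)^2)
  refine Integrable.mono' h ?_ ?_
  · exact ((measurable_coulombKR d).comp (measurable_const.sub measurable_id)).aestronglyMeasurable
  · filter_upwards [ae_restrict_mem measurableSet_closedBall] with y hy
    rw [Real.norm_eq_abs]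
    refine (abs_coulombKR_le d hd _).trans ?_
    have : ‖x - y‖ ≤ ‖x‖ + ‖c‖ + r := by
      rw [mem_closedBall, dist_eq_norm] at hy
      calc ‖x - y‖ = ‖x - (y - c) - c‖ := by congr 1; abel
      _ ≤ ‖x - (y - c)‖ + ‖c‖ := norm_sub_le _ _
      _ ≤ ‖x‖ + ‖y - c‖ + ‖c‖ := by gcongr; exact norm_sub_le _ _
      _ ≤ _ := by linarith
    gcongr
    exact domK_nonneg d _

/- The uniform measure on the unit ball. -/

lemma isProb_uniformBall (d : ℕ) (c : Euc d) : IsProbabilityMeasure (uniformBall d c) := by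
  constructor
  unfold uniformBall
  simp only [Measure.smul_apply, Measure.restrict_apply MeasurableSet.univ, Set.univ_inter,
    smul_eq_mul]
  exact ENNReal.inv_mul_cancel (measure_closedBall_pos _ _ one_pos).ne'
    measure_closedBall_lt_top.ne

instance instProbUB (d : ℕ) (c : Euc d) : IsProbabilityMeasure (uniformBall d c) :=
  isProb_uniformBall d c

/-- volume of the unit ball -/
def volB (d : ℕ) : ℝ := volume.real (closedBall (0 : Euc d) 1)

lemma volB_pos (d : ℕ) : 0 < volB d := by
  unfold volB Measure.real
  exact ENNReal.toReal_pos (measure_closedBall_pos _ _ one_pos).ne' measure_closedBall_lt_top.ne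

lemma integral_uniformBall (d : ℕ) (f : Euc d → ℝ) :
    ∫ y, f y ∂(uniformBall d 0) = (volB d)⁻¹ * ∫ y in closedBall (0 : Euc d) 1, f y := by
  unfold uniformBall volB Measure.real
  rw [integral_smul_measure, ENNReal.toReal_inv, smul_eq_mul]

lemma integrable_uniformBall (d : ℕ) (f : Euc d → ℝ)
    (h : IntegrableOn f (closedBall (0 : Euc d) 1)) : Integrable f (uniformBall d 0) := by
  unfold uniformBall
  apply Integrable.smul_measure h
  simpa using (measure_closedBall_pos volume (0 : Euc d) one_pos).ne'

lemma lintegral_uniformBall (d : ℕ) (f : Euc d → ℝ≥0∞) :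
    ∫⁻ y, f y ∂(uniformBall d 0) = (ENNReal.ofReal (volB d))⁻¹ * ∫⁻ y in closedBall (0 : Euc d) 1, f y := by
  unfold uniformBall volB
  rw [lintegral_smul_measure, ofReal_measureReal measure_closedBall_lt_top.ne, smul_eq_mul]

lemma ae_uniformBall (d : ℕ) : ∀ᵐ y ∂(uniformBall d 0), ‖y‖ ≤ 1 := by
  unfold uniformBall
  apply Measure.ae_smul_measure
  filter_upwards [ae_restrict_mem measurableSet_closedBall] with y hy
  simpa using hy

lemma uniformBall_ac (d : ℕ) (c : Euc d) : uniformBall d c ≪ volume := by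
  unfold uniformBall
  exact (Measure.smul_absolutelyContinuous).trans Measure.restrict_le_self.absolutelyContinuous

/-- potential of the uniform ball -/
def potU (d : ℕ) (x : Euc d) : ℝ := ∫ y, coulombKR d (x - y) ∂(uniformBall d 0)

lemma integrable_coulombKR_ub (d : ℕ) (hd : 2 ≤ d) (x : Euc d) :
    Integrable (fun y => coulombKR d (x - y)) (uniformBall d 0) :=
  integrable_uniformBall d _ (integrableOn_coulombKR_sub d hd x 0 1)

lemma measurable_sub_coulombKR (d : ℕ) :
    Measurable (fun q : Euc d × Euc d => coulombKR d (q.1 - q.2)) :=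
  (measurable_coulombKR d).comp (measurable_fst.sub measurable_snd)

lemma integrable_coulombKR_prod (d : ℕ) (hd : 2 ≤ d) :
    Integrable (fun q : Euc d × Euc d => coulombKR d (q.1 - q.2))
      ((uniformBall d 0).prod (uniformBall d 0)) := by
  rw [integrable_prod_iff (measurable_sub_coulombKR d).aestronglyMeasurable]
  refine ⟨Eventually.of_forall fun x => integrable_coulombKR_ub d hd x, ?_⟩
  set M := (volB d)⁻¹ * (5 * ∫ z in ball (0 : Euc d) (1 + 2), domK d z)
  refine Integrable.mono' (integrable_const M) ?_ ?_
  · exact ((measurable_sub_coulombKR d).norm.aestronglyMeasurable).integral_prod_right'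
  · filter_upwards [ae_uniformBall d] with x hx
    rw [Real.norm_of_nonneg (integral_nonneg fun y => norm_nonneg _)]
    rw [integral_uniformBall]
    apply mul_le_mul_of_nonneg_left _ (inv_nonneg.2 (volB_pos d).le)
    calc ∫ y in closedBall (0 : Euc d) 1, ‖coulombKR d (x - y)‖
        ≤ ∫ y in closedBall (0 : Euc d) 1, 5 * domK d (x - y) := by
          apply setIntegral_mono_on (integrableOn_coulombKR_sub d hd x 0 1).norm
            ((integrableOn_domK_sub d hd x 0 1).const_mul 5) measurableSet_closedBall
          intro y hy
          have hy' : ‖y‖ ≤ 1 := by simpa using hy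
          rw [Real.norm_eq_abs]
          refine (abs_coulombKR_le d hd _).trans ?_
          rw [mul_comm]
          apply mul_le_mul_of_nonneg_right _ (domK_nonneg d _)
          have : ‖x - y‖ ≤ 2 := (norm_sub_le _ _).trans (by linarith)
          nlinarith [norm_nonneg (x - y)]
      _ = 5 * ∫ y in closedBall (0 : Euc d) 1, domK d (x - y) := by rw [integral_const_mul]
      _ ≤ _ := by
          gcongr
          exact setIntegral_domK_sub_le d hd x 1 hx

/-- self energy of the uniform ball -/
def selfJ (d : ℕ) : ℝ := ∫ x, potU d x ∂(uniformBall d 0)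

lemma selfJ_eq (d : ℕ) (hd : 2 ≤ d) : selfJ d =
    ∫ q : Euc d × Euc d, coulombKR d (q.1 - q.2) ∂((uniformBall d 0).prod (uniformBall d 0)) := by
  rw [integral_prod _ (integrable_coulombKR_prod d hd)]; rfl

lemma integrable_potU (d : ℕ) (hd : 2 ≤ d) : Integrable (potU d) (uniformBall d 0) :=
  (integrable_coulombKR_prod d hd).integral_prod_left

lemma integrable_normsq_ub (d : ℕ) : Integrable (fun x : Euc d => ‖x‖ ^ 2) (uniformBall d 0) := by
  apply Integrable.of_bound (C := 1) (by fun_prop)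
  filter_upwards [ae_uniformBall d] with x hx
  rw [Real.norm_of_nonneg (by positivity)]
  nlinarith [norm_nonneg x]

/-- energy of the equilibrium measure -/
def eqI (d : ℕ) : ℝ := ∫ x, ‖x‖ ^ 2 ∂(uniformBall d 0) + selfJ d

/- The potential of the uniform ball. -/

lemma nontrivial_Euc (d : ℕ) (hd : 2 ≤ d) : Nontrivial (Euc d) :=
  Module.nontrivial_of_finrank_pos (R := ℝ) (by simp; omega)

lemma polar_integral (d : ℕ) (hd : 2 ≤ d) (f : Euc d → ℝ) (hf : Integrable f) :
    ∫ x, f x = ∫ ω : sphere (0 : Euc d) 1, (∫ r in Set.Ioi (0:ℝ), r ^ (d - 1) * f (r • (ω : Euc d)))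
      ∂((volume : Measure (Euc d)).toSphere) := by
  have := nontrivial_Euc d hd
  have hmp := (volume : Measure (Euc d)).measurePreserving_homeomorphUnitSphereProd
  have hdim : Module.finrank ℝ (Euc d) = d := by simp
  rw [hdim] at hmp
  let F : (sphere (0 : Euc d) 1) × (Set.Ioi (0:ℝ)) → ℝ := fun p => f ((p.2 : ℝ) • (p.1 : Euc d))
  have hF : ∀ x : ({0}ᶜ : Set (Euc d)), F (homeomorphUnitSphereProd (Euc d) x) = f x := by
    intro x
    simp only [F, homeomorphUnitSphereProd_apply_snd_coe, homeomorphUnitSphereProd_apply_fst_coe]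
    congr 1
    have : ‖(x : Euc d)‖ ≠ 0 := norm_ne_zero_iff.2 x.2
    rw [smul_smul, mul_inv_cancel₀ this, one_smul]
  have h1 : ∫ x, f x = ∫ x : ({(0)}ᶜ : Set (Euc d)), f x.1 ∂((volume : Measure (Euc d)).comap Subtype.val) := by
    rw [integral_subtype_comap (measurableSet_singleton _).compl f, MeasureTheory.restrict_compl_singleton]
  have h2 := hmp.integral_comp (Homeomorph.measurableEmbedding _) F
  simp_rw [hF] at h2
  have hFi : Integrable F ((volume : Measure (Euc d)).toSphere.prod (Measure.volumeIoiPow (d - 1))) := by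
    have := hmp.integrable_comp_emb (g := F) (Homeomorph.measurableEmbedding _)
    rw [← this]
    have e : (F ∘ (homeomorphUnitSphereProd (Euc d))) = fun x => f x.1 := funext hF
    rw [e]
    have h3 := (integrableOn_iff_comap_subtypeVal (f := f) (μ := volume)
      (measurableSet_singleton (0 : Euc d)).compl)
    exact h3.1 hf.integrableOn
  rw [h1, h2, integral_prod _ hFi]
  apply integral_congr_ae
  apply Eventually.of_forall
  intro ω
  simp only [Measure.volumeIoiPow, ENNReal.ofReal, F]
  rw [integral_withDensity_eq_integral_smul,
    integral_subtype_comap measurableSet_Ioi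
      fun a ↦ Real.toNNReal (a ^ (d - 1)) • f (a • (ω : Euc d)),
    setIntegral_congr_fun measurableSet_Ioi fun x hx ↦ ?_]
  · rw [NNReal.smul_def, Real.coe_toNNReal _ (pow_nonneg hx.out.le _), smul_eq_mul]
  · exact (measurable_subtype_coe.pow_const _).real_toNNReal

/-- the chord set -/
def chordSet (s q : ℝ) : Set ℝ := {r | 0 < r ∧ r ^ 2 - 2 * r * s + q ≤ 0}

lemma measurableSet_chordSet (s q : ℝ) : MeasurableSet (chordSet s q) := by
  apply MeasurableSet.inter
  · exact measurableSet_Ioi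
  · exact measurableSet_le (f := fun r : ℝ => r ^ 2 - 2 * r * s + q) (by fun_prop) measurable_const

lemma chord_diff_of_nonpos (s q : ℝ) (hq : q ≤ 0) :
    volume.real (chordSet s q) - volume.real (chordSet (-s) q) = 2 * s := by
  have key : ∀ s : ℝ, volume.real (chordSet s q) = s + √(s ^ 2 - q) := by
    intro s
    have hD : 0 ≤ s ^ 2 - q := by nlinarith [sq_nonneg s]
    have hs : |s| ≤ √(s ^ 2 - q) := Real.abs_le_sqrt (by linarith)
    have hsq := Real.sq_sqrt hD
    have : chordSet s q = Set.Ioc 0 (s + √(s ^ 2 - q)) := by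
      ext r
      simp only [chordSet, Set.mem_ofPred_eq, Set.mem_Ioc]
      have h3 := abs_le.1 hs
      constructor
      · rintro ⟨h1, h2⟩
        refine ⟨h1, ?_⟩
        have : r - s ≤ √(s ^ 2 - q) := Real.le_sqrt_of_sq_le (by nlinarith)
        linarith
      · rintro ⟨h1, h2⟩
        refine ⟨h1, ?_⟩
        nlinarith
    rw [this, Real.volume_real_Ioc_of_le]
    · ring
    · linarith [neg_le_of_abs_le hs]
  rw [key, key]
  have : (-s) ^ 2 = s ^ 2 := by ring
  rw [this]; ring

lemma chord_empty (s q : ℝ) (hs : s ≤ 0) (hq : 0 < q) : chordSet s q = ∅ := by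
  ext r
  simp only [chordSet, Set.mem_ofPred_eq, Set.mem_empty_iff_false, iff_false, not_and, not_le]
  intro hr
  nlinarith [mul_nonneg hr.le (neg_nonneg.2 hs)]

lemma chord_le (s q : ℝ) (hs : 0 ≤ s) (hq : 0 ≤ q) : volume.real (chordSet s q) ≤ 2 * s := by
  have h : chordSet s q ⊆ Set.Icc 0 (2 * s) := by
    rintro r ⟨h1, h2⟩
    refine ⟨h1.le, ?_⟩
    by_contra hc
    push Not at hc
    nlinarith
  have := measureReal_mono (μ := volume) h measure_Icc_lt_top.ne
  rw [Real.volume_real_Icc_of_le (by linarith)] at this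
  linarith

lemma chord_diff_le (s q : ℝ) :
    s * (volume.real (chordSet s q) - volume.real (chordSet (-s) q)) ≤ 2 * s ^ 2 := by
  rcases le_or_gt q 0 with hq | hq
  · rw [chord_diff_of_nonpos s q hq]; nlinarith
  · rcases le_total 0 s with hs | hs
    · rw [chord_empty (-s) q (by linarith) hq]
      have := chord_le s q hs hq.le
      simp only [measureReal_empty, sub_zero]
      nlinarith
    · rw [chord_empty s q hs hq]
      have := chord_le (-s) q (by linarith) hq.le
      simp only [measureReal_empty, zero_sub]
      nlinarith

lemma chord_volume_lt_top (s q : ℝ) : volume (chordSet s q) ≠ ∞ := by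
  have h : chordSet s q ⊆ Set.Icc 0 (2 * |s| + |q| + 1) := by
    rintro r ⟨h1, h2⟩
    refine ⟨h1.le, ?_⟩
    by_contra hc
    push Not at hc
    have h3 : s ≤ |s| := le_abs_self s
    have h4 : -|q| ≤ q := neg_abs_le q
    have h5 := abs_nonneg s
    have h6 := abs_nonneg q
    nlinarith [mul_le_mul_of_nonneg_left h3 h1.le]
  exact ((measure_mono h).trans_lt (by simp)).ne

lemma integrableOn_quad (d : ℕ) (z : Euc d) :
    IntegrableOn (fun w : Euc d => ⟪w, z⟫ ^ 2 / ‖w‖ ^ 2) (ball 0 1) := by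
  have : IsFiniteMeasure (volume.restrict (ball (0 : Euc d) 1)) :=
    ⟨by rw [Measure.restrict_apply_univ]; exact measure_ball_lt_top⟩
  have hm : AEStronglyMeasurable (fun w : Euc d => ⟪w, z⟫ ^ 2 / ‖w‖ ^ 2)
      (volume.restrict (ball (0 : Euc d) 1)) := by
    apply Measurable.aestronglyMeasurable
    fun_prop
  refine Integrable.of_bound (C := ‖z‖ ^ 2) hm ?_
  apply Eventually.of_forall
  intro w
  rw [Real.norm_of_nonneg (by positivity)]
  apply div_le_of_le_mul₀ (by positivity) (by positivity)
  have := abs_real_inner_le_norm w z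
  rw [← sq_abs, ← mul_pow, mul_comm ‖z‖]
  gcongr

/-- second moment on the sphere -/
lemma ball_quad (d : ℕ) (hd : 2 ≤ d) (z : Euc d) :
    ∫ w in ball (0 : Euc d) 1, ⟪w, z⟫ ^ 2 / ‖w‖ ^ 2 = ‖z‖ ^ 2 * volB d / d := by
  let h : Euc d → ℝ := fun z => ∫ w in ball (0 : Euc d) 1, ⟪w, z⟫ ^ 2 / ‖w‖ ^ 2
  have hIntg : ∀ z : Euc d, IntegrableOn (fun w : Euc d => ⟪w, z⟫ ^ 2 / ‖w‖ ^ 2) (ball 0 1) := fun z => integrableOn_quad d z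
  have hrot : ∀ (e : Euc d ≃ₗᵢ[ℝ] Euc d) z, h (e z) = h z := by
    intro e z
    simp only [h]
    have mp := e.measurePreserving
    rw [← mp.setIntegral_preimage_emb e.toHomeomorph.measurableEmbedding _ (ball 0 1)]
    have : e ⁻¹' ball 0 1 = ball 0 1 := by
      ext w; simp
    rw [this]
    simp
  have hsc : ∀ (c : ℝ) z, h (c • z) = c ^ 2 * h z := by
    intro c z
    simp only [h]
    rw [← integral_const_mul]
    congr 1; ext w
    rw [inner_smul_right]; ring
  have hunit : ∀ u u' : Euc d, ‖u‖ = ‖u'‖ → h u = h u' := by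
    intro u u' hu
    by_cases hne : u = u'
    · rw [hne]
    have := Submodule.reflection_sub hu
    rw [← this, hrot]
  have i0 : Fin d := ⟨0, by omega⟩
  have hall : ∀ i : Fin d, h (EuclideanSpace.single i 1) = h (EuclideanSpace.single i0 1) := by
    intro i; apply hunit; simp
  have hsum : ∑ i : Fin d, h (EuclideanSpace.single i 1) = volB d := by
    simp only [h]
    rw [← integral_finsetSum _ (fun i _ => hIntg _)]
    have e : ∀ᵐ w ∂(volume.restrict (ball (0 : Euc d) 1)),
        ∑ i : Fin d, ⟪w, EuclideanSpace.single i (1:ℝ)⟫ ^ 2 / ‖w‖ ^ 2 = 1 := by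
      have hz : ∀ᵐ w ∂(volume.restrict (ball (0 : Euc d) 1)), w ≠ 0 := by
        apply ae_restrict_of_ae
        have := nontrivial_Euc d hd
        exact Measure.ae_ne volume 0
      filter_upwards [hz] with w hw
      have hw' : ‖w‖ ^ 2 ≠ 0 := pow_ne_zero _ (norm_ne_zero_iff.2 hw)
      rw [← Finset.sum_div, div_eq_one_iff_eq hw', EuclideanSpace.real_norm_sq_eq]
      apply Finset.sum_congr rfl
      intro i _
      simp [EuclideanSpace.inner_single_right]
    rw [integral_congr_ae e]
    simp only [integral_const, smul_eq_mul, mul_one]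
    unfold volB Measure.real
    have := nontrivial_Euc d hd
    rw [Measure.restrict_apply_univ, Measure.addHaar_closedBall_eq_addHaar_ball]
  simp only [hall, Finset.sum_const, Finset.card_univ, Fintype.card_fin, nsmul_eq_mul] at hsum
  have hd0 : (d:ℝ) ≠ 0 := by exact_mod_cast (by omega : d ≠ 0)
  have : h z = ‖z‖ ^ 2 * h (EuclideanSpace.single i0 1) := by
    rw [← hsc]
    apply hunit
    rw [norm_smul]; simp
  change h z = _
  rw [this, ← hsum]
  field_simp

lemma sphere_quad (d : ℕ) (hd : 2 ≤ d) (z : Euc d) :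
    ∫ ω : sphere (0 : Euc d) 1, ⟪(ω : Euc d), z⟫ ^ 2 ∂((volume : Measure (Euc d)).toSphere)
      = ‖z‖ ^ 2 * volB d := by
  have hd0 : (d:ℝ) ≠ 0 := by exact_mod_cast (by omega : d ≠ 0)
  have h1 := ball_quad d hd z
  rw [← integral_indicator measurableSet_ball, polar_integral d hd] at h1
  · have h2 : ∀ ω : sphere (0 : Euc d) 1, (∫ r in Set.Ioi (0:ℝ), r ^ (d - 1) *
        (ball (0 : Euc d) 1).indicator (fun w => ⟪w, z⟫ ^ 2 / ‖w‖ ^ 2) (r • (ω : Euc d)))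
        = ⟪(ω : Euc d), z⟫ ^ 2 / d := by
      intro ω
      have hω : ‖(ω : Euc d)‖ = 1 := by simpa using ω.2
      have e : ∀ r ∈ Set.Ioi (0:ℝ), r ^ (d - 1) *
        (ball (0 : Euc d) 1).indicator (fun w => ⟪w, z⟫ ^ 2 / ‖w‖ ^ 2) (r • (ω : Euc d)) =
          (Set.Iio 1).indicator (fun r => r ^ (d - 1) * ⟪(ω : Euc d), z⟫ ^ 2) r := by
        intro r hr
        have hr' : 0 < r := hr
        have hn : ‖r • (ω : Euc d)‖ = r := by
          rw [norm_smul, hω, mul_one, Real.norm_of_nonneg hr'.le]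
        by_cases h : r < 1
        · rw [Set.indicator_of_mem (by rw [mem_ball_zero_iff, hn]; exact h),
            Set.indicator_of_mem (Set.mem_Iio.2 h), hn, inner_smul_left]
          simp only [RCLike.conj_to_real]
          field_simp
        · rw [Set.indicator_of_notMem (by rw [mem_ball_zero_iff, hn]; exact h),
            Set.indicator_of_notMem (by simp; linarith), mul_zero]
      rw [setIntegral_congr_fun measurableSet_Ioi e, setIntegral_indicator measurableSet_Iio,
        Set.Ioi_inter_Iio, ← integral_Ioc_eq_integral_Ioo, ← intervalIntegral.integral_of_le zero_le_one,
        intervalIntegral.integral_mul_const, integral_pow]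
      have : d - 1 + 1 = d := by omega
      rw [this]
      have : ((d - 1 : ℕ) : ℝ) + 1 = d := by exact_mod_cast this
      rw [this]
      have h0 : (0:ℝ) ^ d = 0 := zero_pow (by omega)
      rw [h0]
      field_simp
      simp
    simp_rw [h2] at h1
    rw [integral_div] at h1
    field_simp at h1
    linarith
  · rw [integrable_indicator_iff measurableSet_ball]
    exact integrableOn_quad d z

/-- field function -/
def fieldF (d : ℕ) (z w : Euc d) : ℝ :=
  (closedBall z 1).indicator (fun w => ⟪w, z⟫ / ‖w‖ ^ d) w

lemma abs_inner_div_le (d : ℕ) (hd : 2 ≤ d) (z w : Euc d) : |⟪w, z⟫ / ‖w‖ ^ d| ≤ ‖z‖ * domK d w := by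
  rw [abs_div, abs_of_nonneg (by positivity : 0 ≤ ‖w‖ ^ d), domK]
  by_cases hw : w = 0
  · subst hw; simp; positivity
  have hw' : 0 < ‖w‖ := norm_pos_iff.2 hw
  have h := abs_real_inner_le_norm w z
  have e : ‖w‖ ^ d = ‖w‖ * ‖w‖ ^ (d - 1) := by
    rw [← pow_succ']; congr 1; omega
  rw [e, div_le_iff₀ (by positivity)]
  have : ‖z‖ * (‖w‖ ^ (d - 1))⁻¹ * (‖w‖ * ‖w‖ ^ (d - 1)) = ‖w‖ * ‖z‖ := by
    field_simp
  rw [this]; exact h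

lemma integrable_fieldF (d : ℕ) (hd : 2 ≤ d) (z : Euc d) : Integrable (fieldF d z) := by
  unfold fieldF
  rw [integrable_indicator_iff measurableSet_closedBall]
  have h := (integrableOn_domK_sub d hd 0 z 1).const_mul ‖z‖
  refine Integrable.mono' h ?_ ?_
  · apply Measurable.aestronglyMeasurable
    fun_prop
  · apply Eventually.of_forall
    intro w
    have := abs_inner_div_le d hd z w
    rw [Real.norm_eq_abs]
    convert this using 2
    simp [domK]

lemma field_inner (d : ℕ) (hd : 2 ≤ d) (z ω : Euc d) (hω : ‖ω‖ = 1) :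
    ∫ r in Set.Ioi (0:ℝ), r ^ (d - 1) * (fieldF d z (r • ω) + fieldF d z (-(r • ω)))
      = ⟪ω, z⟫ * (volume.real (chordSet ⟪ω, z⟫ (‖z‖ ^ 2 - 1))
          - volume.real (chordSet (-⟪ω, z⟫) (‖z‖ ^ 2 - 1))) := by
  have key : ∀ (ω : Euc d), ‖ω‖ = 1 → ∀ r ∈ Set.Ioi (0:ℝ), r ^ (d - 1) * fieldF d z (r • ω) =
      (chordSet ⟪ω, z⟫ (‖z‖ ^ 2 - 1)).indicator (fun _ => ⟪ω, z⟫) r := by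
    intro ω hω r hr
    have hr' : 0 < r := hr
    have hn : ‖r • ω‖ = r := by
      rw [norm_smul, hω, mul_one, Real.norm_of_nonneg hr'.le]
    have hmem : r • ω ∈ closedBall z 1 ↔ r ∈ chordSet ⟪ω, z⟫ (‖z‖ ^ 2 - 1) := by
      rw [mem_closedBall, dist_eq_norm]
      simp only [chordSet, Set.mem_ofPred_eq, hr', true_and]
      rw [← sq_le_one_iff₀ (norm_nonneg _), norm_sub_sq_real, hn, inner_smul_left]
      simp only [RCLike.conj_to_real]
      constructor <;> intro h <;> linarith
    unfold fieldF
    by_cases h : r ∈ chordSet ⟪ω, z⟫ (‖z‖ ^ 2 - 1)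
    · rw [Set.indicator_of_mem (hmem.2 h), Set.indicator_of_mem h, hn, inner_smul_left]
      simp only [RCLike.conj_to_real]
      have : r ^ d = r * r ^ (d - 1) := by rw [← pow_succ']; congr 1; omega
      rw [this]; field_simp
    · rw [Set.indicator_of_notMem (fun h' => h (hmem.1 h')), Set.indicator_of_notMem h, mul_zero]
  have key2 : ∀ r ∈ Set.Ioi (0:ℝ), r ^ (d - 1) * (fieldF d z (r • ω) + fieldF d z (-(r • ω)))
      = (chordSet ⟪ω, z⟫ (‖z‖ ^ 2 - 1)).indicator (fun _ => ⟪ω, z⟫) r +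
        (chordSet (-⟪ω, z⟫) (‖z‖ ^ 2 - 1)).indicator (fun _ => -⟪ω, z⟫) r := by
    intro r hr
    rw [mul_add, key ω hω r hr, ← smul_neg, key (-ω) (by rw [norm_neg, hω]) r hr, inner_neg_left]
  rw [setIntegral_congr_fun measurableSet_Ioi key2, integral_add, setIntegral_indicator (measurableSet_chordSet _ _),
    setIntegral_indicator (measurableSet_chordSet _ _)]
  · have : ∀ s q, Set.Ioi 0 ∩ chordSet s q = chordSet s q := by
      intro s q
      apply Set.inter_eq_self_of_subset_right
      intro r hr; exact hr.1
    rw [this, this]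
    simp [integral_const]
    ring
  all_goals
    rw [integrable_indicator_iff (measurableSet_chordSet _ _)]
    apply IntegrableOn.mono_measure _ Measure.restrict_le_self
    apply integrableOn_const (chord_volume_lt_top _ _)

lemma field_eq (d : ℕ) (hd : 2 ≤ d) (z : Euc d) :
    ∫ y in closedBall (0 : Euc d) 1, ⟪z - y, z⟫ / ‖z - y‖ ^ d =
     (∫ ω : sphere (0 : Euc d) 1, ⟪(ω : Euc d), z⟫ * (volume.real (chordSet ⟪(ω : Euc d), z⟫ (‖z‖ ^ 2 - 1))
          - volume.real (chordSet (-⟪(ω : Euc d), z⟫) (‖z‖ ^ 2 - 1))) ∂((volume : Measure (Euc d)).toSphere)) / 2 := by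
  have h1 : ∫ y in closedBall (0 : Euc d) 1, ⟪z - y, z⟫ / ‖z - y‖ ^ d = ∫ w, fieldF d z w := by
    rw [← integral_sub_left_eq_self (fieldF d z) volume z, ← integral_indicator measurableSet_closedBall]
    congr 1; ext y
    unfold fieldF
    by_cases hy : ‖y‖ ≤ 1
    · rw [Set.indicator_of_mem (by simpa using hy), Set.indicator_of_mem (by simpa [dist_eq_norm] using hy)]
    · rw [Set.indicator_of_notMem (by simpa using hy), Set.indicator_of_notMem (by simpa [dist_eq_norm] using hy)]
  have h2 : ∫ w, fieldF d z w = (∫ w, (fieldF d z w + fieldF d z (-w))) / 2 := by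
    rw [integral_add (integrable_fieldF d hd z) (integrable_fieldF d hd z).comp_neg, integral_neg_eq_self]
    ring
  rw [h1, h2, polar_integral d hd (fun w => fieldF d z w + fieldF d z (-w)) ((integrable_fieldF d hd z).add (integrable_fieldF d hd z).comp_neg)]
  congr 2
  ext ω
  exact field_inner d hd z ω (by simp)

lemma integrable_sphere_quad (d : ℕ) (z : Euc d) :
    Integrable (fun ω : sphere (0 : Euc d) 1 => ⟪(ω : Euc d), z⟫ ^ 2) ((volume : Measure (Euc d)).toSphere) := by
  have hm : AEStronglyMeasurable (fun ω : sphere (0 : Euc d) 1 => ⟪(ω : Euc d), z⟫ ^ 2)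
      ((volume : Measure (Euc d)).toSphere) := by
    apply Continuous.aestronglyMeasurable
    fun_prop
  refine Integrable.of_bound (C := ‖z‖ ^ 2) hm ?_
  apply Eventually.of_forall
  intro w
  rw [Real.norm_of_nonneg (by positivity), ← sq_abs]
  have := abs_real_inner_le_norm (w : Euc d) z
  have h1 : ‖(w : Euc d)‖ = 1 := by simp
  rw [h1, one_mul] at this
  gcongr

lemma field_le (d : ℕ) (hd : 2 ≤ d) (z : Euc d) :
    ∫ y in closedBall (0 : Euc d) 1, ⟪z - y, z⟫ / ‖z - y‖ ^ d ≤ ‖z‖ ^ 2 * volB d := by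
  rw [field_eq d hd, div_le_iff₀ two_pos, ← sphere_quad d hd, ← integral_mul_const]
  by_cases hi : Integrable (fun ω : sphere (0 : Euc d) 1 => ⟪(ω : Euc d), z⟫ * (volume.real (chordSet ⟪(ω : Euc d), z⟫ (‖z‖ ^ 2 - 1))
          - volume.real (chordSet (-⟪(ω : Euc d), z⟫) (‖z‖ ^ 2 - 1)))) ((volume : Measure (Euc d)).toSphere)
  · apply integral_mono hi ((integrable_sphere_quad d z).mul_const 2)
    intro ω
    have := chord_diff_le ⟪(ω : Euc d), z⟫ (‖z‖ ^ 2 - 1)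
    simp only
    linarith
  · rw [integral_undef hi]
    apply integral_nonneg
    intro ω
    positivity

lemma field_in (d : ℕ) (hd : 2 ≤ d) (z : Euc d) (hz : ‖z‖ ≤ 1) :
    ∫ y in closedBall (0 : Euc d) 1, ⟪z - y, z⟫ / ‖z - y‖ ^ d = ‖z‖ ^ 2 * volB d := by
  rw [field_eq d hd, div_eq_iff two_ne_zero, ← sphere_quad d hd, ← integral_mul_const]
  congr 1
  ext ω
  rw [chord_diff_of_nonpos _ _ (by nlinarith [norm_nonneg z])]
  ring

lemma hasDerivAt_ray_norm (d : ℕ) (x y : Euc d) (t : ℝ) (h : t • x - y ≠ 0) :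
    HasDerivAt (fun t : ℝ => ‖t • x - y‖) (⟪t • x - y, x⟫ / ‖t • x - y‖) t := by
  have h1 : HasDerivAt (fun t : ℝ => t • x - y) x t := by
    simpa using ((hasDerivAt_id t).smul_const x).sub_const y
  have h2 := h1.norm_sq
  have hn : ‖t • x - y‖ ≠ 0 := norm_ne_zero_iff.2 h
  have h3 := h2.sqrt (pow_ne_zero 2 hn)
  simp only [Real.sqrt_sq (norm_nonneg _)] at h3
  convert h3 using 1
  field_simp

lemma hasDerivAt_ray (d : ℕ) (hd : 2 ≤ d) (x y : Euc d) (t : ℝ) (h : t • x - y ≠ 0) :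
    HasDerivAt (fun t : ℝ => coulombKR d (t • x - y)) (-(⟪t • x - y, x⟫ / ‖t • x - y‖ ^ d)) t := by
  have h1 := hasDerivAt_ray_norm d x y t h
  have hn : ‖t • x - y‖ ≠ 0 := norm_ne_zero_iff.2 h
  unfold coulombKR
  by_cases h2 : d = 2
  · subst h2
    simp only [if_true, one_div, Real.log_inv]
    refine (h1.log hn).neg.congr_deriv ?_
    rw [div_div, ← sq]
  · simp only [h2, if_false, one_div]
    have hd3 : (d : ℝ) - 2 ≠ 0 := by
      have : (3:ℝ) ≤ d := by exact_mod_cast (by omega : 3 ≤ d)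
      intro h; linarith
    have h4 := ((h1.pow (d - 2)).const_mul ((d:ℝ) - 2)).inv
      (mul_ne_zero hd3 (pow_ne_zero _ hn))
    refine h4.congr_deriv ?_
    obtain ⟨k, rfl⟩ : ∃ k, d = k + 3 := ⟨d - 3, by omega⟩
    have e1 : k + 3 - 2 = k + 1 := by omega
    have e2 : k + 1 - 1 = k := by omega
    simp only [Pi.pow_apply, e1, e2]
    push_cast
    have : (k:ℝ) + 3 - 2 = k + 1 := by ring
    rw [this]
    have hk : (k:ℝ) + 1 ≠ 0 := by positivity
    field_simp
    ring

lemma ae_not_line (d : ℕ) (hd : 2 ≤ d) (x : Euc d) :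
    ∀ᵐ y : Euc d, ∀ t : ℝ, t • x - y ≠ 0 := by
  have h : volume ((Submodule.span ℝ {x} : Submodule ℝ (Euc d)) : Set (Euc d)) = 0 := by
    apply Measure.addHaar_submodule
    intro htop
    have h1 : Module.finrank ℝ (Submodule.span ℝ {x} : Submodule ℝ (Euc d)) ≤ 1 := (finrank_span_le_card _).trans (by simp)
    rw [htop, finrank_top] at h1
    simp at h1
    omega
  rw [ae_iff]
  refine measure_mono_null ?_ h
  intro y hy
  simp only [Set.mem_ofPred_eq, not_forall, not_not] at hy
  obtain ⟨t, ht⟩ := hy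
  exact Submodule.mem_span_singleton.2 ⟨t, sub_eq_zero.1 ht⟩

lemma coulomb_ftc (d : ℕ) (hd : 2 ≤ d) (x y : Euc d) (h : ∀ t : ℝ, t • x - y ≠ 0) :
    coulombKR d (x - y) - coulombKR d (0 - y) = -∫ t in Set.Ioc (0:ℝ) 1, ⟪t • x - y, x⟫ / ‖t • x - y‖ ^ d := by
  have h1 := intervalIntegral.integral_eq_sub_of_hasDerivAt (a := 0) (b := 1)
    (fun t _ => hasDerivAt_ray d hd x y t (h t)) ?_
  · rw [intervalIntegral.integral_of_le zero_le_one, integral_neg] at h1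
    rw [h1]; simp
  · apply Continuous.intervalIntegrable
    apply Continuous.neg
    apply Continuous.div
    · fun_prop
    · fun_prop
    · intro t
      exact pow_ne_zero _ (norm_ne_zero_iff.2 (h t))

lemma integrable_ray (d : ℕ) (hd : 2 ≤ d) (x : Euc d) :
    Integrable (fun p : Euc d × ℝ => ⟪p.2 • x - p.1, x⟫ / ‖p.2 • x - p.1‖ ^ d)
      ((volume.restrict (closedBall (0:Euc d) 1)).prod (volume.restrict (Set.Ioc (0:ℝ) 1))) := by
  have hm : Measurable (fun p : Euc d × ℝ => ⟪p.2 • x - p.1, x⟫ / ‖p.2 • x - p.1‖ ^ d) := by fun_prop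
  have hslice : ∀ t : ℝ, IntegrableOn (fun y : Euc d => ⟪t • x - y, x⟫ / ‖t • x - y‖ ^ d) (closedBall (0:Euc d) 1) := by
    intro t
    refine Integrable.mono' ((integrableOn_domK_sub d hd (t • x) 0 1).const_mul ‖x‖) ?_ ?_
    · apply Measurable.aestronglyMeasurable
      fun_prop
    · exact Eventually.of_forall fun y => abs_inner_div_le d hd x (t • x - y)
  rw [integrable_prod_iff' hm.aestronglyMeasurable]
  refine ⟨Eventually.of_forall hslice, ?_⟩
  have hm2 : AEStronglyMeasurable (fun t : ℝ => ∫ y, ‖⟪t • x - y, x⟫ / ‖t • x - y‖ ^ d‖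
      ∂(volume.restrict (closedBall (0:Euc d) 1))) (volume.restrict (Set.Ioc (0:ℝ) 1)) := by
    have := (hm.comp measurable_swap).norm.stronglyMeasurable.integral_prod_right'
      (ν := volume.restrict (closedBall (0:Euc d) 1))
    exact this.aestronglyMeasurable
  refine Integrable.of_bound hm2 (C := ‖x‖ * ∫ z in ball (0 : Euc d) (‖x‖ + 2), domK d z) ?_
  filter_upwards [ae_restrict_mem measurableSet_Ioc] with t ht
  rw [Real.norm_of_nonneg (integral_nonneg fun _ => norm_nonneg _)]
  calc _ ≤ ∫ y in closedBall (0:Euc d) 1, ‖x‖ * domK d (t • x - y) := by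
        apply integral_mono (hslice t).norm ((integrableOn_domK_sub d hd (t • x) 0 1).const_mul ‖x‖)
        intro y; exact abs_inner_div_le d hd x (t • x - y)
    _ ≤ _ := by
        rw [integral_const_mul]
        gcongr
        apply setIntegral_domK_sub_le d hd
        rw [norm_smul, Real.norm_of_nonneg ht.1.le]
        nlinarith [norm_nonneg x, ht.2]

lemma potU_sub (d : ℕ) (hd : 2 ≤ d) (x : Euc d) :
    potU d x - potU d 0 = -((volB d)⁻¹ * ∫ t in Set.Ioc (0:ℝ) 1, ∫ y in closedBall (0:Euc d) 1,
      ⟪t • x - y, x⟫ / ‖t • x - y‖ ^ d) := by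
  unfold potU
  rw [← integral_sub (integrable_coulombKR_ub d hd x) (integrable_coulombKR_ub d hd 0)]
  have h1 : ∀ᵐ y ∂(uniformBall d 0), coulombKR d (x - y) - coulombKR d (0 - y) =
      -∫ t in Set.Ioc (0:ℝ) 1, ⟪t • x - y, x⟫ / ‖t • x - y‖ ^ d := by
    filter_upwards [(uniformBall_ac d 0).ae_le (ae_not_line d hd x)] with y hy
    exact coulomb_ftc d hd x y hy
  rw [integral_congr_ae h1, integral_neg, integral_uniformBall]
  rw [integral_integral_swap (integrable_ray d hd x)]

lemma ray_eq (d : ℕ) (x : Euc d) (t : ℝ) (ht : 0 < t) :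
    ∫ y in closedBall (0:Euc d) 1, ⟪t • x - y, x⟫ / ‖t • x - y‖ ^ d =
      t⁻¹ * ∫ y in closedBall (0:Euc d) 1, ⟪t • x - y, t • x⟫ / ‖t • x - y‖ ^ d := by
  rw [← integral_const_mul]
  congr 1; ext y
  rw [inner_smul_right]
  field_simp

lemma integral_id_Ioc (a : ℝ) : ∫ t in Set.Ioc (0:ℝ) 1, t * a = a / 2 := by
  rw [← intervalIntegral.integral_of_le zero_le_one, intervalIntegral.integral_mul_const, integral_id]
  ring

/-- effective potential is minimal on the ball -/
lemma effpot_ge (d : ℕ) (hd : 2 ≤ d) (x : Euc d) : 2 * potU d 0 ≤ ‖x‖ ^ 2 + 2 * potU d x := by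
  have h := potU_sub d hd x
  have hv := volB_pos d
  have h2 : ∫ t in Set.Ioc (0:ℝ) 1, ∫ y in closedBall (0:Euc d) 1,
      ⟪t • x - y, x⟫ / ‖t • x - y‖ ^ d ≤ ∫ t in Set.Ioc (0:ℝ) 1, t * (‖x‖ ^ 2 * volB d) := by
    apply setIntegral_mono_on (integrable_ray d hd x).integral_prod_right _ measurableSet_Ioc
    · intro t ht
      rw [ray_eq d x t ht.1]
      have := field_le d hd (t • x)
      rw [norm_smul, mul_pow, Real.norm_eq_abs, sq_abs] at this
      rw [inv_mul_le_iff₀ ht.1]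
      linarith
    · apply Continuous.integrableOn_Ioc
      fun_prop
  rw [integral_id_Ioc] at h2
  have h3 : (volB d)⁻¹ * (∫ t in Set.Ioc (0:ℝ) 1, ∫ y in closedBall (0:Euc d) 1,
      ⟪t • x - y, x⟫ / ‖t • x - y‖ ^ d) ≤ ‖x‖ ^ 2 / 2 := by
    rw [inv_mul_le_iff₀ hv]; linarith
  linarith

lemma effpot_eq (d : ℕ) (hd : 2 ≤ d) (x : Euc d) (hx : ‖x‖ ≤ 1) : ‖x‖ ^ 2 + 2 * potU d x = 2 * potU d 0 := by
  have h := potU_sub d hd x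
  have hv := volB_pos d
  have h2 : ∫ t in Set.Ioc (0:ℝ) 1, ∫ y in closedBall (0:Euc d) 1,
      ⟪t • x - y, x⟫ / ‖t • x - y‖ ^ d = ∫ t in Set.Ioc (0:ℝ) 1, t * (‖x‖ ^ 2 * volB d) := by
    apply setIntegral_congr_fun measurableSet_Ioc
    intro t ht
    simp only
    rw [ray_eq d x t ht.1, field_in d hd (t • x), norm_smul, mul_pow, Real.norm_eq_abs, sq_abs]
    · have := ht.1
      field_simp
    · rw [norm_smul, Real.norm_of_nonneg ht.1.le]
      nlinarith [norm_nonneg x, ht.2, ht.1]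
  rw [integral_id_Ioc] at h2
  rw [h2] at h
  field_simp at h
  linarith

lemma eqI_eq (d : ℕ) (hd : 2 ≤ d) : eqI d = 2 * potU d 0 - selfJ d := by
  have h : ∫ x, (‖x‖ ^ 2 + 2 * potU d x) ∂(uniformBall d 0) = 2 * potU d 0 := by
    have h1 : ∀ᵐ x ∂(uniformBall d 0), ‖x‖ ^ 2 + 2 * potU d x = 2 * potU d 0 := by
      filter_upwards [ae_uniformBall d] with x hx
      exact effpot_eq d hd x hx
    rw [integral_congr_ae h1]; simp
  rw [integral_add (integrable_normsq_ub d) ((integrable_potU d hd).const_mul 2), integral_const_mul] at h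
  unfold eqI
  change _ + 2 * selfJ d = _ at h
  linarith

/- Gaussian representation of the Coulomb kernel. -/

/-- indicator of dimension two -/
def chi2 (d : ℕ) : ℝ := if d = 2 then 1 else 0

/-- weight -/
def wt (d : ℕ) (t : ℝ) : ℝ := t ^ ((d : ℝ) / 2 - 2)

/-- bounding weight -/
def wb (d : ℕ) (t : ℝ) : ℝ := t ^ ((d : ℝ) / 2 - 2 + chi2 d)

/-- the time-`t` integrand -/
def kk (d : ℕ) (t s : ℝ) : ℝ := (Real.exp (-(t * s)) - chi2 d * Real.exp (-t)) * wt d t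

/-- normalizing constant -/
def aC (d : ℕ) : ℝ := if d = 2 then 1 / 2 else 1 / (((d : ℝ) - 2) * Real.Gamma ((d : ℝ) / 2 - 1))

lemma chi2_nonneg (d : ℕ) : 0 ≤ chi2 d := by unfold chi2; split_ifs <;> norm_num

lemma aC_pos (d : ℕ) (hd : 2 ≤ d) : 0 < aC d := by
  unfold aC
  split_ifs with h
  · norm_num
  · have : (3:ℝ) ≤ d := by exact_mod_cast (by omega : 3 ≤ d)
    have := Real.Gamma_pos_of_pos (s := (d:ℝ) / 2 - 1) (by linarith)
    apply one_div_pos.2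
    apply mul_pos (by linarith) this

lemma wt_pos (d : ℕ) (t : ℝ) (ht : 0 < t) : 0 < wt d t := Real.rpow_pos_of_pos ht _

lemma wb_exp (d : ℕ) (hd : 2 ≤ d) : -1 < (d : ℝ) / 2 - 2 + chi2 d := by
  unfold chi2
  split_ifs with h
  · subst h; norm_num
  · have : (3:ℝ) ≤ d := by exact_mod_cast (by omega : 3 ≤ d)
    linarith

lemma integrableOn_wb (d : ℕ) (hd : 2 ≤ d) (T : ℝ) (hT : 0 ≤ T) : IntegrableOn (wb d) (Set.Ioc 0 T) := by
  unfold wb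
  rw [← intervalIntegrable_iff_integrableOn_Ioc_of_le hT]
  exact intervalIntegral.intervalIntegrable_rpow' (wb_exp d hd)

lemma exp_neg_sub_abs (a b : ℝ) (ha : 0 ≤ a) (hb : 0 ≤ b) : |Real.exp (-a) - Real.exp (-b)| ≤ a + b := by
  rw [abs_le]
  have h1 := Real.add_one_le_exp (-a)
  have h2 := Real.add_one_le_exp (-b)
  have h3 : Real.exp (-a) ≤ 1 := Real.exp_le_one_iff.2 (by linarith)
  have h4 : Real.exp (-b) ≤ 1 := Real.exp_le_one_iff.2 (by linarith)
  constructor <;> linarith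

lemma abs_kk_le (d : ℕ) (_hd : 2 ≤ d) (t s : ℝ) (ht : 0 < t) (hs : 0 ≤ s) :
    |kk d t s| ≤ (1 + s) * wb d t := by
  unfold kk
  rw [abs_mul, abs_of_pos (wt_pos d t ht)]
  unfold wb chi2
  split_ifs with h
  · have e : t ^ ((d : ℝ) / 2 - 2 + 1) = t * wt d t := by
      rw [Real.rpow_add_one ht.ne', wt, mul_comm]
    rw [e, one_mul]
    have := exp_neg_sub_abs (t * s) t (by positivity) ht.le
    have hw := wt_pos d t ht
    calc _ ≤ (t * s + t) * wt d t := by gcongr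
      _ = _ := by ring
  · rw [zero_mul, sub_zero, add_zero, Real.abs_exp]
    have h3 : Real.exp (-(t * s)) ≤ 1 := Real.exp_le_one_iff.2 (by have := mul_nonneg ht.le hs; linarith)
    have hw := wt_pos d t ht
    change _ ≤ (1 + s) * wt d t
    gcongr
    linarith

lemma measurable_kk (d : ℕ) : Measurable (fun p : ℝ × ℝ => kk d p.1 p.2) := by
  unfold kk wt
  fun_prop

lemma integrableOn_kk_Ioc (d : ℕ) (hd : 2 ≤ d) (T s : ℝ) (hT : 0 ≤ T) (hs : 0 ≤ s) :
    IntegrableOn (fun t => kk d t s) (Set.Ioc 0 T) := by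
  refine Integrable.mono' ((integrableOn_wb d hd T hT).const_mul (1 + s)) ?_ ?_
  · exact ((measurable_kk d).comp (measurable_id.prodMk measurable_const)).aestronglyMeasurable
  · filter_upwards [ae_restrict_mem measurableSet_Ioc] with t ht
    exact abs_kk_le d hd t s ht.1 hs

lemma integrableOn_exp_wt (d : ℕ) (T s : ℝ) (hT : 0 < T) (hs : 0 < s) :
    IntegrableOn (fun t => Real.exp (-(t * s)) * wt d t) (Set.Ioi T) := by
  have h := (integrableOn_rpow_mul_exp_neg_mul_rpow (p := 1) (s := (d:ℝ)/2) (b := s)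
    (by have : (0:ℝ) ≤ d := by positivity
        linarith) one_pos hs).mono_set (Set.Ioi_subset_Ioi hT.le)
  refine Integrable.mono' (h.const_mul (T ^ (-2:ℝ))) ?_ ?_
  · apply Measurable.aestronglyMeasurable
    unfold wt
    fun_prop
  · filter_upwards [ae_restrict_mem measurableSet_Ioi] with t ht
    have ht' : T < t := ht
    have ht0 : 0 < t := hT.trans ht'
    rw [Real.norm_of_nonneg (by have := wt_pos d t ht0; positivity)]
    have e : wt d t = t ^ ((d:ℝ)/2) * t ^ (-2:ℝ) := by
      rw [wt, sub_eq_add_neg, Real.rpow_add ht0]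
    rw [e, Real.rpow_one]
    have h5 : t ^ (-2:ℝ) ≤ T ^ (-2:ℝ) := Real.rpow_le_rpow_of_nonpos hT ht'.le (by norm_num)
    have h6 : -s * t = -(t * s) := by ring
    rw [h6]
    calc _ = t ^ (-2:ℝ) * (t ^ ((d:ℝ)/2) * Real.exp (-(t * s))) := by ring
      _ ≤ _ := by gcongr

lemma integrableOn_kk_Ioi (d : ℕ) (T s : ℝ) (hT : 0 < T) (hs : 0 < s) :
    IntegrableOn (fun t => kk d t s) (Set.Ioi T) := by
  have h1 := integrableOn_exp_wt d T s hT hs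
  have h2 := (integrableOn_exp_wt d T 1 hT one_pos).const_mul (chi2 d)
  refine (h1.sub h2).congr ?_
  apply Eventually.of_forall
  intro t
  simp only [kk, mul_one, Pi.sub_apply]
  ring

lemma integrableOn_kk (d : ℕ) (hd : 2 ≤ d) (s : ℝ) (hs : 0 < s) :
    IntegrableOn (fun t => kk d t s) (Set.Ioi 0) := by
  rw [← Set.Ioc_union_Ioi_eq_Ioi (zero_le_one (α := ℝ))]
  exact (integrableOn_kk_Ioc d hd 1 s zero_le_one hs.le).union (integrableOn_kk_Ioi d 1 s one_pos hs)

lemma coulomb_repr (d : ℕ) (hd : 2 ≤ d) (x : Euc d) (hx : x ≠ 0) :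
    coulombKR d x = aC d * ∫ t in Set.Ioi (0:ℝ), kk d t (‖x‖ ^ 2) := by
  have hx' : 0 < ‖x‖ := norm_pos_iff.2 hx
  have hs : 0 < ‖x‖ ^ 2 := by positivity
  by_cases h : d = 2
  · subst h
    have hIntg := integrableOn_kk 2 hd _ hs
    have e : ∀ t ∈ Set.Ioi (0:ℝ), kk 2 t (‖x‖ ^ 2) = t⁻¹ • ((fun u => Real.exp (-u)) (‖x‖ ^ 2 * t)
        - (fun u => Real.exp (-u)) (1 * t)) := by
      intro t ht
      simp only [kk, chi2, wt, if_true, one_mul, smul_eq_mul]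
      have : ((2:ℕ):ℝ) / 2 - 2 = -1 := by norm_num
      rw [this, Real.rpow_neg_one, mul_comm t]
      ring
    rw [setIntegral_congr_fun measurableSet_Ioi e]
    rw [integrableOn_congr_fun e measurableSet_Ioi] at hIntg
    rw [Frullani.integral_Ioi_eq (f := fun u : ℝ => Real.exp (-u)) (L := (1:ℝ)) (R := (0:ℝ)) _ hs one_pos _ _ hIntg]
    · simp only [coulombKR, aC, if_true, smul_eq_mul, one_div, Real.log_inv, Real.log_pow]
      push_cast; ring
    · apply ContinuousOn.locallyIntegrableOn _ measurableSet_Ioi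
      fun_prop
    · have : Continuous (fun u : ℝ => Real.exp (-u)) := by fun_prop
      have h2 := (this.tendsto 0).mono_left (nhdsWithin_le_nhds (s := Set.Ioi 0))
      simpa using h2
    · exact Real.tendsto_exp_neg_atTop_nhds_zero
  · have h3 : (3:ℝ) ≤ d := by exact_mod_cast (by omega : 3 ≤ d)
    have e : ∀ t ∈ Set.Ioi (0:ℝ), kk d t (‖x‖ ^ 2) =
        t ^ (((d:ℝ)/2 - 1) - 1) * Real.exp (-(‖x‖ ^ 2 * t)) := by
      intro t ht
      simp only [kk, chi2, wt, h, if_false, zero_mul, sub_zero]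
      rw [mul_comm t, mul_comm]
      congr 2; ring
    rw [setIntegral_congr_fun measurableSet_Ioi e, Real.integral_rpow_mul_exp_neg_mul_Ioi (by linarith) hs]
    simp only [coulombKR, aC, h, if_false]
    have hG := (Real.Gamma_pos_of_pos (s := (d:ℝ) / 2 - 1) (by linarith)).ne'
    generalize Real.Gamma ((d:ℝ) / 2 - 1) = G at *
    have e2 : (1 / ‖x‖ ^ 2) ^ ((d:ℝ)/2 - 1) = 1 / ‖x‖ ^ (d - 2) := by
      rw [Real.div_rpow zero_le_one hs.le, Real.one_rpow, ← Real.rpow_natCast ‖x‖ 2, ← Real.rpow_mul hx'.le,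
        ← Real.rpow_natCast ‖x‖ (d-2)]
      congr 2
      rw [Nat.cast_sub hd]; push_cast; ring
    rw [e2]
    have hd2 : (d:ℝ) - 2 ≠ 0 := by intro h; linarith
    field_simp

/-- truncated kernel as a function of the squared distance -/
def gT (d : ℕ) (T s : ℝ) : ℝ := aC d * ∫ t in Set.Ioc 0 T, kk d t s

/-- error -/
def epsT (d : ℕ) (T : ℝ) : ℝ := aC d * (chi2 d * ∫ t in Set.Ioi T, Real.exp (-(t * 1)) * wt d t)

lemma gT_le (d : ℕ) (hd : 2 ≤ d) (T : ℝ) (hT : 0 < T) (x : Euc d) (hx : x ≠ 0) :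
    gT d T (‖x‖ ^ 2) - epsT d T ≤ coulombKR d x := by
  have hx' : 0 < ‖x‖ := norm_pos_iff.2 hx
  have hs : 0 < ‖x‖ ^ 2 := by positivity
  rw [coulomb_repr d hd x hx, gT, epsT, ← mul_sub]
  apply mul_le_mul_of_nonneg_left _ (aC_pos d hd).le
  rw [← Set.Ioc_union_Ioi_eq_Ioi hT.le, setIntegral_union (Set.Ioc_disjoint_Ioi le_rfl) measurableSet_Ioi
    (integrableOn_kk_Ioc d hd T _ hT.le hs.le) (integrableOn_kk_Ioi d T _ hT hs), sub_eq_add_neg]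
  gcongr
  rw [← integral_const_mul, ← integral_neg]
  apply setIntegral_mono_on ((integrableOn_exp_wt d T 1 hT one_pos).const_mul _).neg
    (integrableOn_kk_Ioi d T _ hT hs) measurableSet_Ioi
  intro t ht
  have := wt_pos d t (hT.trans ht)
  have h5 := Real.exp_pos (-(t * ‖x‖ ^ 2))
  simp only [kk, mul_one, Pi.neg_apply]
  nlinarith [mul_pos h5 this]

lemma gT_ge (d : ℕ) (hd : 2 ≤ d) (T : ℝ) (hT : 0 < T) (x : Euc d) (hx : x ≠ 0) :
    coulombKR d x ≤ gT d T (‖x‖ ^ 2) + aC d * ∫ t in Set.Ioi T, Real.exp (-(t * ‖x‖ ^ 2)) * wt d t := by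
  have hx' : 0 < ‖x‖ := norm_pos_iff.2 hx
  have hs : 0 < ‖x‖ ^ 2 := by positivity
  rw [coulomb_repr d hd x hx, gT, ← mul_add]
  apply mul_le_mul_of_nonneg_left _ (aC_pos d hd).le
  rw [← Set.Ioc_union_Ioi_eq_Ioi hT.le, setIntegral_union (Set.Ioc_disjoint_Ioi le_rfl) measurableSet_Ioi
    (integrableOn_kk_Ioc d hd T _ hT.le hs.le) (integrableOn_kk_Ioi d T _ hT hs)]
  apply add_le_add le_rfl
  apply setIntegral_mono_on (integrableOn_kk_Ioi d T _ hT hs)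
    (integrableOn_exp_wt d T _ hT hs) measurableSet_Ioi
  intro t ht
  have := wt_pos d t (hT.trans ht)
  have h5 := Real.exp_pos (-t)
  simp only [kk]
  nlinarith [mul_nonneg (mul_nonneg (chi2_nonneg d) h5.le) this.le]

lemma epsT_nonneg (d : ℕ) (hd : 2 ≤ d) (T : ℝ) (hT : 0 < T) : 0 ≤ epsT d T := by
  unfold epsT
  apply mul_nonneg (aC_pos d hd).le
  apply mul_nonneg (chi2_nonneg d)
  apply setIntegral_nonneg measurableSet_Ioi
  intro t ht
  have := wt_pos d t (hT.trans ht)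
  positivity

lemma epsT_tendsto (d : ℕ) : Tendsto (epsT d) atTop (𝓝 0) := by
  have h : Tendsto (fun T => ∫ t in Set.Ioi T, Real.exp (-(t * 1)) * wt d t) atTop (𝓝 0) := by
    have hi := integrableOn_exp_wt d 1 1 one_pos one_pos
    have h1 : ∀ᶠ T in atTop, ∫ t in Set.Ioi T, Real.exp (-(t * 1)) * wt d t =
        (∫ t in Set.Ioi 1, Real.exp (-(t * 1)) * wt d t) - ∫ t in (1:ℝ)..T, Real.exp (-(t * 1)) * wt d t := by
      filter_upwards [eventually_ge_atTop 1] with T hT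
      rw [eq_sub_iff_add_eq, add_comm, intervalIntegral.integral_of_le hT,
        ← setIntegral_union (Set.Ioc_disjoint_Ioi le_rfl) measurableSet_Ioi (hi.mono_set Set.Ioc_subset_Ioi_self)
        (hi.mono_set (Set.Ioi_subset_Ioi hT)), Set.Ioc_union_Ioi_eq_Ioi hT]
    rw [tendsto_congr' h1]
    have := intervalIntegral_tendsto_integral_Ioi 1 hi tendsto_id
    simpa using (tendsto_const_nhds (x := ∫ t in Set.Ioi (1:ℝ), Real.exp (-(t * 1)) * wt d t)).sub this
  have := (h.const_mul (chi2 d)).const_mul (aC d)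
  rw [mul_zero, mul_zero] at this
  exact this

lemma integral_lin3 {α E : Type*} [MeasurableSpace α] [NormedAddCommGroup E] [NormedSpace ℝ E]
    {m : Measure α} {f g h : α → E}
    (hf : Integrable f m) (hg : Integrable g m) (hh : Integrable h m) :
    ∫ x, (f x - g x + h x) ∂m = ∫ x, f x ∂m - ∫ x, g x ∂m + ∫ x, h x ∂m := by
  rw [integral_add (f := fun x => f x - g x) (hf.sub hg) hh, integral_sub hf hg]

lemma integral_lin4 {α E : Type*} [MeasurableSpace α] [NormedAddCommGroup E] [NormedSpace ℝ E]
    {m : Measure α} {f g h k : α → E}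
    (hf : Integrable f m) (hg : Integrable g m) (hh : Integrable h m) (hk : Integrable k m) :
    ∫ x, (f x - g x - h x + k x) ∂m = ∫ x, f x ∂m - ∫ x, g x ∂m - ∫ x, h x ∂m + ∫ x, k x ∂m := by
  rw [integral_lin3 (f := fun x => f x - g x) (hf.sub hg) hh hk, integral_sub hf hg]

/- Truncated interaction energies. -/

lemma gT_fubini {α : Type*} [MeasurableSpace α] (m : Measure α) [IsProbabilityMeasure m] (d : ℕ) (hd : 2 ≤ d)
    (T : ℝ) (hT : 0 ≤ T) (s : α → ℝ) (hs : Measurable s) (hs0 : ∀ z, 0 ≤ s z) (hsi : Integrable s m) :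
    Integrable (fun z => gT d T (s z)) m ∧
    IntegrableOn (fun t => ∫ z, kk d t (s z) ∂m) (Set.Ioc 0 T) ∧
    ∫ z, gT d T (s z) ∂m = aC d * ∫ t in Set.Ioc 0 T, ∫ z, kk d t (s z) ∂m := by
  have hi : Integrable (fun p : α × ℝ => kk d p.2 (s p.1)) (m.prod (volume.restrict (Set.Ioc 0 T))) := by
    have h1 : Integrable (fun p : α × ℝ => (1 + s p.1) * wb d p.2) (m.prod (volume.restrict (Set.Ioc 0 T))) :=
      Integrable.mul_prod ((integrable_const 1).add hsi) (integrableOn_wb d hd T hT)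
    refine h1.mono' ?_ ?_
    · exact ((measurable_kk d).comp (measurable_snd.prodMk (hs.comp measurable_fst))).aestronglyMeasurable
    · have : ∀ᵐ p : α × ℝ ∂(m.prod (volume.restrict (Set.Ioc 0 T))), p.2 ∈ Set.Ioc 0 T :=
        Measure.quasiMeasurePreserving_snd.ae (ae_restrict_mem measurableSet_Ioc)
      filter_upwards [this] with p hp
      exact abs_kk_le d hd _ _ hp.1 (hs0 _)
  refine ⟨?_, ?_, ?_⟩
  · exact hi.integral_prod_left.const_mul (aC d)
  · exact hi.integral_prod_right
  · unfold gT
    rw [integral_const_mul, integral_integral_swap hi]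

/-- Gaussian interaction of two measures -/
def gInt (d : ℕ) (t : ℝ) (μ ν : Measure (Euc d)) : ℝ :=
  ∫ p : Euc d × Euc d, Real.exp (-(t * ‖p.1 - p.2‖ ^ 2)) ∂(μ.prod ν)

/-- Gaussian discrepancy -/
def gDis (d : ℕ) (t : ℝ) (μ ν : Measure (Euc d)) : ℝ :=
  gInt d t μ μ - 2 * gInt d t μ ν + gInt d t ν ν

/-- truncated Coulomb interaction -/
def jT (d : ℕ) (T : ℝ) (μ ν : Measure (Euc d)) : ℝ :=
  ∫ p : Euc d × Euc d, gT d T (‖p.1 - p.2‖ ^ 2) ∂(μ.prod ν)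

lemma integrable_normsq_prod (d : ℕ) (μ ν : Measure (Euc d)) [IsProbabilityMeasure μ] [IsProbabilityMeasure ν]
    (hμ : Integrable (fun x => ‖x‖ ^ 2) μ) (hν : Integrable (fun x => ‖x‖ ^ 2) ν) :
    Integrable (fun p : Euc d × Euc d => ‖p.1 - p.2‖ ^ 2) (μ.prod ν) := by
  have h := ((hμ.comp_fst ν).add (hν.comp_snd μ)).const_mul 2
  refine h.mono' ?_ ?_
  · apply Measurable.aestronglyMeasurable
    fun_prop
  · apply Eventually.of_forall
    intro p
    rw [Real.norm_of_nonneg (by positivity)]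
    have := norm_sub_le p.1 p.2
    simp only [Pi.add_apply]
    calc ‖p.1 - p.2‖ ^ 2 ≤ (‖p.1‖ + ‖p.2‖) ^ 2 := by gcongr
      _ ≤ _ := by nlinarith [sq_nonneg (‖p.1‖ - ‖p.2‖)]

lemma integrable_exp_gen {α : Type*} [MeasurableSpace α] (m : Measure α) [IsProbabilityMeasure m]
    (t : ℝ) (ht : 0 ≤ t) (s : α → ℝ) (hs : Measurable s) (hs0 : ∀ z, 0 ≤ s z) :
    Integrable (fun z => Real.exp (-(t * s z))) m := by
  have hm : AEStronglyMeasurable (fun z => Real.exp (-(t * s z))) m :=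
    Measurable.aestronglyMeasurable (by fun_prop)
  refine Integrable.of_bound hm 1 ?_
  apply Eventually.of_forall
  intro z
  rw [Real.norm_of_nonneg (Real.exp_pos _).le]
  exact Real.exp_le_one_iff.2 (by have := mul_nonneg ht (hs0 z); linarith)

lemma integral_kk {α : Type*} [MeasurableSpace α] (m : Measure α) [IsProbabilityMeasure m] (d : ℕ)
    (t : ℝ) (ht : 0 ≤ t) (s : α → ℝ) (hs : Measurable s) (hs0 : ∀ z, 0 ≤ s z) :
    ∫ z, kk d t (s z) ∂m = (∫ z, Real.exp (-(t * s z)) ∂m) * wt d t - chi2 d * Real.exp (-t) * wt d t := by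
  unfold kk
  rw [integral_mul_const, integral_sub (integrable_exp_gen m t ht s hs hs0) (integrable_const _)]
  simp
  ring

lemma measurable_nsq (d : ℕ) : Measurable (fun p : Euc d × Euc d => ‖p.1 - p.2‖ ^ 2) := by fun_prop

lemma jT_diff (d : ℕ) (hd : 2 ≤ d) (T : ℝ) (hT : 0 ≤ T) (μ ν : Measure (Euc d))
    [IsProbabilityMeasure μ] [IsProbabilityMeasure ν]
    (hμ : Integrable (fun x => ‖x‖ ^ 2) μ) (hν : Integrable (fun x => ‖x‖ ^ 2) ν) :
    IntegrableOn (fun t => gDis d t μ ν * wt d t) (Set.Ioc 0 T) ∧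
    jT d T μ μ - 2 * jT d T μ ν + jT d T ν ν = aC d * ∫ t in Set.Ioc 0 T, gDis d t μ ν * wt d t := by
  obtain ⟨-, a2, a3⟩ := gT_fubini (μ.prod μ) d hd T hT _ (measurable_nsq d) (fun p => by positivity)
    (integrable_normsq_prod d μ μ hμ hμ)
  obtain ⟨-, b2, b3⟩ := gT_fubini (μ.prod ν) d hd T hT _ (measurable_nsq d) (fun p => by positivity)
    (integrable_normsq_prod d μ ν hμ hν)
  obtain ⟨-, c2, c3⟩ := gT_fubini (ν.prod ν) d hd T hT _ (measurable_nsq d) (fun p => by positivity)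
    (integrable_normsq_prod d ν ν hν hν)
  have e : ∀ t ∈ Set.Ioc 0 T, (∫ p, kk d t (‖p.1 - p.2‖ ^ 2) ∂(μ.prod μ))
      - 2 * (∫ p, kk d t (‖p.1 - p.2‖ ^ 2) ∂(μ.prod ν)) + (∫ p, kk d t (‖p.1 - p.2‖ ^ 2) ∂(ν.prod ν))
      = gDis d t μ ν * wt d t := by
    intro t ht
    rw [integral_kk _ d t ht.1.le _ (measurable_nsq d) (fun p => by positivity),
      integral_kk _ d t ht.1.le _ (measurable_nsq d) (fun p => by positivity),
      integral_kk _ d t ht.1.le _ (measurable_nsq d) (fun p => by positivity)]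
    unfold gDis gInt
    ring
  have hI := (a2.sub (b2.const_mul 2)).add c2
  refine ⟨(integrableOn_congr_fun e measurableSet_Ioc).1 hI, ?_⟩
  rw [← setIntegral_congr_fun measurableSet_Ioc e, integral_lin3 a2 (b2.const_mul 2) c2,
    integral_const_mul]
  unfold jT
  rw [a3, b3, c3]
  ring

open ProbabilityTheory in
lemma gauss_fourier (d : ℕ) (c : ℝ) (μ ν : Measure (Euc d))
    [IsProbabilityMeasure μ] [IsProbabilityMeasure ν] :
    ∫ ξ, charFun μ (c • ξ) * (starRingEnd ℂ) (charFun ν (c • ξ)) ∂(stdGaussian (Euc d)) =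
      ((∫ p : Euc d × Euc d, Real.exp (-(c ^ 2 / 2 * ‖p.1 - p.2‖ ^ 2)) ∂(μ.prod ν) : ℝ) : ℂ) := by
  have h1 : ∀ ξ : Euc d, charFun μ (c • ξ) * (starRingEnd ℂ) (charFun ν (c • ξ)) =
      ∫ p : Euc d × Euc d, Complex.exp (⟪ξ, c • (p.1 - p.2)⟫ * Complex.I) ∂(μ.prod ν) := by
    intro ξ
    rw [charFun_apply, charFun_apply, ← integral_conj, ← integral_prod_mul]
    congr 1; ext p
    rw [← Complex.exp_conj, ← Complex.exp_add]
    congr 1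
    simp only [map_mul, Complex.conj_ofReal, Complex.conj_I, inner_smul_right, inner_sub_right,
      real_inner_comm ξ]
    push_cast
    ring
  simp_rw [h1]
  rw [integral_integral_swap]
  · rw [← integral_complex_ofReal]
    congr 1; ext p
    rw [← charFun_apply, charFun_stdGaussian, ← Complex.ofReal_pow, norm_smul, mul_pow, Real.norm_eq_abs, sq_abs]
    push_cast
    congr 1
    ring
  · have hm : AEStronglyMeasurable (Function.uncurry fun (ξ : Euc d) (p : Euc d × Euc d) =>
        Complex.exp (⟪ξ, c • (p.1 - p.2)⟫ * Complex.I)) ((stdGaussian (Euc d)).prod (μ.prod ν)) := by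
      apply Continuous.aestronglyMeasurable
      unfold Function.uncurry
      fun_prop
    refine Integrable.of_bound hm 1 ?_
    apply Eventually.of_forall
    rintro ⟨ξ, p⟩
    simp [Function.uncurry, Complex.norm_exp_ofReal_mul_I]

open ProbabilityTheory in
lemma integrable_charFun_mul (d : ℕ) (c : ℝ) (μ ν : Measure (Euc d))
    [IsProbabilityMeasure μ] [IsProbabilityMeasure ν] :
    Integrable (fun ξ => charFun μ (c • ξ) * (starRingEnd ℂ) (charFun ν (c • ξ))) (stdGaussian (Euc d)) := by
  have hm : AEStronglyMeasurable (fun ξ => charFun μ (c • ξ) * (starRingEnd ℂ) (charFun ν (c • ξ)))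
      (stdGaussian (Euc d)) := by
    apply Continuous.aestronglyMeasurable
    apply Continuous.mul
    · exact (continuous_charFun).comp (continuous_const_smul c)
    · exact Complex.continuous_conj.comp ((continuous_charFun).comp (continuous_const_smul c))
  refine Integrable.of_bound hm 1 ?_
  apply Eventually.of_forall
  intro ξ
  rw [norm_mul, RCLike.norm_conj]
  have h1 := norm_charFun_le_one (μ := μ) (c • ξ)
  have h2 := norm_charFun_le_one (μ := ν) (c • ξ)
  have := norm_nonneg (charFun ν (c • ξ))
  nlinarith

open ProbabilityTheory in
lemma gDis_eq (d : ℕ) (t : ℝ) (ht : 0 ≤ t) (μ ν : Measure (Euc d))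
    [IsProbabilityMeasure μ] [IsProbabilityMeasure ν] :
    gDis d t μ ν = ∫ ξ, ‖charFun μ (√(2 * t) • ξ) - charFun ν (√(2 * t) • ξ)‖ ^ 2 ∂(stdGaussian (Euc d)) := by
  have hc : √(2 * t) ^ 2 / 2 = t := by rw [Real.sq_sqrt (by linarith)]; ring
  have hsym : gInt d t ν μ = gInt d t μ ν := by
    unfold gInt
    rw [← integral_prod_swap]
    congr 1; ext p
    simp only [Prod.fst_swap, Prod.snd_swap]
    rw [norm_sub_rev]
  have key : ∀ μ ν : Measure (Euc d), IsProbabilityMeasure μ → IsProbabilityMeasure ν →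
      ∫ ξ, charFun μ (√(2 * t) • ξ) * (starRingEnd ℂ) (charFun ν (√(2 * t) • ξ)) ∂(stdGaussian (Euc d)) =
      (gInt d t μ ν : ℂ) := by
    intro μ ν _ _
    rw [gauss_fourier, hc]; rfl
  rw [← Complex.ofReal_inj, ← integral_complex_ofReal]
  have e : ∀ ξ : Euc d, ((‖charFun μ (√(2 * t) • ξ) - charFun ν (√(2 * t) • ξ)‖ ^ 2 : ℝ) : ℂ) =
      charFun μ (√(2 * t) • ξ) * (starRingEnd ℂ) (charFun μ (√(2 * t) • ξ))
      - charFun μ (√(2 * t) • ξ) * (starRingEnd ℂ) (charFun ν (√(2 * t) • ξ))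
      - charFun ν (√(2 * t) • ξ) * (starRingEnd ℂ) (charFun μ (√(2 * t) • ξ))
      + charFun ν (√(2 * t) • ξ) * (starRingEnd ℂ) (charFun ν (√(2 * t) • ξ)) := by
    intro ξ
    push_cast
    rw [← Complex.mul_conj', map_sub]
    ring
  simp_rw [e]
  have i1 := integrable_charFun_mul d √(2*t) μ μ
  have i2 := integrable_charFun_mul d √(2*t) μ ν
  have i3 := integrable_charFun_mul d √(2*t) ν μ
  have i4 := integrable_charFun_mul d √(2*t) ν ν
  rw [integral_lin4 i1 i2 i3 i4,
    key _ _ ‹_› ‹_›, key _ _ ‹_› ‹_›, key _ _ ‹_› ‹_›, key _ _ ‹_› ‹_›, hsym]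
  unfold gDis
  push_cast
  ring

lemma gDis_nonneg (d : ℕ) (t : ℝ) (ht : 0 ≤ t) (μ ν : Measure (Euc d))
    [IsProbabilityMeasure μ] [IsProbabilityMeasure ν] : 0 ≤ gDis d t μ ν := by
  rw [gDis_eq d t ht]
  exact integral_nonneg fun _ => by positivity

/-- tail constant -/
def delT (d : ℕ) (T : ℝ) : ℝ := aC d * ((volB d)⁻¹ * Real.pi ^ ((d : ℝ) / 2) * T⁻¹)

lemma gauss_ub (d : ℕ) (t : ℝ) (ht : 0 < t) (x : Euc d) :
    ∫ y, Real.exp (-(t * ‖x - y‖ ^ 2)) ∂(uniformBall d 0) ≤ (volB d)⁻¹ * (Real.pi / t) ^ ((d : ℝ) / 2) := by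
  rw [integral_uniformBall]
  have h := GaussianFourier.integral_rexp_neg_mul_sq_norm (V := Euc d) ht
  have hne : ∫ v : Euc d, Real.exp (-t * ‖v‖ ^ 2) ≠ 0 := by
    rw [h]
    have : 0 < Real.pi / t := div_pos Real.pi_pos ht
    exact (Real.rpow_pos_of_pos this _).ne'
  have hi : Integrable (fun v : Euc d => Real.exp (-t * ‖v‖ ^ 2)) := by
    by_contra hc
    exact hne (integral_undef hc)
  have hi2 : Integrable (fun y : Euc d => Real.exp (-(t * ‖x - y‖ ^ 2))) := by
    have := hi.comp_sub_left x
    simpa [neg_mul] using this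
  have h2 : ∫ y : Euc d, Real.exp (-(t * ‖x - y‖ ^ 2)) = (Real.pi / t) ^ ((d : ℝ) / 2) := by
    have := integral_sub_left_eq_self (fun v : Euc d => Real.exp (-t * ‖v‖ ^ 2)) volume x
    rw [h, finrank_euclideanSpace_fin] at this
    rw [← this]
    simp [neg_mul]
  rw [← h2]
  gcongr
  · have := volB_pos d; positivity
  · exact Eventually.of_forall fun _ => by positivity
  · exact Measure.restrict_le_self

lemma tail_bound (d : ℕ) (T : ℝ) (hT : 0 < T) (x : Euc d) :
    Integrable (fun y => ∫ t in Set.Ioi T, Real.exp (-(t * ‖x - y‖ ^ 2)) * wt d t) (uniformBall d 0) ∧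
    ∫ y, (∫ t in Set.Ioi T, Real.exp (-(t * ‖x - y‖ ^ 2)) * wt d t) ∂(uniformBall d 0) ≤
      (volB d)⁻¹ * Real.pi ^ ((d : ℝ) / 2) * T⁻¹ := by
  have hm : Measurable (fun p : Euc d × ℝ => Real.exp (-(p.2 * ‖x - p.1‖ ^ 2)) * wt d p.2) := by
    unfold wt; fun_prop
  have hb : ∀ t, 0 < t → ∫ y, Real.exp (-(t * ‖x - y‖ ^ 2)) * wt d t ∂(uniformBall d 0) ≤
      (volB d)⁻¹ * Real.pi ^ ((d : ℝ) / 2) * t ^ (-2 : ℝ) := by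
    intro t ht
    rw [integral_mul_const]
    calc _ ≤ (volB d)⁻¹ * (Real.pi / t) ^ ((d : ℝ) / 2) * wt d t := by
          gcongr
          · exact (wt_pos d t ht).le
          · exact gauss_ub d t ht x
      _ = _ := by
          unfold wt
          rw [Real.div_rpow Real.pi_pos.le ht.le, mul_assoc, mul_assoc, div_mul_eq_mul_div, mul_div_assoc,
            ← Real.rpow_sub ht]
          congr 3
          ring
  have hi2 : IntegrableOn (fun t : ℝ => (volB d)⁻¹ * Real.pi ^ ((d : ℝ) / 2) * t ^ (-2 : ℝ)) (Set.Ioi T) :=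
    (integrableOn_Ioi_rpow_of_lt (by norm_num) hT).const_mul _
  have hIntg : Integrable (fun p : Euc d × ℝ => Real.exp (-(p.2 * ‖x - p.1‖ ^ 2)) * wt d p.2)
      ((uniformBall d 0).prod (volume.restrict (Set.Ioi T))) := by
    rw [integrable_prod_iff' hm.aestronglyMeasurable]
    constructor
    · filter_upwards [ae_restrict_mem measurableSet_Ioi] with t ht
      have ht0 : 0 < t := hT.trans ht
      exact (integrable_exp_gen _ t ht0.le (fun y => ‖x - y‖ ^ 2) (by fun_prop) (fun _ => by positivity)).mul_const _
    · refine hi2.mono' ?_ ?_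
      · exact (StronglyMeasurable.integral_prod_right' (f := fun q : ℝ × Euc d => ‖Real.exp (-(q.1 * ‖x - q.2‖ ^ 2)) * wt d q.1‖)
          (hm.norm.comp measurable_swap).stronglyMeasurable).aestronglyMeasurable
      · filter_upwards [ae_restrict_mem measurableSet_Ioi] with t ht
        have ht0 : 0 < t := hT.trans ht
        have hw := wt_pos d t ht0
        have : ∀ y, ‖Real.exp (-(t * ‖x - y‖ ^ 2)) * wt d t‖ = Real.exp (-(t * ‖x - y‖ ^ 2)) * wt d t := by
          intro y
          exact Real.norm_of_nonneg (by positivity)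
        simp only [this]
        rw [Real.norm_of_nonneg (integral_nonneg fun _ => by positivity)]
        exact hb t ht0
  refine ⟨hIntg.integral_prod_left, ?_⟩
  rw [integral_integral_swap hIntg]
  have h3 : ∫ t in Set.Ioi T, (volB d)⁻¹ * Real.pi ^ ((d : ℝ) / 2) * t ^ (-2 : ℝ) =
      (volB d)⁻¹ * Real.pi ^ ((d : ℝ) / 2) * T⁻¹ := by
    rw [integral_const_mul, integral_Ioi_rpow_of_lt (by norm_num) hT]
    norm_num [Real.rpow_neg_one]
  rw [← h3]
  apply setIntegral_mono_on hIntg.integral_prod_right hi2 measurableSet_Ioi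
  intro t ht
  exact hb t (hT.trans ht)

lemma integrable_gT_ub (d : ℕ) (hd : 2 ≤ d) (T : ℝ) (hT : 0 ≤ T) (x : Euc d) :
    Integrable (fun y => gT d T (‖x - y‖ ^ 2)) (uniformBall d 0) := by
  refine (gT_fubini (uniformBall d 0) d hd T hT (fun y => ‖x - y‖ ^ 2) (by fun_prop) (fun _ => by positivity) ?_).1
  apply Integrable.of_bound (C := (‖x‖ + 1) ^ 2) (by fun_prop)
  filter_upwards [ae_uniformBall d] with y hy
  rw [Real.norm_of_nonneg (by positivity)]
  gcongr
  exact (norm_sub_le _ _).trans (by linarith)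

lemma gT_pot_ge (d : ℕ) (hd : 2 ≤ d) (T : ℝ) (hT : 0 < T) (x : Euc d) :
    potU d x - delT d T ≤ ∫ y, gT d T (‖x - y‖ ^ 2) ∂(uniformBall d 0) := by
  obtain ⟨h1, h2⟩ := tail_bound d T hT x
  have hi := integrable_gT_ub d hd T hT.le x
  have hne : ∀ᵐ y ∂(uniformBall d 0), x - y ≠ 0 := by
    apply (uniformBall_ac d 0).ae_le
    have := nontrivial_Euc d hd
    filter_upwards [compl_mem_ae_iff.2 (measure_singleton (μ := (volume : Measure (Euc d))) x)] with y hy h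
    exact hy (sub_eq_zero.1 h).symm
  have h3 : potU d x ≤ ∫ y, (gT d T (‖x - y‖ ^ 2) + aC d * ∫ t in Set.Ioi T, Real.exp (-(t * ‖x - y‖ ^ 2)) * wt d t)
      ∂(uniformBall d 0) := by
    apply integral_mono_ae (integrable_coulombKR_ub d hd x) (hi.add (h1.const_mul _))
    filter_upwards [hne] with y hy
    exact gT_ge d hd T hT (x - y) hy
  rw [integral_add hi (h1.const_mul _), integral_const_mul] at h3
  have := mul_le_mul_of_nonneg_left h2 (aC_pos d hd).le
  unfold delT
  linarith

lemma gT_self_le (d : ℕ) (hd : 2 ≤ d) (T : ℝ) (hT : 0 < T) :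
    jT d T (uniformBall d 0) (uniformBall d 0) ≤ selfJ d + epsT d T := by
  rw [selfJ_eq d hd]
  have h1 : Integrable (fun p : Euc d × Euc d => gT d T (‖p.1 - p.2‖ ^ 2)) ((uniformBall d 0).prod (uniformBall d 0)) :=
    (gT_fubini _ d hd T hT.le _ (measurable_nsq d) (fun _ => by positivity)
      (integrable_normsq_prod d _ _ (integrable_normsq_ub d) (integrable_normsq_ub d))).1
  have h2 := integrable_coulombKR_prod d hd
  have : ∫ q : Euc d × Euc d, (coulombKR d (q.1 - q.2) + epsT d T) ∂((uniformBall d 0).prod (uniformBall d 0)) =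
      (∫ q : Euc d × Euc d, coulombKR d (q.1 - q.2) ∂((uniformBall d 0).prod (uniformBall d 0))) + epsT d T := by
    rw [integral_add h2 (integrable_const _)]
    simp
  rw [← this]
  apply integral_mono_ae h1 (h2.add (integrable_const _))
  have hne : ∀ᵐ p ∂((uniformBall d 0).prod (uniformBall d 0)), p.1 - p.2 ≠ (0 : Euc d) := by
    have hms : MeasurableSet {p : Euc d × Euc d | p.1 - p.2 ≠ 0} :=
      (measurable_fst.sub measurable_snd) (measurableSet_singleton 0).compl
    rw [Measure.ae_prod_iff_ae_ae hms]
    refine Eventually.of_forall fun x => ?_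
    apply (uniformBall_ac d 0).ae_le
    have := nontrivial_Euc d hd
    filter_upwards [compl_mem_ae_iff.2 (measure_singleton (μ := (volume : Measure (Euc d))) x)] with y hy h
    exact hy (sub_eq_zero.1 h).symm
  filter_upwards [hne] with p hp
  have := gT_le d hd T hT _ hp
  show _ ≤ coulombKR d (p.1 - p.2) + epsT d T
  linarith

instance instProbEmp (d n : ℕ) [NeZero n] (x : Fin n → Euc d) : IsProbabilityMeasure (empMeas d n x) := by
  constructor
  unfold empMeas
  have : (n : ℝ≥0∞) ≠ 0 := by exact_mod_cast NeZero.ne n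
  simp [ENNReal.inv_mul_cancel this (ENNReal.natCast_ne_top n)]

lemma integrable_emp {E : Type*} [NormedAddCommGroup E] (d n : ℕ) [NeZero n] (x : Fin n → Euc d) (f : Euc d → E) :
    Integrable f (empMeas d n x) := by
  unfold empMeas
  apply Integrable.smul_measure
  · rw [integrable_finsetSum_measure]
    intro i _
    exact integrable_dirac (by simp)
  · simpa using NeZero.ne n

lemma integral_emp {E : Type*} [NormedAddCommGroup E] [NormedSpace ℝ E] [CompleteSpace E]
    (d n : ℕ) (x : Fin n → Euc d) (f : Euc d → E) :
    ∫ y, f y ∂(empMeas d n x) = (n : ℝ)⁻¹ • ∑ i, f (x i) := by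
  unfold empMeas
  rw [integral_smul_measure, integral_finsetSum_measure]
  · simp
  · intro i _
    exact integrable_dirac (by simp)

lemma integrable_jT (d : ℕ) (hd : 2 ≤ d) (T : ℝ) (hT : 0 ≤ T) (μ ν : Measure (Euc d))
    [IsProbabilityMeasure μ] [IsProbabilityMeasure ν]
    (hμ : Integrable (fun x => ‖x‖ ^ 2) μ) (hν : Integrable (fun x => ‖x‖ ^ 2) ν) :
    Integrable (fun p : Euc d × Euc d => gT d T (‖p.1 - p.2‖ ^ 2)) (μ.prod ν) :=
  (gT_fubini _ d hd T hT _ (measurable_nsq d) (fun _ => by positivity) (integrable_normsq_prod d μ ν hμ hν)).1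

/-- quantity controlling the discrepancy -/
def QQ (d n : ℕ) (x : Fin n → Euc d) : ℝ :=
  aC d * ∫ t in Set.Ioc (1/2 : ℝ) 1, gDis d t (empMeas d n x) (uniformBall d 0) * wt d t

lemma hamiltonian_ge (d : ℕ) (hd : 2 ≤ d) (n : ℕ) (hn : 1 ≤ n) (x : Fin n → Euc d) (hx : Function.Injective x)
    (T : ℝ) (hT : 1 ≤ T) :
    eqI d + QQ d n x - (2 * delT d T + 2 * epsT d T + gT d T 0 / n) ≤ hamiltonian d n (fun y => ‖y‖ ^ 2) x := by
  have : NeZero n := ⟨by omega⟩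
  have hn0 : (0:ℝ) < n := by exact_mod_cast hn
  have hT0 : 0 < T := by linarith
  set μ := empMeas d n x with hμ
  set ν := uniformBall d 0 with hν
  have iμ : Integrable (fun x => ‖x‖ ^ 2) μ := integrable_emp d n x _
  have iν : Integrable (fun x => ‖x‖ ^ 2) ν := integrable_normsq_ub d
  obtain ⟨hIntg, hjd⟩ := jT_diff d hd T hT0.le μ ν iμ iν
  -- Q bound
  have hQ : QQ d n x ≤ jT d T μ μ - 2 * jT d T μ ν + jT d T ν ν := by
    rw [hjd]
    unfold QQ
    apply mul_le_mul_of_nonneg_left _ (aC_pos d hd).le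
    apply setIntegral_mono_set hIntg
    · filter_upwards [ae_restrict_mem measurableSet_Ioc] with t ht
      exact mul_nonneg (gDis_nonneg d t ht.1.le μ ν) (wt_pos d t ht.1).le
    · apply HasSubset.Subset.eventuallyLE
      intro t ht
      exact ⟨by have := ht.1; linarith, ht.2.trans hT⟩
  -- jT μ ν
  have h1 : jT d T μ ν ≥ (n:ℝ)⁻¹ * ∑ i, (potU d (x i) - delT d T) := by
    unfold jT
    rw [integral_prod _ (integrable_jT d hd T hT0.le μ ν iμ iν), integral_emp, smul_eq_mul]
    gcongr with i
    exact gT_pot_ge d hd T hT0 (x i)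
  have h1' : (n:ℝ)⁻¹ * ∑ i, (potU d (x i) - delT d T) = (n:ℝ)⁻¹ * ∑ i, potU d (x i) - delT d T := by
    rw [Finset.sum_sub_distrib]
    simp only [Finset.sum_const, Finset.card_univ, Fintype.card_fin, nsmul_eq_mul]
    field_simp
  have h2 := gT_self_le d hd T hT0
  -- jT μ μ
  have h3 : jT d T μ μ = (1 / (n:ℝ) ^ 2) * ∑ q : Fin n × Fin n, gT d T (‖x q.1 - x q.2‖ ^ 2) := by
    unfold jT
    rw [integral_prod _ (integrable_jT d hd T hT0.le μ μ iμ iμ), integral_emp, smul_eq_mul, Fintype.sum_prod_type]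
    simp only [hμ, integral_emp, smul_eq_mul]
    rw [← Finset.mul_sum, ← mul_assoc]
    congr 1
    field_simp
  have h4 : ∑ q : Fin n × Fin n, gT d T (‖x q.1 - x q.2‖ ^ 2) ≤
      (∑ q ∈ Finset.univ.filter (fun q : Fin n × Fin n => q.1 ≠ q.2), coulombKR d (x q.1 - x q.2)) +
        (n:ℝ)^2 * epsT d T + n * gT d T 0 := by
    rw [← Finset.sum_filter_add_sum_filter_not Finset.univ (fun q : Fin n × Fin n => q.1 ≠ q.2)]
    have e := epsT_nonneg d hd T hT0
    have a1 : ∑ q ∈ Finset.univ.filter (fun q : Fin n × Fin n => q.1 ≠ q.2), gT d T (‖x q.1 - x q.2‖ ^ 2) ≤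
        ∑ q ∈ Finset.univ.filter (fun q : Fin n × Fin n => q.1 ≠ q.2), (coulombKR d (x q.1 - x q.2) + epsT d T) := by
      apply Finset.sum_le_sum
      intro q hq
      have hq' : q.1 ≠ q.2 := (Finset.mem_filter.1 hq).2
      have := gT_le d hd T hT0 (x q.1 - x q.2) (sub_ne_zero.2 (fun h => hq' (hx h)))
      linarith
    rw [Finset.sum_add_distrib] at a1
    have a2 : ∑ q ∈ Finset.univ.filter (fun q : Fin n × Fin n => q.1 ≠ q.2), epsT d T ≤ (n:ℝ)^2 * epsT d T := by
      rw [Finset.sum_const, nsmul_eq_mul]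
      gcongr
      have := Finset.card_filter_le (Finset.univ : Finset (Fin n × Fin n)) (fun q => q.1 ≠ q.2)
      simp only [Finset.card_univ, Fintype.card_prod, Fintype.card_fin] at this
      rw [sq]
      exact_mod_cast this
    have a3 : ∑ q ∈ Finset.univ.filter (fun q : Fin n × Fin n => ¬ q.1 ≠ q.2), gT d T (‖x q.1 - x q.2‖ ^ 2) = n * gT d T 0 := by
      rw [Finset.sum_filter, Fintype.sum_prod_type]
      simp [eq_comm]
    linarith
  have h5 : jT d T μ μ ≤ (1 / (n : ℝ) ^ 2) *
        (∑ q ∈ Finset.univ.filter (fun q : Fin n × Fin n => q.1 ≠ q.2), coulombKR d (x q.1 - x q.2)) +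
        epsT d T + gT d T 0 / n := by
    rw [h3]
    refine (mul_le_mul_of_nonneg_left h4 (by positivity)).trans (le_of_eq ?_)
    field_simp
  have h6 : 2 * potU d 0 ≤ (1 / (n:ℝ)) * ∑ i, ‖x i‖ ^ 2 + 2 * ((n:ℝ)⁻¹ * ∑ i, potU d (x i)) := by
    have : (1 / (n:ℝ)) * ∑ i, ‖x i‖ ^ 2 + 2 * ((n:ℝ)⁻¹ * ∑ i, potU d (x i)) =
        (n:ℝ)⁻¹ * ∑ i, (‖x i‖ ^ 2 + 2 * potU d (x i)) := by
      rw [Finset.sum_add_distrib, ← Finset.mul_sum]; ring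
    rw [this]
    have h7 : ∑ i : Fin n, 2 * potU d 0 ≤ ∑ i, (‖x i‖ ^ 2 + 2 * potU d (x i)) :=
      Finset.sum_le_sum fun i _ => effpot_ge d hd (x i)
    simp only [Finset.sum_const, Finset.card_univ, Fintype.card_fin, nsmul_eq_mul] at h7
    rw [inv_mul_eq_div, le_div_iff₀ hn0]
    linarith
  have h8 := eqI_eq d hd
  unfold hamiltonian
  rw [h1'] at h1
  simp only [← hν] at h2
  linarith

open ProbabilityTheory in
lemma stdGaussian_openPos (d : ℕ) : (stdGaussian (Euc d)).IsOpenPosMeasure := by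
  have h1 : (gaussianReal 0 1).IsOpenPosMeasure :=
    (gaussianReal_absolutelyContinuous' 0 one_ne_zero).isOpenPosMeasure
  rw [← map_pi_eq_stdGaussian]
  exact Continuous.isOpenPosMeasure_map (PiLp.continuous_toLp 2 _) (WithLp.toLp_surjective 2)

lemma norm_cexp_sub_le (a b : ℝ) : ‖Complex.exp (a * Complex.I) - Complex.exp (b * Complex.I)‖ ≤ |a - b| := by
  have : Complex.exp (a * Complex.I) - Complex.exp (b * Complex.I) =
      Complex.exp (Complex.I * b) * (Complex.exp (Complex.I * ((a - b : ℝ) : ℂ)) - 1) := by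
    rw [mul_sub, ← Complex.exp_add]
    push_cast
    congr 1
    · congr 1; ring
    · rw [mul_comm, mul_one]
  rw [this, norm_mul, Complex.norm_exp_I_mul_ofReal, one_mul]
  exact Real.norm_exp_I_mul_ofReal_sub_one_le

lemma charFun_lip (d : ℕ) (μ : Measure (Euc d)) [IsProbabilityMeasure μ] (h : Integrable (fun x => ‖x‖) μ)
    (a b : Euc d) : ‖charFun μ a - charFun μ b‖ ≤ ‖a - b‖ * ∫ x, ‖x‖ ∂μ := by
  rw [charFun_apply, charFun_apply]
  have hi : ∀ a : Euc d, Integrable (fun x : Euc d => Complex.exp (⟪x, a⟫ * Complex.I)) μ := by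
    intro a
    apply Integrable.of_bound (C := 1) (by fun_prop)
    exact Eventually.of_forall fun x => by rw [Complex.norm_exp_ofReal_mul_I]
  rw [← integral_sub (hi a) (hi b), ← integral_const_mul]
  apply norm_integral_le_of_norm_le (h.const_mul _)
  refine Eventually.of_forall fun x => (norm_cexp_sub_le _ _).trans ?_
  rw [← inner_sub_right, mul_comm]
  exact abs_real_inner_le_norm x (a - b)

lemma wt_ge (d : ℕ) (t : ℝ) (h1 : 1/2 ≤ t) (h2 : t ≤ 1) : (1/2 : ℝ) ^ ((d:ℝ)/2) ≤ wt d t := by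
  unfold wt
  calc (1/2 : ℝ) ^ ((d:ℝ)/2) ≤ t ^ ((d:ℝ)/2) := by gcongr
    _ ≤ t ^ ((d:ℝ)/2 - 2) := Real.rpow_le_rpow_of_exponent_ge (by linarith) h2 (by linarith)

open ProbabilityTheory in
lemma QQ_lower (d : ℕ) (hd : 2 ≤ d) (ξ : Euc d) (K : ℝ) (hK : 0 ≤ K) (ε : ℝ) (hε : 0 < ε) :
    ∃ c > 0, ∀ n, 1 ≤ n → ∀ x : Fin n → Euc d, (n:ℝ)⁻¹ * ∑ i, ‖x i‖ ≤ K →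
      ε ≤ ‖charFun (empMeas d n x) ξ - charFun (uniformBall d 0) ξ‖ → c ≤ QQ d n x := by
  set r := ε / (2 * (K + 1)) with hr
  have hr0 : 0 < r := by positivity
  set η := min (1/2) (r / (4 * (‖ξ‖ + 1))) with hη
  have hη0 : 0 < η := by positivity
  have hη1 : η ≤ 1/2 := min_le_left _ _
  have hη2 : η * (4 * (‖ξ‖ + 1)) ≤ r := by
    rw [← le_div_iff₀ (by positivity)]
    exact min_le_right _ _
  have hop := stdGaussian_openPos d
  set γ := (stdGaussian (Euc d)).real (ball ξ (r/4)) with hγ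
  have hγ0 : 0 < γ := by
    apply ENNReal.toReal_pos
    · exact (isOpen_ball.measure_pos _ ⟨ξ, mem_ball_self (by positivity)⟩).ne'
    · exact measure_ne_top _ _
  refine ⟨aC d * (η * ((ε/2)^2 * γ * (1/2 : ℝ) ^ ((d:ℝ)/2))), ?_, ?_⟩
  · have := aC_pos d hd
    positivity
  intro n hn x hx hD
  have : NeZero n := ⟨by omega⟩
  set μ := empMeas d n x with hμ
  set ν := uniformBall d 0 with hν
  have iμ : Integrable (fun x => ‖x‖ ^ 2) μ := integrable_emp d n x _
  have iν : Integrable (fun x => ‖x‖ ^ 2) ν := integrable_normsq_ub d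
  have iμ1 : Integrable (fun x => ‖x‖) μ := integrable_emp d n x _
  have iν1 : Integrable (fun x => ‖x‖) ν := by
    apply Integrable.of_bound (C := 1) (by fun_prop)
    filter_upwards [ae_uniformBall d] with x hx
    simpa using hx
  have mν : ∫ x, ‖x‖ ∂ν ≤ 1 := by
    have : ∫ x, ‖x‖ ∂ν ≤ ∫ x, (1:ℝ) ∂ν := by
      apply integral_mono_ae iν1 (integrable_const _)
      exact ae_uniformBall d
    simpa using this
  have mμ : ∫ x, ‖x‖ ∂μ ≤ K := by rw [hμ, integral_emp]; exact hx
  have hD2 : ∀ η' : Euc d, ‖η' - ξ‖ ≤ r → ε / 2 ≤ ‖charFun μ η' - charFun ν η'‖ := by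
    intro η' h
    have a1 := charFun_lip d μ iμ1 ξ η'
    have a2 := charFun_lip d ν iν1 η' ξ
    have a3 : ‖charFun μ ξ - charFun ν ξ‖ ≤ ‖charFun μ ξ - charFun μ η'‖ + ‖charFun μ η' - charFun ν η'‖ +
        ‖charFun ν η' - charFun ν ξ‖ := by
      have : charFun μ ξ - charFun ν ξ = (charFun μ ξ - charFun μ η') + (charFun μ η' - charFun ν η') +
        (charFun ν η' - charFun ν ξ) := by ring
      rw [this]
      exact norm_add₃_le
    rw [norm_sub_rev] at h
    have a4 : ‖ξ - η'‖ * ∫ x, ‖x‖ ∂μ ≤ r * K := by gcongr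
    have a5 : ‖η' - ξ‖ * ∫ x, ‖x‖ ∂ν ≤ r * 1 := by rw [norm_sub_rev]; gcongr
    have a6 : r * (K + 1) = ε / 2 := by rw [hr]; field_simp
    linarith
  have hdis : ∀ t ∈ Set.Ioc (1/2 : ℝ) (1/2 + η), (ε/2)^2 * γ ≤ gDis d t μ ν := by
    intro t ht
    have ht0 : 0 ≤ t := by linarith [ht.1]
    rw [gDis_eq d t ht0]
    set s := √(2 * t) with hs
    have hs2 : s ^ 2 = 2 * t := Real.sq_sqrt (by linarith)
    have hs0 : 0 ≤ s := Real.sqrt_nonneg _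
    have hs1 : 1 ≤ s := by nlinarith [ht.1]
    have hs3 : s ≤ 2 := by nlinarith [ht.2]
    have hs4 : s - 1 ≤ 2 * η := by nlinarith [ht.2]
    have hb : ∀ z : Euc d, ‖charFun μ (s • z) - charFun ν (s • z)‖ ^ 2 ≤ 4 := by
      intro z
      have : ‖charFun μ (s • z) - charFun ν (s • z)‖ ≤ 2 := by
        refine (norm_sub_le _ _).trans ?_
        have := norm_charFun_le_one (μ := μ) (s • z)
        have := norm_charFun_le_one (μ := ν) (s • z)
        linarith
      nlinarith [norm_nonneg (charFun μ (s • z) - charFun ν (s • z))]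
    have hIntg : Integrable (fun z : Euc d => ‖charFun μ (s • z) - charFun ν (s • z)‖ ^ 2) (stdGaussian (Euc d)) := by
      apply Integrable.of_bound (C := 4)
      · apply Continuous.aestronglyMeasurable
        have := continuous_charFun (μ := μ)
        have := continuous_charFun (μ := ν)
        fun_prop
      · refine Eventually.of_forall fun z => ?_
        rw [Real.norm_of_nonneg (by positivity)]
        exact hb z
    calc (ε/2)^2 * γ = ∫ z in ball ξ (r/4), (ε/2)^2 ∂(stdGaussian (Euc d)) := by
          rw [setIntegral_const, smul_eq_mul, mul_comm]
      _ ≤ ∫ z in ball ξ (r/4), ‖charFun μ (s • z) - charFun ν (s • z)‖ ^ 2 ∂(stdGaussian (Euc d)) := by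
          apply setIntegral_mono_on (integrable_const _).integrableOn hIntg.integrableOn measurableSet_ball
          intro z hz
          gcongr
          apply hD2
          have hz' : ‖z - ξ‖ < r/4 := by simpa [dist_eq_norm] using hz
          have e : s • z - ξ = s • (z - ξ) + (s - 1) • ξ := by rw [smul_sub, sub_smul, one_smul]; abel
          rw [e]
          refine (norm_add_le _ _).trans ?_
          rw [norm_smul, norm_smul, Real.norm_of_nonneg hs0, Real.norm_of_nonneg (by linarith)]
          have : s * ‖z - ξ‖ ≤ 2 * (r/4) := by gcongr
          have : (s - 1) * ‖ξ‖ ≤ 2 * η * (‖ξ‖ + 1) := by gcongr; linarith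
          linarith
      _ ≤ _ := setIntegral_le_integral hIntg (Eventually.of_forall fun z => by positivity)
  unfold QQ
  gcongr
  · exact (aC_pos d hd).le
  have hIntg := (jT_diff d hd 1 zero_le_one μ ν iμ iν).1
  have hsub : Set.Ioc (1/2 : ℝ) (1/2 + η) ⊆ Set.Ioc (1/2 : ℝ) 1 := Set.Ioc_subset_Ioc_right (by linarith)
  have hIntg' : IntegrableOn (fun t => gDis d t μ ν * wt d t) (Set.Ioc (1/2 : ℝ) 1) :=
    hIntg.mono_set (Set.Ioc_subset_Ioc_left (by norm_num))
  calc η * ((ε/2)^2 * γ * (1/2 : ℝ) ^ ((d:ℝ)/2))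
      = ∫ t in Set.Ioc (1/2 : ℝ) (1/2 + η), (ε/2)^2 * γ * (1/2 : ℝ) ^ ((d:ℝ)/2) := by
        rw [setIntegral_const, smul_eq_mul, Real.volume_real_Ioc_of_le (by linarith)]
        ring
    _ ≤ ∫ t in Set.Ioc (1/2 : ℝ) (1/2 + η), gDis d t μ ν * wt d t := by
        apply setIntegral_mono_on (integrableOn_const measure_Ioc_lt_top.ne) (hIntg'.mono_set hsub) measurableSet_Ioc
        intro t ht
        have := hdis t ht
        have := wt_ge d t ht.1.le (by linarith [ht.2])
        gcongr
        exact gDis_nonneg d t (by linarith [ht.1]) μ ν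
    _ ≤ _ := by
        apply setIntegral_mono_set hIntg'
        · filter_upwards [ae_restrict_mem measurableSet_Ioc] with t ht
          exact mul_nonneg (gDis_nonneg d t (by linarith [ht.1]) μ ν) (wt_pos d t (by linarith [ht.1])).le
        · exact Eventually.of_forall hsub

lemma delT_tendsto (d : ℕ) : Tendsto (delT d) atTop (𝓝 0) := by
  unfold delT
  have := (tendsto_inv_atTop_zero (𝕜 := ℝ)).const_mul ((volB d)⁻¹ * Real.pi ^ ((d : ℝ) / 2))
  simpa using this.const_mul (aC d)

/-- deterministic convergence of characteristic functions -/
lemma charFun_conv (d : ℕ) (hd : 2 ≤ d) (x : (n : ℕ) → Fin n → Euc d)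
    (hinj : ∀ᶠ n in atTop, Function.Injective (x n))
    (hH : ∀ ε > 0, ∀ᶠ n in atTop, hamiltonian d n (fun y => ‖y‖ ^ 2) (x n) ≤ eqI d + ε)
    (K : ℝ) (hK : 0 ≤ K) (hm : ∀ᶠ n : ℕ in atTop, (n:ℝ)⁻¹ * ∑ i, ‖x n i‖ ≤ K) (ξ : Euc d) :
    Tendsto (fun n => charFun (empMeas d n (x n)) ξ) atTop (𝓝 (charFun (uniformBall d 0) ξ)) := by
  rw [tendsto_iff_norm_sub_tendsto_zero]
  rw [Metric.tendsto_atTop']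
  intro ε hε
  obtain ⟨c, hc, hlow⟩ := QQ_lower d hd ξ K hK ε hε
  have h1 : Tendsto (fun T => 2 * delT d T + 2 * epsT d T) atTop (𝓝 0) := by
    simpa using ((delT_tendsto d).const_mul 2).add ((epsT_tendsto d).const_mul 2)
  obtain ⟨T, hT1, hT2⟩ := ((h1.eventually (gt_mem_nhds (show (0:ℝ) < c/4 by positivity))).and (eventually_ge_atTop 1)).exists
  have h2 : Tendsto (fun n : ℕ => gT d T 0 / n) atTop (𝓝 0) := tendsto_const_div_atTop_nhds_zero_nat _
  have h3 := h2.eventually (gt_mem_nhds (show (0:ℝ) < c/4 by positivity))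
  have h4 : ∀ᶠ n in atTop, ‖charFun (empMeas d n (x n)) ξ - charFun (uniformBall d 0) ξ‖ < ε := by
    filter_upwards [hinj, hH (c/4) (by positivity), hm, h3, eventually_ge_atTop 1] with n a1 a2 a3 a4 a5
    by_contra hcon
    have b1 := hlow n a5 (x n) a3 (not_lt.1 hcon)
    have b2 := hamiltonian_ge d hd n a5 (x n) a1 T hT2
    linarith
  obtain ⟨N, hN⟩ := eventually_atTop.1 h4
  refine ⟨N, fun n hn => ?_⟩
  rw [Real.dist_0_eq_abs, abs_norm]
  exact hN n hn.le

/-- cost of the optimal coupling -/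
def costInf (d : ℕ) (p : ℝ) (μ ν : Measure (Euc d)) : ℝ≥0∞ :=
  ⨅ π ∈ Couplings d μ ν, ∫⁻ q : Euc d × Euc d, ENNReal.ofReal (‖q.1 - q.2‖ ^ p) ∂π

/-- coupling coefficient -/
def gco (a b : ℝ≥0∞) : ℝ≥0∞ := min a b / (a * b)

lemma gco_mul (a b : ℝ≥0∞) (ha : a ≤ 1) (hb : b ≤ 1) : gco a b * a * b = min a b := by
  unfold gco
  by_cases h : a * b = 0
  · rcases mul_eq_zero.1 h with h | h <;> simp [h]
  · rw [mul_assoc, ENNReal.div_mul_cancel h]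
    exact ENNReal.mul_ne_top (ha.trans_lt ENNReal.one_lt_top).ne (hb.trans_lt ENNReal.one_lt_top).ne

lemma gco_comm (a b : ℝ≥0∞) : gco a b = gco b a := by unfold gco; rw [min_comm, mul_comm]

lemma gco_le (a b : ℝ≥0∞) (ha : a ≤ 1) (hb : b ≤ 1) : gco a b * b ≤ 1 := by
  by_cases h : a = 0
  · simp [h, gco]
  · have h1 := gco_mul a b ha hb
    have ha' : a ≠ ⊤ := (ha.trans_lt ENNReal.one_lt_top).ne
    have h2 : gco a b * b * a ≤ 1 * a := by
      rw [one_mul, mul_right_comm, h1]; exact min_le_left _ _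
    exact (ENNReal.mul_le_mul_iff_left h ha').1 h2

lemma rpow_sub_le (p : ℝ) (hp : 0 ≤ p) {E : Type*} [NormedAddCommGroup E] (x y : E) :
    ‖x - y‖ ^ p ≤ 2 ^ p * (‖x‖ ^ p + ‖y‖ ^ p) := by
  calc ‖x - y‖ ^ p ≤ (2 * max ‖x‖ ‖y‖) ^ p := by
        gcongr
        refine (norm_sub_le _ _).trans ?_
        linarith [le_max_left ‖x‖ ‖y‖, le_max_right ‖x‖ ‖y‖]
    _ = 2 ^ p * (max ‖x‖ ‖y‖) ^ p := Real.mul_rpow (by norm_num) (by positivity)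
    _ ≤ _ := by
        gcongr
        have := Real.rpow_nonneg (norm_nonneg x) p
        have := Real.rpow_nonneg (norm_nonneg y) p
        rcases max_choice ‖x‖ ‖y‖ with h | h <;> rw [h] <;> linarith

lemma costInf_le (d : ℕ) (p : ℝ) (hp : 1 ≤ p) (μ ν : Measure (Euc d)) [IsProbabilityMeasure μ] [IsProbabilityMeasure ν]
    {ι : Type*} [Fintype ι] (A : ι → Set (Euc d)) (hA : ∀ i, MeasurableSet (A i))
    (hdisj : Pairwise (Function.onFun Disjoint A)) (hun : ⋃ i, A i = Set.univ) (ε : ℝ) (hε : 0 ≤ ε)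
    (hgood : ∀ i, (∀ x ∈ A i, ∀ y ∈ A i, ‖x - y‖ ≤ ε) ∨ ν (A i) = 0) (hν : ∀ᵐ y ∂ν, ‖y‖ ≤ 1)
    (lam : ℝ) (hlam : 0 < lam) :
    costInf d p μ ν ≤ ENNReal.ofReal (ε ^ p) + ENNReal.ofReal (2 ^ p) * (
      (ENNReal.ofReal lam + 1) * (1 - ∑ i, min (μ (A i)) (ν (A i))) +
        ENNReal.ofReal (lam⁻¹) * ∫⁻ x, ENNReal.ofReal (‖x‖ ^ (2 * p)) ∂μ) := by
  have hp0 : 0 ≤ p := by linarith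
  set a : ι → ℝ≥0∞ := fun i => μ (A i) with ha
  set b : ι → ℝ≥0∞ := fun i => ν (A i) with hb
  have ha1 : ∀ i, a i ≤ 1 := fun i => prob_le_one
  have hb1 : ∀ i, b i ≤ 1 := fun i => prob_le_one
  set g : ι → ℝ≥0∞ := fun i => gco (a i) (b i) with hg
  have hgab : ∀ i, g i * a i * b i = min (a i) (b i) := fun i => gco_mul _ _ (ha1 i) (hb1 i)
  have hga : ∀ i, g i * a i ≤ 1 := fun i => by
    have := gco_le (b i) (a i) (hb1 i) (ha1 i); rw [gco_comm] at this; exact this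
  have hgb : ∀ i, g i * b i ≤ 1 := fun i => gco_le _ _ (ha1 i) (hb1 i)
  have dec : ∀ m : Measure (Euc d), m = ∑ i, m.restrict (A i) := by
    intro m
    rw [← Measure.sum_fintype, ← Measure.restrict_iUnion hdisj hA, hun, Measure.restrict_univ]
  set μ' : Measure (Euc d) := ∑ i, (1 - g i * b i) • μ.restrict (A i) with hμ'
  set ν' : Measure (Euc d) := ∑ i, (1 - g i * a i) • ν.restrict (A i) with hν'
  have hμ1 : μ = ∑ i, (g i * b i) • μ.restrict (A i) + μ' := by
    conv_lhs => rw [dec μ]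
    rw [hμ', ← Finset.sum_add_distrib]
    congr 1; ext1 i
    rw [← add_smul, add_tsub_cancel_of_le (hgb i), one_smul]
  have hν1 : ν = ∑ i, (g i * a i) • ν.restrict (A i) + ν' := by
    conv_lhs => rw [dec ν]
    rw [hν', ← Finset.sum_add_distrib]
    congr 1; ext1 i
    rw [← add_smul, add_tsub_cancel_of_le (hga i), one_smul]
  set r : ℝ≥0∞ := 1 - ∑ i, min (a i) (b i) with hr
  have hmtop : ∑ i, min (a i) (b i) ≠ ⊤ :=
    ENNReal.sum_ne_top.2 fun i _ => ((min_le_left _ _).trans_lt ((ha1 i).trans_lt ENNReal.one_lt_top)).ne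
  have hμ'u : μ' Set.univ = r := by
    have := congrArg (fun m : Measure (Euc d) => m Set.univ) hμ1
    simp only [Measure.add_apply, Measure.finsetSum_apply, Measure.smul_apply, smul_eq_mul, Measure.restrict_apply_univ,
      measure_univ] at this
    have e : ∑ i, g i * b i * μ (A i) = ∑ i, min (a i) (b i) :=
      Finset.sum_congr rfl fun i _ => by rw [← hgab i]; ring
    rw [e] at this
    rw [hr, this, ENNReal.add_sub_cancel_left hmtop]
  have hν'u : ν' Set.univ = r := by
    have := congrArg (fun m : Measure (Euc d) => m Set.univ) hν1
    simp only [Measure.add_apply, Measure.finsetSum_apply, Measure.smul_apply, smul_eq_mul, Measure.restrict_apply_univ,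
      measure_univ] at this
    have e : ∑ i, g i * a i * ν (A i) = ∑ i, min (a i) (b i) :=
      Finset.sum_congr rfl fun i _ => by rw [← hgab i]
    rw [e] at this
    rw [hr, this, ENNReal.add_sub_cancel_left hmtop]
  have hrtop : r ≠ ⊤ := (tsub_le_self.trans_lt ENNReal.one_lt_top).ne
  have fμ' : IsFiniteMeasure μ' := ⟨by rw [hμ'u]; exact hrtop.lt_top⟩
  have fν' : IsFiniteMeasure ν' := ⟨by rw [hν'u]; exact hrtop.lt_top⟩
  have hrr : ∀ m : Measure (Euc d), m Set.univ = r → (r⁻¹ * r) • m = m := by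
    intro m hm
    by_cases h : r = 0
    · rw [h, Measure.measure_univ_eq_zero] at hm
      simp [hm]
    · rw [ENNReal.inv_mul_cancel h hrtop, one_smul]
  set π : Measure (Euc d × Euc d) :=
    ∑ i, g i • (μ.restrict (A i)).prod (ν.restrict (A i)) + r⁻¹ • μ'.prod ν' with hπ
  have hc : π ∈ Couplings d μ ν := by
    constructor
    · rw [hπ, Measure.map_add _ _ measurable_fst, Measure.map_finset_sum measurable_fst.aemeasurable]
      simp only [Measure.map_smul, Measure.map_fst_prod, hν'u, Measure.restrict_apply_univ, smul_smul]
      rw [hrr μ' hμ'u]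
      exact hμ1.symm
    · rw [hπ, Measure.map_add _ _ measurable_snd, Measure.map_finset_sum measurable_snd.aemeasurable]
      simp only [Measure.map_smul, Measure.map_snd_prod, hμ'u, Measure.restrict_apply_univ, smul_smul]
      rw [hrr ν' hν'u]
      exact hν1.symm
  unfold costInf
  refine (iInf₂_le π hc).trans ?_
  rw [hπ, lintegral_add_measure, lintegral_finsetSum_measure]
  simp only [lintegral_smul_measure, smul_eq_mul]
  refine add_le_add ?_ ?_
  · -- near part
    have h1 : ∀ i, g i * ∫⁻ q, ENNReal.ofReal (‖q.1 - q.2‖ ^ p) ∂((μ.restrict (A i)).prod (ν.restrict (A i))) ≤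
        ENNReal.ofReal (ε ^ p) * min (a i) (b i) := by
      intro i
      rcases hgood i with h | h
      · rw [Measure.prod_restrict]
        calc _ ≤ g i * ∫⁻ q in A i ×ˢ A i, ENNReal.ofReal (ε ^ p) ∂(μ.prod ν) := by
              gcongr g i * ?_
              apply setLIntegral_mono' ((hA i).prod (hA i))
              intro q hq
              have := h _ hq.1 _ hq.2
              gcongr
          _ = _ := by
              rw [setLIntegral_const, Measure.prod_prod, ← hgab i]
              ring
      · have : ν.restrict (A i) = 0 := Measure.restrict_eq_zero.2 h
        rw [this]
        simp
    calc _ ≤ ∑ i, ENNReal.ofReal (ε ^ p) * min (a i) (b i) := Finset.sum_le_sum fun i _ => h1 i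
      _ = ENNReal.ofReal (ε ^ p) * ∑ i, min (a i) (b i) := by rw [Finset.mul_sum]
      _ ≤ ENNReal.ofReal (ε ^ p) * 1 := by
          gcongr
          calc ∑ i, min (a i) (b i) ≤ ∑ i, a i := Finset.sum_le_sum fun i _ => min_le_left _ _
            _ = μ Set.univ := by
              conv_rhs => rw [dec μ]
              simp [ha]
            _ = 1 := measure_univ
      _ = _ := mul_one _
  · -- far part
    have hμ'le : μ' ≤ μ := by
      conv_rhs => rw [hμ1]
      exact Measure.le_add_left le_rfl
    have hν'le : ν' ≤ ν := by
      conv_rhs => rw [hν1]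
      exact Measure.le_add_left le_rfl
    have mp : Measurable (fun x : Euc d => ENNReal.ofReal (‖x‖ ^ p)) := by fun_prop
    have e1 : ∫⁻ q : Euc d × Euc d, ENNReal.ofReal (‖q.1 - q.2‖ ^ p) ∂(μ'.prod ν') ≤
        ENNReal.ofReal (2 ^ p) * (r * ∫⁻ x, ENNReal.ofReal (‖x‖ ^ p) ∂μ' + r * ∫⁻ y, ENNReal.ofReal (‖y‖ ^ p) ∂ν') := by
      calc _ ≤ ∫⁻ q : Euc d × Euc d, ENNReal.ofReal (2 ^ p) * (ENNReal.ofReal (‖q.1‖ ^ p) + ENNReal.ofReal (‖q.2‖ ^ p)) ∂(μ'.prod ν') := by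
            apply lintegral_mono
            intro q
            beta_reduce
            rw [← ENNReal.ofReal_add (by positivity) (by positivity), ← ENNReal.ofReal_mul (by positivity)]
            exact ENNReal.ofReal_le_ofReal (rpow_sub_le p hp0 q.1 q.2)
        _ = _ := by
            rw [lintegral_const_mul _ (by fun_prop), lintegral_add_left (by fun_prop)]
            congr 2
            · have := lintegral_prod_mul (μ := μ') (ν := ν') mp.aemeasurable (g := fun _ => 1) aemeasurable_const
              simp only [mul_one, lintegral_one, hν'u] at this
              rw [this, mul_comm]
            · have := lintegral_prod_mul (μ := μ') (ν := ν') (f := fun _ => 1) aemeasurable_const mp.aemeasurable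
              simp only [one_mul, lintegral_one, hμ'u] at this
              rw [this]
    have e2 : ∫⁻ y, ENNReal.ofReal (‖y‖ ^ p) ∂ν' ≤ r := by
      have : ∀ᵐ y ∂ν', ENNReal.ofReal (‖y‖ ^ p) ≤ 1 := by
        filter_upwards [(Measure.absolutelyContinuous_of_le hν'le).ae_le hν] with y hy
        rw [ENNReal.ofReal_le_one]
        exact Real.rpow_le_one (norm_nonneg _) hy hp0
      refine (lintegral_mono_ae this).trans ?_
      rw [lintegral_one, hν'u]
    have e3 : ∫⁻ x, ENNReal.ofReal (‖x‖ ^ p) ∂μ' ≤ ENNReal.ofReal lam * r +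
        ENNReal.ofReal (lam⁻¹) * ∫⁻ x, ENNReal.ofReal (‖x‖ ^ (2 * p)) ∂μ := by
      calc _ ≤ ∫⁻ x, (ENNReal.ofReal lam + ENNReal.ofReal (lam⁻¹) * ENNReal.ofReal (‖x‖ ^ (2 * p))) ∂μ' := by
            apply lintegral_mono
            intro x
            beta_reduce
            rw [← ENNReal.ofReal_mul (by positivity), ← ENNReal.ofReal_add (by positivity) (by positivity)]
            apply ENNReal.ofReal_le_ofReal
            have h0 : 0 ≤ ‖x‖ ^ p := by positivity
            have h2 : ‖x‖ ^ (2 * p) = (‖x‖ ^ p) ^ 2 := by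
              rw [mul_comm, Real.rpow_mul (norm_nonneg _)]; norm_num
            rw [h2]
            have : 0 ≤ lam⁻¹ * (‖x‖ ^ p - lam) ^ 2 := by positivity
            have e : lam⁻¹ * (‖x‖ ^ p - lam) ^ 2 = lam⁻¹ * (‖x‖ ^ p)^2 - 2 * ‖x‖ ^ p + lam := by field_simp; ring
            linarith
        _ = ENNReal.ofReal lam * r + ENNReal.ofReal (lam⁻¹) * ∫⁻ x, ENNReal.ofReal (‖x‖ ^ (2 * p)) ∂μ' := by
            rw [lintegral_add_left measurable_const, lintegral_const, hμ'u, lintegral_const_mul _ (by fun_prop)]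
        _ ≤ _ := by gcongr
    calc r⁻¹ * ∫⁻ q : Euc d × Euc d, ENNReal.ofReal (‖q.1 - q.2‖ ^ p) ∂(μ'.prod ν')
        ≤ r⁻¹ * (ENNReal.ofReal (2 ^ p) * (r * ∫⁻ x, ENNReal.ofReal (‖x‖ ^ p) ∂μ' + r * ∫⁻ y, ENNReal.ofReal (‖y‖ ^ p) ∂ν')) := by
          gcongr
      _ = (r⁻¹ * r) * (ENNReal.ofReal (2 ^ p) * (∫⁻ x, ENNReal.ofReal (‖x‖ ^ p) ∂μ' + ∫⁻ y, ENNReal.ofReal (‖y‖ ^ p) ∂ν')) := by ring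
      _ ≤ 1 * (ENNReal.ofReal (2 ^ p) * ((ENNReal.ofReal lam * r +
        ENNReal.ofReal (lam⁻¹) * ∫⁻ x, ENNReal.ofReal (‖x‖ ^ (2 * p)) ∂μ) + r)) := by
          gcongr
          exact ENNReal.inv_mul_le_one _
      _ = _ := by rw [one_mul]; ring

/-- a good partition -/
lemma exists_partition (d : ℕ) (hd : 2 ≤ d) (ε : ℝ) (hε : 0 < ε) :
    ∃ (N : ℕ) (A : Fin (N+1) → Set (Euc d)), (∀ i, MeasurableSet (A i)) ∧
      Pairwise (Function.onFun Disjoint A) ∧ ⋃ i, A i = Set.univ ∧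
      (∀ i, (∀ x ∈ A i, ∀ y ∈ A i, ‖x - y‖ ≤ ε) ∨ uniformBall d 0 (A i) = 0) ∧
      (∀ i, uniformBall d 0 (frontier (A i)) = 0) := by
  have : Nonempty (Euc d) := ⟨0⟩
  have hcov : closedBall (0 : Euc d) 1 ⊆ ⋃ k : ℕ, ball (TopologicalSpace.denseSeq (Euc d) k) (ε/2) := by
    intro z _
    obtain ⟨k, hk⟩ := (TopologicalSpace.denseRange_denseSeq (Euc d)).exists_dist_lt z (show 0 < ε/2 by positivity)
    exact Set.mem_iUnion.2 ⟨k, by simpa using hk⟩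
  obtain ⟨t, ht⟩ := (isCompact_closedBall (0 : Euc d) 1).elim_finite_subcover _ (fun k => isOpen_ball) hcov
  obtain ⟨N, hN⟩ : ∃ N, ∀ k ∈ t, k < N := ⟨t.sup id + 1, fun k hk => Nat.lt_succ_of_le (Finset.le_sup (f := id) hk)⟩
  set B : Fin (N+1) → Set (Euc d) := fun k => if (k : ℕ) < N then ball (TopologicalSpace.denseSeq (Euc d) k) (ε/2) else Set.univ
    with hB
  have hBm : ∀ k, MeasurableSet (B k) := by
    intro k; simp only [hB]; split_ifs
    · exact measurableSet_ball
    · exact MeasurableSet.univ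
  have hBf : ∀ k, uniformBall d 0 (frontier (B k)) = 0 := by
    intro k; simp only [hB]; split_ifs
    · apply uniformBall_ac d 0
      have := nontrivial_Euc d hd
      rw [frontier_ball _ (by positivity)]
      exact Measure.addHaar_sphere _ _ _
    · simp
  refine ⟨N, disjointed B, ?_, ?_, ?_, ?_, ?_⟩
  · intro i
    exact disjointedRec (p := fun s => MeasurableSet s) (fun s j hs => hs.diff (hBm j)) (hBm i)
  · exact disjoint_disjointed B
  · rw [iUnion_disjointed]
    apply Set.eq_univ_of_univ_subset
    refine Set.subset_iUnion_of_subset (Fin.last N) ?_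
    simp [hB]
  · intro i
    by_cases hi : (i : ℕ) < N
    · left
      intro x hx y hy
      have hx := disjointed_subset B i hx
      have hy := disjointed_subset B i hy
      simp only [hB, hi, if_true, mem_ball] at hx hy
      rw [← dist_eq_norm]
      have := dist_triangle_right x y (TopologicalSpace.denseSeq (Euc d) i)
      linarith
    · right
      refine measure_mono_null (t := (closedBall (0 : Euc d) 1)ᶜ) ?_ ?_
      · intro x hx hx1
        obtain ⟨k, hk, hxk⟩ := Set.mem_iUnion₂.1 (ht hx1)
        have hkN := hN k hk
        have hlt : (⟨k, by omega⟩ : Fin (N+1)) < i := by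
          rw [Fin.lt_def]; simp; omega
        have hd1 : x ∈ ⋃ j, disjointed B j := by
          rw [iUnion_disjointed]
          exact Set.mem_iUnion.2 ⟨i, disjointed_subset B i hx⟩
        rw [disjointed_apply] at hx
        apply hx.2
        have : B ⟨k, by omega⟩ ≤ (Finset.Iio i).sup B := Finset.le_sup (f := B) (Finset.mem_Iio.2 hlt)
        apply this
        simp only [hB, hkN, if_true]
        exact hxk
      · have := ae_uniformBall d
        rw [ae_iff] at this
        convert this using 2
        ext z; simp
  · intro i
    refine disjointedRec (p := fun s => uniformBall d 0 (frontier s) = 0) (fun s j hs => ?_) (hBf i)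
    rw [Set.sdiff_eq]
    refine measure_mono_null (frontier_inter_subset _ _) ?_
    rw [measure_union_null_iff]
    refine ⟨measure_mono_null Set.inter_subset_left hs, measure_mono_null Set.inter_subset_right ?_⟩
    rw [frontier_compl]
    exact hBf j

lemma emp_moment_le (d n : ℕ) [NeZero n] (x : Fin n → Euc d) (p : ℝ) (hp : 0 ≤ p) (k : ℕ) (hk : p ≤ k) (K : ℝ)
    (hK : (n:ℝ)⁻¹ * ∑ i, ‖x i‖ ^ k ≤ K) :
    ∫⁻ y, ENNReal.ofReal (‖y‖ ^ p) ∂(empMeas d n x) ≤ ENNReal.ofReal (1 + K) := by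
  rw [← ofReal_integral_eq_lintegral_ofReal (integrable_emp d n x _) (Eventually.of_forall fun _ => by positivity)]
  apply ENNReal.ofReal_le_ofReal
  calc ∫ y, ‖y‖ ^ p ∂(empMeas d n x) ≤ ∫ y, (1 + ‖y‖ ^ k) ∂(empMeas d n x) := by
        apply integral_mono (integrable_emp d n x _) (integrable_emp d n x _)
        intro y
        show ‖y‖ ^ p ≤ 1 + ‖y‖ ^ k
        rcases le_total ‖y‖ 1 with h | h
        · have := Real.rpow_le_one (norm_nonneg y) h hp
          have : 0 ≤ ‖y‖ ^ k := by positivity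
          linarith
        · have := Real.rpow_le_rpow_of_exponent_le h hk
          rw [Real.rpow_natCast] at this
          linarith
    _ = 1 + (n:ℝ)⁻¹ * ∑ i, ‖x i‖ ^ k := by
        rw [integral_add (integrable_const _) (integrable_emp d n x _), integral_emp (f := fun y : Euc d => ‖y‖ ^ k)]
        simp
    _ ≤ _ := by linarith

lemma det_conv (d : ℕ) (hd : 2 ≤ d) (x : (n : ℕ) → Fin n → Euc d)
    (hinj : ∀ᶠ n in atTop, Function.Injective (x n))
    (hH : ∀ ε > 0, ∀ᶠ n in atTop, hamiltonian d n (fun y => ‖y‖ ^ 2) (x n) ≤ eqI d + ε)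
    (hm : ∀ k : ℕ, ∃ K : ℝ, ∀ᶠ n : ℕ in atTop, (n:ℝ)⁻¹ * ∑ i, ‖x n i‖ ^ k ≤ K) (p : ℝ) (hp : 1 ≤ p) :
    Tendsto (fun n => costInf d p (empMeas d n (x n)) (uniformBall d 0)) atTop (𝓝 0) := by
  have hcf : ∀ ξ : Euc d, Tendsto (fun n => charFun (empMeas d n (x n)) ξ) atTop (𝓝 (charFun (uniformBall d 0) ξ)) := by
    obtain ⟨K, hK⟩ := hm 1
    intro ξ
    refine charFun_conv d hd x hinj hH (max K 0) (le_max_right _ _) ?_ ξ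
    filter_upwards [hK] with n hn
    simp only [pow_one] at hn
    exact hn.trans (le_max_left _ _)
  let μs : ℕ → ProbabilityMeasure (Euc d) := fun n => ⟨empMeas d (n+1) (x (n+1)), inferInstance⟩
  let ν : ProbabilityMeasure (Euc d) := ⟨uniformBall d 0, inferInstance⟩
  have hw : Tendsto μs atTop (𝓝 ν) := by
    apply ProbabilityMeasure.tendsto_of_tendsto_charFun
    intro t
    exact (tendsto_add_atTop_iff_nat 1).2 (hcf t)
  rw [← tendsto_add_atTop_iff_nat 1]
  obtain ⟨k, hk⟩ := exists_nat_ge (2 * p)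
  obtain ⟨K, hK⟩ := hm k
  have hK' := (tendsto_add_atTop_nat 1).eventually hK
  rw [ENNReal.tendsto_nhds_zero]
  intro η hη
  obtain ⟨η', hη'0, hη'⟩ : ∃ η' : ℝ, 0 < η' ∧ ENNReal.ofReal η' + (ENNReal.ofReal η' + ENNReal.ofReal η') ≤ η := by
    rcases eq_or_ne η ⊤ with h | h
    · exact ⟨1, one_pos, by simp [h]⟩
    · refine ⟨η.toReal / 3, by have := ENNReal.toReal_pos hη.ne' h; positivity, ?_⟩
      have := ENNReal.toReal_nonneg (a := η)
      rw [← ENNReal.ofReal_add (by positivity) (by positivity), ← ENNReal.ofReal_add (by positivity) (by positivity)]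
      apply ENNReal.ofReal_le_of_le_toReal
      linarith
  -- choose ε
  set ε := η' ^ (1/p) with hε
  have hε0 : 0 < ε := by positivity
  have hεp : ε ^ p = η' := by rw [hε, ← Real.rpow_mul hη'0.le, one_div_mul_cancel (by linarith), Real.rpow_one]
  obtain ⟨N, A, hA1, hA2, hA3, hA4, hA5⟩ := exists_partition d hd ε hε0
  -- choose lam
  obtain ⟨lam, hlam0, hlam⟩ : ∃ lam : ℝ, 0 < lam ∧ (2:ℝ) ^ p * (lam⁻¹ * (1 + |K|)) ≤ η' := by
    refine ⟨2 ^ p * (1 + |K|) / η', by positivity, le_of_eq ?_⟩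
    have : (0:ℝ) < 2 ^ p := by positivity
    have : (0:ℝ) < 1 + |K| := by positivity
    field_simp
  have hr : Tendsto (fun n => ENNReal.ofReal (2^p) * ((ENNReal.ofReal lam + 1) *
      (1 - ∑ i, min ((μs n : Measure (Euc d)) (A i)) ((ν : Measure (Euc d)) (A i))))) atTop (𝓝 0) := by
    have h1 : Tendsto (fun n => ∑ i, min ((μs n : Measure (Euc d)) (A i)) ((ν : Measure (Euc d)) (A i))) atTop (𝓝 1) := by
      have h2 : (1 : ℝ≥0∞) = ∑ i, min ((ν : Measure (Euc d)) (A i)) ((ν : Measure (Euc d)) (A i)) := by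
        simp only [min_self]
        rw [← tsum_fintype (L := .unconditional _), ← measure_iUnion hA2 hA1, hA3, measure_univ]
      rw [h2]
      apply tendsto_finsetSum
      intro i _
      exact (ProbabilityMeasure.tendsto_measure_of_null_frontier_of_tendsto' hw (hA5 i)).min tendsto_const_nhds
    have h3 := ENNReal.Tendsto.sub (tendsto_const_nhds (x := (1:ℝ≥0∞)) (f := atTop (α := ℕ))) h1 (Or.inl ENNReal.one_ne_top)
    rw [tsub_self] at h3
    have h4 := ENNReal.Tendsto.const_mul (a := ENNReal.ofReal lam + 1) h3 (Or.inr (by simp))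
    have h5 := ENNReal.Tendsto.const_mul (a := ENNReal.ofReal (2^p)) h4 (Or.inr (by simp))
    simpa using h5
  have hr' := (ENNReal.tendsto_nhds_zero.1 hr) (ENNReal.ofReal η') (by simpa using hη'0)
  filter_upwards [hK', hr'] with n hn1 hn2
  refine (costInf_le d p hp (empMeas d (n+1) (x (n+1))) (uniformBall d 0) A hA1 hA2 hA3 ε hε0.le hA4 (ae_uniformBall d) lam hlam0).trans ?_
  refine le_trans ?_ hη'
  rw [mul_add]
  refine add_le_add ?_ (add_le_add ?_ ?_)
  · rw [hεp]
  · exact hn2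
  · have h6 := emp_moment_le d (n+1) (x (n+1)) (2*p) (by linarith) k hk |K| (hn1.trans (le_abs_self K))
    calc _ ≤ ENNReal.ofReal (2^p) * (ENNReal.ofReal lam⁻¹ * ENNReal.ofReal (1 + |K|)) := by gcongr
      _ = ENNReal.ofReal ((2:ℝ) ^ p * (lam⁻¹ * (1 + |K|))) := by
          rw [ENNReal.ofReal_mul (by positivity), ENNReal.ofReal_mul (by positivity)]
      _ ≤ _ := ENNReal.ofReal_le_ofReal hlam

lemma costInf_translate (d : ℕ) (p : ℝ) (μ ν : Measure (Euc d)) (a : Euc d) :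
    costInf d p (μ.map (fun y => y + a)) (ν.map (fun y => y + a)) ≤ costInf d p μ ν := by
  unfold costInf
  refine le_iInf₂ fun π hπ => ?_
  have hm : Measurable (fun y : Euc d => y + a) := by fun_prop
  have hm2 : Measurable (Prod.map (fun y : Euc d => y + a) (fun y : Euc d => y + a)) := hm.prodMap hm
  refine (iInf₂_le (π.map (Prod.map (fun y => y + a) (fun y => y + a))) ?_).trans ?_
  · constructor
    · rw [Measure.map_map measurable_fst hm2, ← hπ.1, Measure.map_map hm measurable_fst]; rfl
    · rw [Measure.map_map measurable_snd hm2, ← hπ.2, Measure.map_map hm measurable_snd]; rfl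
  · rw [lintegral_map (by fun_prop) hm2]
    simp

lemma uniformBall_map (d : ℕ) (a : Euc d) : (uniformBall d 0).map (fun y => y + a) = uniformBall d a := by
  unfold uniformBall
  have hm : Measurable (fun y : Euc d => y + a) := by fun_prop
  rw [Measure.map_smul]
  have h1 : volume (closedBall a 1) = volume (closedBall (0 : Euc d) 1) := by
    rw [Measure.addHaar_closedBall_center]
  rw [h1]
  congr 1
  have h2 : (fun y : Euc d => y + a) ⁻¹' (closedBall a 1) = closedBall 0 1 := by ext y; simp [dist_eq_norm]
  rw [← h2, ← Measure.restrict_map hm measurableSet_closedBall, map_add_right_eq_self]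

lemma empMeas_map (d n : ℕ) (x : Fin n → Euc d) (a : Euc d) :
    (empMeas d n x).map (fun y => y + a) = empMeas d n (fun i => x i + a) := by
  unfold empMeas
  have hm : Measurable (fun y : Euc d => y + a) := by fun_prop
  rw [Measure.map_smul, Measure.map_finset_sum hm.aemeasurable]
  simp only [Measure.map_dirac]

/-- The deterministic conclusion. -/
lemma det_final (d : ℕ) (hd : 2 ≤ d) (a : Euc d) (y : (n : ℕ) → Fin n → Euc d)
    (hinj : ∀ᶠ n in atTop, Function.Injective (y n))
    (hH : ∀ ε > 0, ∀ᶠ n in atTop, hamiltonian d n (fun y => ‖y‖ ^ 2) (fun i => y n i - a) ≤ eqI d + ε)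
    (hm : ∀ k : ℕ, ∃ K : ℝ, ∀ᶠ n : ℕ in atTop, (n:ℝ)⁻¹ * ∑ i, ‖y n i - a‖ ^ k ≤ K) (p : ℝ) (hp : 1 ≤ p) :
    Tendsto (fun n => wassDist d p (empMeas d n (y n)) (uniformBall d a)) atTop (𝓝 0) := by
  have h := det_conv d hd (fun n i => y n i - a) (hinj.mono fun n hn i j hij => hn (sub_left_injective hij)) hH hm p hp
  have h2 : Tendsto (fun n => costInf d p (empMeas d n (y n)) (uniformBall d a)) atTop (𝓝 0) := by
    refine tendsto_of_tendsto_of_tendsto_of_le_of_le tendsto_const_nhds h (fun _ => zero_le) ?_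
    intro n
    have := costInf_translate d p (empMeas d n (fun i => y n i - a)) (uniformBall d 0) a
    rw [uniformBall_map, empMeas_map] at this
    simpa using this
  have h3 := (ENNReal.continuous_rpow_const (y := 1/p)).tendsto 0 |>.comp h2
  rw [ENNReal.zero_rpow_of_pos (by positivity)] at h3
  exact h3

/-- product Lebesgue measure -/
abbrev LamN (d n : ℕ) : Measure (Fin n → Euc d) := Measure.pi fun _ => (volume : Measure (Euc d))

/-- the quadratic Hamiltonian -/
def ham (d n : ℕ) (x : Fin n → Euc d) : ℝ := hamiltonian d n (fun y => ‖y‖ ^ 2) x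

/-- Gibbs weight -/
def Wt (d n : ℕ) (β : ℝ) (x : Fin n → Euc d) : ℝ≥0∞ := ENNReal.ofReal (Real.exp (-β * ham d n x))

/-- partition function -/
def ZZ (d n : ℕ) (β : ℝ) : ℝ≥0∞ := ∫⁻ x, Wt d n β x ∂(LamN d n)

lemma measurable_ham (d n : ℕ) : Measurable (ham d n) := by
  unfold ham hamiltonian
  refine Measurable.add ?_ ?_
  · refine Measurable.const_mul (Finset.measurable_fun_sum _ (fun i _ => ?_)) _
    exact ((measurable_pi_apply i).norm).pow_const 2
  · refine Measurable.const_mul (Finset.measurable_fun_sum _ (fun q _ => ?_)) _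
    exact (measurable_coulombKR d).comp ((measurable_pi_apply q.1).sub (measurable_pi_apply q.2))

lemma measurable_Wt (d n : ℕ) (β : ℝ) : Measurable (Wt d n β) := by
  unfold Wt
  exact ENNReal.measurable_ofReal.comp (Real.measurable_exp.comp ((measurable_ham d n).const_mul _))

lemma log_le_sq (r : ℝ) (hr : 0 ≤ r) : Real.log r ≤ r ^ 2 / 8 + 1 := by
  rcases hr.eq_or_lt with h | h
  · rw [← h]; simp
  · have h1 := Real.add_one_le_exp (Real.log r - 1 + 0)
    have h2 : Real.log (r ^ 2 / 8) ≤ r ^ 2 / 8 - 1 := Real.log_le_sub_one_of_pos (by positivity)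
    rw [Real.log_div (by positivity) (by norm_num), Real.log_pow] at h2
    have h3 : Real.log 8 = 3 * Real.log 2 := by
      rw [show (8:ℝ) = 2 ^ 3 by norm_num, Real.log_pow]; norm_num
    have h4 := Real.log_two_lt_d9
    push_cast at h2
    nlinarith [sq_nonneg r]

lemma coulombKR_lower (d : ℕ) (hd : 2 ≤ d) (x y : Euc d) :
    -((‖x‖ ^ 2 + ‖y‖ ^ 2) / 4 + 1) ≤ coulombKR d (x - y) := by
  rcases hd.eq_or_lt with h | h
  · have h1 := log_le_sq ‖x - y‖ (norm_nonneg _)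
    have h2 : ‖x - y‖ ≤ ‖x‖ + ‖y‖ := norm_sub_le _ _
    have h3 : ‖x - y‖ ^ 2 ≤ (‖x‖ + ‖y‖) ^ 2 := by gcongr
    unfold coulombKR
    rw [if_pos h.symm, one_div, Real.log_inv]
    nlinarith [sq_nonneg (‖x‖ - ‖y‖)]
  · have := coulombKR_nonneg d (by omega) (x - y)
    nlinarith [sq_nonneg ‖x‖, sq_nonneg ‖y‖]

lemma ham_lower (d : ℕ) (hd : 2 ≤ d) (n : ℕ) (hn : 1 ≤ n) (x : Fin n → Euc d) :
    (1 / (2 * (n : ℝ))) * ∑ i, ‖x i‖ ^ 2 - 1 ≤ ham d n x := by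
  have hn0 : (0 : ℝ) < n := by exact_mod_cast hn
  unfold ham hamiltonian
  have h1 : -∑ q : Fin n × Fin n, ((‖x q.1‖ ^ 2 + ‖x q.2‖ ^ 2) / 4 + 1) ≤
      ∑ q ∈ Finset.univ.filter (fun q : Fin n × Fin n => q.1 ≠ q.2),
        coulombKR d (x q.1 - x q.2) := by
    calc -∑ q : Fin n × Fin n, ((‖x q.1‖ ^ 2 + ‖x q.2‖ ^ 2) / 4 + 1)
        ≤ -∑ q ∈ Finset.univ.filter (fun q : Fin n × Fin n => q.1 ≠ q.2),
          ((‖x q.1‖ ^ 2 + ‖x q.2‖ ^ 2) / 4 + 1) := by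
          rw [neg_le_neg_iff]
          exact Finset.sum_le_sum_of_subset_of_nonneg (Finset.subset_univ _)
            (fun _ _ _ => by positivity)
      _ ≤ _ := by
          rw [← Finset.sum_neg_distrib]
          exact Finset.sum_le_sum (fun q _ => coulombKR_lower d hd _ _)
  have h2 : ∑ q : Fin n × Fin n, ((‖x q.1‖ ^ 2 + ‖x q.2‖ ^ 2) / 4 + 1)
      = n * (∑ i, ‖x i‖ ^ 2) / 2 + n ^ 2 := by
    rw [Fintype.sum_prod_type]
    simp only [Finset.sum_add_distrib, ← Finset.sum_div, Finset.sum_const, Finset.card_univ,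
      Fintype.card_fin, nsmul_eq_mul, ← Finset.mul_sum]
    ring
  rw [h2] at h1
  have h3 : (1 / (n:ℝ) ^ 2) * (-(n * (∑ i, ‖x i‖ ^ 2) / 2 + n ^ 2)) ≤ (1 / (n:ℝ) ^ 2) *
      ∑ q ∈ Finset.univ.filter (fun q : Fin n × Fin n => q.1 ≠ q.2),
        coulombKR d (x q.1 - x q.2) := by gcongr
  have h4 : (1 / (n:ℝ) ^ 2) * (-(n * (∑ i, ‖x i‖ ^ 2) / 2 + n ^ 2))
      = -(1 / (2 * (n : ℝ))) * ∑ i, ‖x i‖ ^ 2 - 1 := by field_simp; ring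
  have h5 : (1 / (n : ℝ)) * ∑ i, ‖x i‖ ^ 2 = 2 * ((1 / (2 * (n : ℝ))) * ∑ i, ‖x i‖ ^ 2) := by
    field_simp
  linarith

lemma ham_ge_neg_one (d : ℕ) (hd : 2 ≤ d) (n : ℕ) (hn : 1 ≤ n) (x : Fin n → Euc d) :
    -1 ≤ ham d n x := by
  have := ham_lower d hd n hn x
  have h : 0 ≤ (1 / (2 * (n : ℝ))) * ∑ i, ‖x i‖ ^ 2 := by positivity
  linarith

/-- the Gaussian integral -/
def Gs (d : ℕ) : ℝ := ∫ x : Euc d, Real.exp (-(1/4) * ‖x‖ ^ 2)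

lemma integrable_gauss (d : ℕ) (b : ℝ) (hb : 0 < b) :
    Integrable (fun x : Euc d => Real.exp (-b * ‖x‖ ^ 2)) := by
  have := GaussianFourier.integrable_cexp_neg_mul_sq_norm_add (V := Euc d) (b := (b : ℂ))
    (by simpa using hb) 0 0
  have h2 := this.norm
  refine h2.congr (ae_of_all _ fun x => ?_)
  simp only [Complex.norm_exp]
  congr 1
  simp [← Complex.ofReal_pow]

lemma Gs_pos (d : ℕ) : 0 < Gs d := by
  unfold Gs
  exact integral_exp_pos (integrable_gauss d (1/4) (by norm_num))

lemma lintegral_expnH (d : ℕ) (hd : 2 ≤ d) (n : ℕ) (hn : 1 ≤ n) :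
    ∫⁻ x, Wt d n n x ∂(LamN d n) ≤ ENNReal.ofReal (Real.exp n * Gs d ^ n) := by
  have hn0 : (0 : ℝ) < n := by exact_mod_cast hn
  have hi : Integrable (fun x : Fin n → Euc d => ∏ i, Real.exp (-(1/4) * ‖x i‖ ^ 2))
      (LamN d n) :=
    Integrable.fintype_prod (fun _ => integrable_gauss d (1/4) (by norm_num))
  have hG : ∫ x, ∏ i, Real.exp (-(1/4) * ‖x i‖ ^ 2) ∂(LamN d n) = Gs d ^ n := by
    have := integral_fintype_prod_eq_pow (𝕜 := ℝ) (ι := Fin n)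
      (fun y : Euc d => Real.exp (-(1/4) * ‖y‖ ^ 2)) (μ := volume)
    rw [this, Fintype.card_fin]; rfl
  calc ∫⁻ x, Wt d n n x ∂(LamN d n)
      ≤ ∫⁻ x, ENNReal.ofReal (Real.exp n * ∏ i, Real.exp (-(1/4) * ‖x i‖ ^ 2)) ∂(LamN d n) := by
        refine lintegral_mono fun x => ?_
        unfold Wt
        apply ENNReal.ofReal_le_ofReal
        rw [← Real.exp_sum, ← Real.exp_add]
        apply Real.exp_le_exp.2
        have h := ham_lower d hd n hn x
        rw [← Finset.mul_sum]
        have h2 := mul_le_mul_of_nonneg_left h hn0.le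
        have h3 : (n:ℝ) * ((1 / (2 * (n : ℝ))) * ∑ i, ‖x i‖ ^ 2 - 1)
          = (1/2) * ∑ i, ‖x i‖ ^ 2 - n := by field_simp
        have h4 : 0 ≤ ∑ i, ‖x i‖ ^ 2 := by positivity
        linarith
    _ = ENNReal.ofReal (Real.exp n * Gs d ^ n) := by
        rw [← ofReal_integral_eq_lintegral_ofReal (hi.const_mul _)
          (ae_of_all _ fun x => by positivity), integral_const_mul, hG]

lemma Wt_le (d : ℕ) (hd : 2 ≤ d) (n : ℕ) (hn : 1 ≤ n) (β : ℝ) (hβ : n ≤ β) (t : ℝ)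
    (x : Fin n → Euc d) (hx : t ≤ ham d n x) :
    Wt d n β x ≤ ENNReal.ofReal (Real.exp (-(β - n) * t)) * Wt d n n x := by
  unfold Wt
  rw [← ENNReal.ofReal_mul (Real.exp_pos _).le, ← Real.exp_add]
  apply ENNReal.ofReal_le_ofReal
  apply Real.exp_le_exp.2
  nlinarith [mul_le_mul_of_nonneg_left hx (sub_nonneg.2 hβ)]

lemma ZZ_ne_top (d : ℕ) (hd : 2 ≤ d) (n : ℕ) (hn : 1 ≤ n) (β : ℝ) (hβ : n ≤ β) :
    ZZ d n β ≠ ⊤ := by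
  refine ne_of_lt ?_
  calc ZZ d n β ≤ ∫⁻ x, ENNReal.ofReal (Real.exp (-(β - n) * (-1))) * Wt d n n x ∂(LamN d n) :=
        lintegral_mono fun x => Wt_le d hd n hn β hβ (-1) x (ham_ge_neg_one d hd n hn x)
    _ = ENNReal.ofReal (Real.exp (-(β - n) * (-1))) * ∫⁻ x, Wt d n n x ∂(LamN d n) :=
        lintegral_const_mul _ (measurable_Wt d n n)
    _ ≤ ENNReal.ofReal (Real.exp (-(β - n) * (-1))) * ENNReal.ofReal (Real.exp n * Gs d ^ n) := by
        gcongr; exact lintegral_expnH d hd n hn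
    _ < ⊤ := ENNReal.mul_lt_top ENNReal.ofReal_lt_top ENNReal.ofReal_lt_top

lemma jensen_exp {α : Type*} [MeasurableSpace α] (μ : Measure α) [IsProbabilityMeasure μ]
    (f : α → ℝ) (hf : Integrable f μ) :
    ENNReal.ofReal (Real.exp (-∫ x, f x ∂μ)) ≤ ∫⁻ x, ENNReal.ofReal (Real.exp (-f x)) ∂μ := by
  set a := ∫ x, f x ∂μ with ha
  have hIntg : Integrable (fun x => Real.exp (-a) * (1 - (f x - a))) μ :=
    ((integrable_const 1).sub (hf.sub (integrable_const a))).const_mul _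
  have h1 : ∫ x, Real.exp (-a) * (1 - (f x - a)) ∂μ = Real.exp (-a) := by
    have h2 : ∫ x, (1 - (f x - a)) ∂μ = ∫ x, ((1 + a) - f x) ∂μ := by
      congr 1; ext x; ring
    rw [integral_const_mul, h2, integral_sub (integrable_const _) hf]
    simp [← ha]
  rw [← h1]
  calc ENNReal.ofReal (∫ x, Real.exp (-a) * (1 - (f x - a)) ∂μ)
      ≤ ENNReal.ofReal (∫ x, max (Real.exp (-a) * (1 - (f x - a))) 0 ∂μ) := by
        apply ENNReal.ofReal_le_ofReal
        exact integral_mono hIntg hIntg.pos_part (fun x => le_max_left _ _)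
    _ = ∫⁻ x, ENNReal.ofReal (max (Real.exp (-a) * (1 - (f x - a))) 0) ∂μ :=
        ofReal_integral_eq_lintegral_ofReal hIntg.pos_part (ae_of_all _ fun x => le_max_right _ _)
    _ ≤ _ := by
        refine lintegral_mono fun x => ENNReal.ofReal_le_ofReal (max_le ?_ (Real.exp_pos _).le)
        have h := Real.add_one_le_exp (-(f x - a))
        calc Real.exp (-a) * (1 - (f x - a)) ≤ Real.exp (-a) * Real.exp (-(f x - a)) := by
              gcongr; linarith
          _ = _ := by rw [← Real.exp_add]; congr 1; ring

lemma pi_uniformBall_le (d n : ℕ) (F : (Fin n → Euc d) → ℝ≥0∞) :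
    ENNReal.ofReal (volB d ^ n) * ∫⁻ x, F x ∂(Measure.pi fun _ : Fin n => uniformBall d 0)
      ≤ ∫⁻ x, F x ∂(LamN d n) := by
  have hv : ENNReal.ofReal (volB d) = volume (closedBall (0 : Euc d) 1) := by
    unfold volB Measure.real
    rw [ENNReal.ofReal_toReal measure_closedBall_lt_top.ne]
  have hpos : ENNReal.ofReal (volB d) ≠ 0 := by simpa using volB_pos d
  have h1 : (Measure.pi fun _ : Fin n => uniformBall d 0) =
      ((ENNReal.ofReal (volB d))⁻¹ ^ n) • (Measure.pi fun _ : Fin n =>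
        (volume : Measure (Euc d)).restrict (closedBall 0 1)) := by
    refine Measure.pi_eq fun s hs => ?_
    rw [Measure.smul_apply, Measure.pi_pi]
    unfold uniformBall
    simp only [Measure.smul_apply, smul_eq_mul, Finset.prod_mul_distrib, Finset.prod_const,
      Finset.card_univ, Fintype.card_fin, hv]
  rw [h1, lintegral_smul_measure, ← Measure.restrict_pi_pi, smul_eq_mul, ← mul_assoc,
    ENNReal.ofReal_pow (volB_pos d).le, ← mul_pow,
    ENNReal.mul_inv_cancel hpos ENNReal.ofReal_ne_top, one_pow, one_mul]
  exact lintegral_mono' Measure.restrict_le_self le_rfl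

open ProbabilityTheory in
lemma pi_pair_marginal (d n : ℕ) (μ : Measure (Euc d)) [IsProbabilityMeasure μ] (i j : Fin n)
    (hij : i ≠ j) : MeasurePreserving (fun x : Fin n → Euc d => (x i, x j))
      (Measure.pi fun _ : Fin n => μ) (μ.prod μ) := by
  have h := (iIndepFun_pi (μ := fun _ : Fin n => μ) (X := fun _ ↦ id)
    (fun _ ↦ aemeasurable_id)).indepFun hij
  refine ⟨by fun_prop, ?_⟩
  have h2 := (indepFun_iff_map_prod_eq_prod_map_map
    (measurable_pi_apply i).aemeasurable (measurable_pi_apply j).aemeasurable).1 h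
  rw [h2, (measurePreserving_eval (fun _ : Fin n => μ) i).map_eq,
    (measurePreserving_eval (fun _ : Fin n => μ) j).map_eq]

lemma integral_ham_pi (d : ℕ) (hd : 2 ≤ d) (n : ℕ) (hn : 1 ≤ n) :
    Integrable (ham d n) (Measure.pi fun _ : Fin n => uniformBall d 0) ∧
    ∫ x, ham d n x ∂(Measure.pi fun _ : Fin n => uniformBall d 0) = eqI d - selfJ d / n := by
  have hn0 : (0 : ℝ) < n := by exact_mod_cast hn
  set P := Measure.pi fun _ : Fin n => uniformBall d 0 with hP
  have i1 : ∀ i : Fin n, Integrable (fun x : Fin n → Euc d => ‖x i‖ ^ 2) P := fun i =>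
    (measurePreserving_eval (fun _ : Fin n => uniformBall d 0) i).integrable_comp_of_integrable
      (integrable_normsq_ub d)
  have v1 : ∀ i : Fin n, ∫ x, ‖x i‖ ^ 2 ∂P = ∫ x, ‖x‖ ^ 2 ∂(uniformBall d 0) := fun i => by
    rw [← (measurePreserving_eval (fun _ : Fin n => uniformBall d 0) i).map_eq,
      integral_map (measurable_pi_apply i).aemeasurable (by fun_prop)]
  have i2 : ∀ q : Fin n × Fin n, q.1 ≠ q.2 →
      Integrable (fun x : Fin n → Euc d => coulombKR d (x q.1 - x q.2)) P := fun q hq =>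
    (pi_pair_marginal d n (uniformBall d 0) q.1 q.2 hq).integrable_comp_of_integrable
      (integrable_coulombKR_prod d hd)
  have v2 : ∀ q : Fin n × Fin n, q.1 ≠ q.2 →
      ∫ x, coulombKR d (x q.1 - x q.2) ∂P = selfJ d := fun q hq => by
    have h := pi_pair_marginal d n (uniformBall d 0) q.1 q.2 hq
    rw [selfJ_eq d hd, ← h.map_eq,
      integral_map (by fun_prop) (measurable_sub_coulombKR d).aestronglyMeasurable]
  have I1 : Integrable (fun x : Fin n → Euc d => (1 / (n:ℝ)) * ∑ i, ‖x i‖ ^ 2) P :=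
    (integrable_finsetSum _ fun i _ => i1 i).const_mul _
  have I2 : Integrable (fun x : Fin n → Euc d => (1 / (n:ℝ) ^ 2) *
      ∑ q ∈ Finset.univ.filter (fun q : Fin n × Fin n => q.1 ≠ q.2),
        coulombKR d (x q.1 - x q.2)) P :=
    (integrable_finsetSum _ fun q hq => i2 q (Finset.mem_filter.1 hq).2).const_mul _
  have hcard : ((Finset.univ.filter (fun q : Fin n × Fin n => q.1 ≠ q.2)).card : ℝ)
      = n ^ 2 - n := by
    have h : Finset.univ.filter (fun q : Fin n × Fin n => q.1 ≠ q.2)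
        = (Finset.univ : Finset (Fin n)).offDiag := by ext q; simp
    rw [h, Finset.offDiag_card]
    simp only [Finset.card_univ, Fintype.card_fin]
    rw [Nat.cast_sub (Nat.le_mul_self n)]
    push_cast; ring
  refine ⟨I1.add I2, ?_⟩
  have e : ∀ x, ham d n x = (1 / (n:ℝ)) * ∑ i, ‖x i‖ ^ 2 + (1 / (n:ℝ) ^ 2) *
      ∑ q ∈ Finset.univ.filter (fun q : Fin n × Fin n => q.1 ≠ q.2),
        coulombKR d (x q.1 - x q.2) := fun x => rfl
  simp only [e]
  rw [integral_add I1 I2, integral_const_mul, integral_const_mul,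
    integral_finsetSum _ (fun i _ => i1 i),
    integral_finsetSum _ (fun q hq => i2 q (Finset.mem_filter.1 hq).2),
    Finset.sum_congr rfl (fun i _ => v1 i),
    Finset.sum_congr rfl (fun q hq => v2 q (Finset.mem_filter.1 hq).2)]
  simp only [Finset.sum_const, Finset.card_univ, Fintype.card_fin, nsmul_eq_mul, hcard]
  unfold eqI
  field_simp
  ring

lemma ZZ_lower (d : ℕ) (hd : 2 ≤ d) (n : ℕ) (hn : 1 ≤ n) (β : ℝ) :
    ENNReal.ofReal (volB d ^ n * Real.exp (-β * (eqI d - selfJ d / n))) ≤ ZZ d n β := by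
  obtain ⟨hi, hv⟩ := integral_ham_pi d hd n hn
  refine le_trans ?_ (pi_uniformBall_le d n (Wt d n β))
  rw [ENNReal.ofReal_mul (pow_nonneg (volB_pos d).le n)]
  gcongr
  have := jensen_exp _ _ (hi.const_mul β)
  rw [integral_const_mul, hv, ← neg_mul] at this
  refine this.trans (le_of_eq ?_)
  congr 1; ext x; unfold Wt; rw [neg_mul]

lemma ZZ_ne_zero (d : ℕ) (hd : 2 ≤ d) (n : ℕ) (hn : 1 ≤ n) (β : ℝ) : ZZ d n β ≠ 0 := by
  intro h
  have := ZZ_lower d hd n hn β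
  rw [h] at this
  have h2 : 0 < volB d ^ n * Real.exp (-β * (eqI d - selfJ d / n)) :=
    mul_pos (pow_pos (volB_pos d) n) (Real.exp_pos _)
  rw [nonpos_iff_eq_zero, ENNReal.ofReal_eq_zero] at this
  linarith

/-- the quadratic Gibbs measure -/
abbrev gib (d n : ℕ) (β : ℝ) : Measure (Fin n → Euc d) := gibbs d n β (fun y => ‖y‖ ^ 2)

lemma gib_eq (d n : ℕ) (β : ℝ) : gib d n β = (ZZ d n β)⁻¹ • (LamN d n).withDensity (Wt d n β) := rfl

lemma gib_prob (d : ℕ) (hd : 2 ≤ d) (n : ℕ) (hn : 1 ≤ n) (β : ℝ) (hβ : n ≤ β) :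
    IsProbabilityMeasure (gib d n β) := by
  constructor
  rw [gib_eq, Measure.smul_apply, withDensity_apply _ MeasurableSet.univ, Measure.restrict_univ,
    smul_eq_mul]
  exact ENNReal.inv_mul_cancel (ZZ_ne_zero d hd n hn β) (ZZ_ne_top d hd n hn β hβ)

lemma gib_tail (d : ℕ) (hd : 2 ≤ d) (n : ℕ) (hn : 1 ≤ n) (β : ℝ) (hβ : n ≤ β) (δ : ℝ) :
    gib d n β {x | eqI d + δ ≤ ham d n x} ≤ ENNReal.ofReal (Real.exp (n * (-(β / n) * (δ + selfJ d / n)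
      + (eqI d + δ + 1 + Real.log (Gs d) - Real.log (volB d))))) := by
  have hn0 : (0 : ℝ) < n := by exact_mod_cast hn
  have hms : MeasurableSet {x | eqI d + δ ≤ ham d n x} :=
    measurableSet_le measurable_const (measurable_ham d n)
  set t := eqI d + δ with ht
  have hnum : ∫⁻ x in {x | t ≤ ham d n x}, Wt d n β x ∂(LamN d n) ≤
      ENNReal.ofReal (Real.exp (-(β - n) * t) * (Real.exp n * Gs d ^ n)) := by
    calc ∫⁻ x in {x | t ≤ ham d n x}, Wt d n β x ∂(LamN d n)
        ≤ ∫⁻ x in {x | t ≤ ham d n x},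
          ENNReal.ofReal (Real.exp (-(β - n) * t)) * Wt d n n x ∂(LamN d n) :=
          setLIntegral_mono ((measurable_Wt d n n).const_mul _)
            (fun x hx => Wt_le d hd n hn β hβ t x hx)
      _ ≤ ∫⁻ x, ENNReal.ofReal (Real.exp (-(β - n) * t)) * Wt d n n x ∂(LamN d n) :=
          setLIntegral_le_lintegral _ _
      _ = ENNReal.ofReal (Real.exp (-(β - n) * t)) * ∫⁻ x, Wt d n n x ∂(LamN d n) :=
          lintegral_const_mul _ (measurable_Wt d n n)
      _ ≤ _ := by
          rw [ENNReal.ofReal_mul (Real.exp_pos _).le]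
          gcongr; exact lintegral_expnH d hd n hn
  rw [gib_eq, Measure.smul_apply, withDensity_apply _ hms, smul_eq_mul, mul_comm,
    ← div_eq_mul_inv]
  have hz : 0 < volB d ^ n * Real.exp (-β * (eqI d - selfJ d / n)) :=
    mul_pos (pow_pos (volB_pos d) n) (Real.exp_pos _)
  refine (ENNReal.div_le_div hnum (ZZ_lower d hd n hn β)).trans ?_
  rw [← ENNReal.ofReal_div_of_pos hz]
  apply ENNReal.ofReal_le_ofReal
  rw [div_le_iff₀ hz]
  have e1 : volB d ^ n = Real.exp (n * Real.log (volB d)) := by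
    rw [mul_comm, Real.exp_mul, Real.exp_log (volB_pos d), Real.rpow_natCast]
  have e2 : Gs d ^ n = Real.exp (n * Real.log (Gs d)) := by
    rw [mul_comm, Real.exp_mul, Real.exp_log (Gs_pos d), Real.rpow_natCast]
  rw [e1, e2, ← Real.exp_add, ← Real.exp_add, ← Real.exp_add, ← Real.exp_add]
  apply Real.exp_le_exp.2
  apply le_of_eq
  rw [ht]
  field_simp
  ring

lemma gib_tail_ev (d : ℕ) (hd : 2 ≤ d) (β : ℕ → ℝ) (hβ : Tendsto (fun n => β n / n) atTop atTop)
    (δ : ℝ) (hδ : 0 < δ) : ∀ᶠ n : ℕ in atTop,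
      gib d n (β n) {x | eqI d + δ ≤ ham d n x} ≤ ENNReal.ofReal (Real.exp (-(n:ℝ))) := by
  set K := eqI d + δ + 1 + Real.log (Gs d) - Real.log (volB d) with hK
  have h1 := hβ.eventually_ge_atTop (max 1 ((K + 1) / (δ / 2)))
  have h2 : ∀ᶠ n : ℕ in atTop, -(δ / 2) < selfJ d / n :=
    (tendsto_const_div_atTop_nhds_zero_nat (selfJ d)).eventually (lt_mem_nhds (by linarith))
  filter_upwards [h1, h2, eventually_ge_atTop 1] with n h1 h2 hn
  have hn0 : (0 : ℝ) < n := by exact_mod_cast hn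
  have hb1 : 1 ≤ β n / n := le_trans (le_max_left _ _) h1
  have hb2 : (K + 1) / (δ / 2) ≤ β n / n := le_trans (le_max_right _ _) h1
  rw [div_le_iff₀ (by linarith)] at hb2
  rw [le_div_iff₀ hn0, one_mul] at hb1
  refine (gib_tail d hd n hn (β n) hb1 δ).trans ?_
  apply ENNReal.ofReal_le_ofReal
  apply Real.exp_le_exp.2
  have h3 : -(β n / n) * (δ + selfJ d / n) + K ≤ -1 := by
    have : β n / n * (δ / 2) ≤ β n / n * (δ + selfJ d / n) := by
      apply mul_le_mul_of_nonneg_left (by linarith)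
      exact le_trans (by norm_num) (le_trans (le_max_left 1 ((K + 1) / (δ / 2))) h1)
    linarith
  nlinarith

lemma coulombKR_le_one (d : ℕ) (hd : 2 ≤ d) (z : Euc d) (hz : 1 ≤ ‖z‖) : coulombKR d z ≤ 1 := by
  unfold coulombKR
  split_ifs with h
  · rw [one_div, Real.log_inv]
    have := Real.log_nonneg hz
    linarith
  · have h3 : (3 : ℝ) ≤ d := by
      have : 3 ≤ d := by omega
      exact_mod_cast this
    have h4 : 1 ≤ ‖z‖ ^ (d - 2) := one_le_pow₀ hz
    rw [div_le_iff₀ (by nlinarith)]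
    nlinarith

/-- constant bounding the positive part of the potential -/
def CP (d : ℕ) : ℝ := 1 + 2 * ((volB d)⁻¹ * ∫ z in ball (0 : Euc d) (2 + 2), domK d z)

lemma CP_nonneg (d : ℕ) : 0 ≤ CP d := by
  unfold CP
  have h1 : 0 ≤ ∫ z in ball (0 : Euc d) (2 + 2), domK d z :=
    integral_nonneg fun z => domK_nonneg d z
  have h2 := (volB_pos d).le
  positivity

lemma posPot_le (d : ℕ) (hd : 2 ≤ d) (x : Euc d) :
    ∫ w, max (coulombKR d (x - w)) 0 ∂(uniformBall d 0) ≤ CP d := by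
  have hi : Integrable (fun w => max (coulombKR d (x - w)) 0) (uniformBall d 0) :=
    (integrable_coulombKR_ub d hd x).pos_part
  have hD : Integrable (fun w => domK d (x - w)) (uniformBall d 0) :=
    integrable_uniformBall d _ (integrableOn_domK_sub d hd x 0 1)
  have hA : 0 ≤ 2 * ((volB d)⁻¹ * ∫ z in ball (0 : Euc d) (2 + 2), domK d z) := by
    have h1 : 0 ≤ ∫ z in ball (0 : Euc d) (2 + 2), domK d z :=
      integral_nonneg fun z => domK_nonneg d z
    have h2 := (volB_pos d).le
    positivity
  by_cases hx : ‖x‖ ≤ 2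
  · have h1 : ∫ w, max (coulombKR d (x - w)) 0 ∂(uniformBall d 0)
        ≤ ∫ w, (1 + 2 * domK d (x - w)) ∂(uniformBall d 0) := by
      refine integral_mono hi ((integrable_const 1).add (hD.const_mul 2)) fun w => ?_
      have hK := domK_nonneg d (x - w)
      refine max_le ?_ (by positivity)
      by_cases h : 1 ≤ ‖x - w‖
      · have := coulombKR_le_one d hd _ h
        linarith
      · have h2 := (le_abs_self _).trans (abs_coulombKR_le d hd (x - w))
        have h3 : ‖x - w‖ ^ 2 ≤ 1 := by nlinarith [norm_nonneg (x - w)]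
        nlinarith
    refine h1.trans ?_
    rw [integral_add (integrable_const 1) (hD.const_mul 2), integral_const_mul,
      integral_uniformBall d (fun w => domK d (x - w))]
    unfold CP
    have := setIntegral_domK_sub_le d hd x 2 hx
    have hv := inv_nonneg.2 (volB_pos d).le
    have h4 := mul_le_mul_of_nonneg_left this hv
    simp only [integral_const, probReal_univ, smul_eq_mul, mul_one]
    linarith
  · have h1 : ∫ w, max (coulombKR d (x - w)) 0 ∂(uniformBall d 0)
        ≤ ∫ w, (1:ℝ) ∂(uniformBall d 0) := by
      refine integral_mono_ae hi (integrable_const 1) ?_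
      filter_upwards [ae_uniformBall d] with w hw
      refine max_le (coulombKR_le_one d hd _ ?_) zero_le_one
      have := norm_sub_norm_le x w
      linarith
    simp only [integral_const, probReal_univ, smul_eq_mul, mul_one] at h1
    unfold CP
    linarith

lemma coulombKR_diff (d : ℕ) (hd : 2 ≤ d) (y w z : Euc d) (hw : ‖w‖ ≤ 1) :
    coulombKR d (z - w) - coulombKR d (z - y) ≤ max (coulombKR d (z - w)) 0 + ‖y‖ + 1 := by
  rcases hd.eq_or_lt with h | h
  · have e : ∀ u : Euc d, coulombKR d u = - Real.log ‖u‖ := fun u => by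
      unfold coulombKR; rw [if_pos h.symm, one_div, Real.log_inv]
    rw [e, e]
    have hs : ‖z - y‖ ≤ ‖z - w‖ + (‖y‖ + 1) := by
      have : z - y = (z - w) + (w - y) := by abel
      rw [this]
      have h1 := norm_add_le (z - w) (w - y)
      have h2 := norm_sub_le w y
      linarith
    set r := ‖z - w‖ with hr
    set s := ‖y‖ + 1 with hs'
    have hs1 : 1 ≤ s := by have := norm_nonneg y; linarith
    have hr0 : 0 ≤ r := norm_nonneg _
    have hl : Real.log ‖z - y‖ ≤ Real.log (r + s) := by
      rcases (norm_nonneg (z - y)).eq_or_lt with h0 | h0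
      · rw [← h0, Real.log_zero]; exact Real.log_nonneg (by linarith)
      · exact Real.log_le_log h0 hs
    by_cases h1 : 1 ≤ r
    · have h2 : Real.log (r + s) - Real.log r ≤ s := by
        rw [← Real.log_div (by linarith) (by linarith)]
        have h3 := Real.log_le_sub_one_of_pos (x := (r + s) / r) (by positivity)
        have h4 : (r + s) / r - 1 = s / r := by field_simp; ring
        have h5 : s / r ≤ s := div_le_self (by linarith) h1
        linarith
      have := le_max_right (-Real.log r) 0
      linarith
    · have h3 := Real.log_le_sub_one_of_pos (x := r + s) (by linarith)
      have := le_max_left (-Real.log r) 0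
      push Not at h1
      linarith
  · have h1 := coulombKR_nonneg d (by omega) (z - y)
    have := le_max_left (coulombKR d (z - w)) 0
    have := norm_nonneg y
    linarith

lemma ham_update (d : ℕ) (hd : 2 ≤ d) (n : ℕ) (hn : 1 ≤ n) (x : Fin n → Euc d) (k : Fin n)
    (y w : Euc d) (hw : ‖w‖ ≤ 1) :
    ham d n (Function.update x k w) + (1 / (n:ℝ)) * (‖y‖ ^ 2 - 2 * ‖y‖ - 3
      - 2 * ((1 / (n:ℝ)) * ∑ j, max (coulombKR d (x j - w)) 0)) ≤ ham d n (Function.update x k y) := by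
  have hn0 : (0 : ℝ) < n := by exact_mod_cast hn
  set u := Function.update x k y with hu
  set u' := Function.update x k w with hu'
  set T : Fin n → ℝ := fun j => max (coulombKR d (x j - w)) 0 + ‖y‖ + 1 with hT
  have hT0 : ∀ j, 0 ≤ T j := fun j => by
    have := le_max_right (coulombKR d (x j - w)) 0
    have := norm_nonneg y
    simp only [hT]; linarith
  have hpot : ∑ i, ‖u i‖ ^ 2 - ∑ i, ‖u' i‖ ^ 2 = ‖y‖ ^ 2 - ‖w‖ ^ 2 := by
    rw [← Finset.sum_sub_distrib, Finset.sum_eq_single k]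
    · simp [hu, hu']
    · intro j _ hj; simp [hu, hu', hj]
    · simp
  have hIntg : -(2 * ∑ j, T j) ≤
      ∑ q ∈ Finset.univ.filter (fun q : Fin n × Fin n => q.1 ≠ q.2), coulombKR d (u q.1 - u q.2)
      - ∑ q ∈ Finset.univ.filter (fun q : Fin n × Fin n => q.1 ≠ q.2), coulombKR d (u' q.1 - u' q.2) := by
    have hs : 2 * ∑ j, T j = ∑ q : Fin n × Fin n,
        ((if q.1 = k then T q.2 else 0) + (if q.2 = k then T q.1 else 0)) := by
      rw [Fintype.sum_prod_type]
      simp only [Finset.sum_add_distrib]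
      rw [Finset.sum_comm (f := fun a b => if a = k then T b else 0)]
      simp
      ring
    rw [hs, ← Finset.sum_sub_distrib]
    calc -∑ q : Fin n × Fin n, ((if q.1 = k then T q.2 else 0) + (if q.2 = k then T q.1 else 0))
        ≤ -∑ q ∈ Finset.univ.filter (fun q : Fin n × Fin n => q.1 ≠ q.2),
          ((if q.1 = k then T q.2 else 0) + (if q.2 = k then T q.1 else 0)) := by
          rw [neg_le_neg_iff]
          refine Finset.sum_le_sum_of_subset_of_nonneg (Finset.subset_univ _) (fun q _ _ => ?_)
          have := hT0 q.1
          have := hT0 q.2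
          split_ifs <;> linarith
      _ ≤ _ := by
          rw [← Finset.sum_neg_distrib]
          refine Finset.sum_le_sum fun q hq => ?_
          have hq' : q.1 ≠ q.2 := (Finset.mem_filter.1 hq).2
          by_cases h1 : q.1 = k
          · have h2 : q.2 ≠ k := fun h => hq' (h1.trans h.symm)
            rw [if_pos h1, if_neg h2, h1]
            have := coulombKR_diff d hd y w (x q.2) hw
            simp only [hu, hu', Function.update_self, Function.update_of_ne h2, hT]
            rw [coulombKR_sub_comm d y, coulombKR_sub_comm d w]
            linarith
          · rw [if_neg h1]
            by_cases h2 : q.2 = k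
            · rw [if_pos h2, h2]
              have := coulombKR_diff d hd y w (x q.1) hw
              simp only [hu, hu', Function.update_self, Function.update_of_ne h1, hT]
              linarith
            · rw [if_neg h2]
              simp only [hu, hu', Function.update_of_ne h1, Function.update_of_ne h2]
              simp
  have hTs : ∑ j, T j = ∑ j, max (coulombKR d (x j - w)) 0 + n * (‖y‖ + 1) := by
    simp only [hT, Finset.sum_add_distrib, Finset.sum_const, Finset.card_univ, Fintype.card_fin,
      nsmul_eq_mul]
    ring
  rw [hTs] at hIntg
  set A := ∑ j, max (coulombKR d (x j - w)) 0
  unfold ham hamiltonian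
  set S1 := ∑ q ∈ Finset.univ.filter (fun q : Fin n × Fin n => q.1 ≠ q.2), coulombKR d (u q.1 - u q.2)
  set S2 := ∑ q ∈ Finset.univ.filter (fun q : Fin n × Fin n => q.1 ≠ q.2), coulombKR d (u' q.1 - u' q.2)
  have h1 : (1 / (n:ℝ) ^ 2) * (-(2 * (A + n * (‖y‖ + 1)))) ≤ (1 / (n:ℝ) ^ 2) * (S1 - S2) := by
    gcongr
  have h2 : (1 / (n:ℝ) ^ 2) * (-(2 * (A + n * (‖y‖ + 1)))) =
      -(1 / (n:ℝ)) * (2 * ((1 / (n:ℝ)) * A) + 2 * (‖y‖ + 1)) := by field_simp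
  have h3 : (1 / (n:ℝ)) * (‖y‖ ^ 2 - 1) ≤ (1 / (n:ℝ)) * (∑ i, ‖u i‖ ^ 2 - ∑ i, ‖u' i‖ ^ 2) := by
    rw [hpot]
    gcongr
    nlinarith [norm_nonneg w]
  rw [h2] at h1
  linarith

lemma Wt_update (d : ℕ) (hd : 2 ≤ d) (n : ℕ) (hn : 1 ≤ n) (β : ℝ) (hβ : n ≤ β) (x : Fin n → Euc d)
    (k : Fin n) (y : Euc d) (hy : 4 + 2 * CP d ≤ ‖y‖) :
    Wt d n β (Function.update x k y) ≤ ENNReal.ofReal ((volB d)⁻¹ * Real.exp (-(1/4) * ‖y‖ ^ 2)) *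
      ∫⁻ w, Wt d n β (Function.update x k w) := by
  have hn0 : (0 : ℝ) < n := by exact_mod_cast hn
  have hb : 1 ≤ β / n := by rw [le_div_iff₀ hn0]; linarith
  set Gx : Euc d → ℝ := fun w => (1 / (n:ℝ)) * ∑ j, max (coulombKR d (x j - w)) 0 with hGx
  have hi1 : ∀ j, Integrable (fun w => max (coulombKR d (x j - w)) 0) (uniformBall d 0) :=
    fun j => (integrable_coulombKR_ub d hd (x j)).pos_part
  have hGi : Integrable Gx (uniformBall d 0) :=
    (integrable_finsetSum _ fun j _ => hi1 j).const_mul _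
  have hGv : ∫ w, Gx w ∂(uniformBall d 0) ≤ CP d := by
    simp only [hGx]
    rw [integral_const_mul, integral_finsetSum _ fun j _ => hi1 j]
    have : ∑ j, ∫ w, max (coulombKR d (x j - w)) 0 ∂(uniformBall d 0) ≤ n * CP d := by
      calc _ ≤ ∑ j : Fin n, CP d := Finset.sum_le_sum fun j _ => posPot_le d hd (x j)
        _ = _ := by simp
    calc _ ≤ (1 / (n:ℝ)) * (n * CP d) := by gcongr
      _ = CP d := by field_simp
  have hJ := jensen_exp _ _ (hGi.const_mul (2 * (β / n)))
  rw [integral_const_mul] at hJ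
  set r := ‖y‖ with hr
  have hc0 := CP_nonneg d
  have hrr : r ^ 2 / 4 ≤ r ^ 2 - 2 * r - 3 - 2 * CP d := by nlinarith
  set E := Real.exp (β / n * (r ^ 2 - 2 * r - 3)) with hE
  -- main chain
  have hvpos := volB_pos d
  have hvne : ENNReal.ofReal (volB d) ≠ 0 := by simpa using hvpos
  have key : ENNReal.ofReal (volB d * (E * Real.exp (-(2 * (β / n) * CP d)))) *
      Wt d n β (Function.update x k y) ≤ ∫⁻ w, Wt d n β (Function.update x k w) := by
    calc ENNReal.ofReal (volB d * (E * Real.exp (-(2 * (β / n) * CP d)))) *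
          Wt d n β (Function.update x k y)
        = ENNReal.ofReal (volB d) * ((ENNReal.ofReal E * Wt d n β (Function.update x k y)) *
          ENNReal.ofReal (Real.exp (-(2 * (β / n) * CP d)))) := by
          rw [ENNReal.ofReal_mul hvpos.le, ENNReal.ofReal_mul (Real.exp_pos _).le]; ring
      _ ≤ ENNReal.ofReal (volB d) * ((ENNReal.ofReal E * Wt d n β (Function.update x k y)) *
          ∫⁻ w, ENNReal.ofReal (Real.exp (-(2 * (β / n) * Gx w))) ∂(uniformBall d 0)) := by
          gcongr
          refine le_trans ?_ hJ
          apply ENNReal.ofReal_le_ofReal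
          apply Real.exp_le_exp.2
          have : 2 * (β / n) * ∫ w, Gx w ∂(uniformBall d 0) ≤ 2 * (β / n) * CP d := by gcongr
          linarith
      _ = ENNReal.ofReal (volB d) * ∫⁻ w, (ENNReal.ofReal E * Wt d n β (Function.update x k y)) *
          ENNReal.ofReal (Real.exp (-(2 * (β / n) * Gx w))) ∂(uniformBall d 0) := by
          rw [lintegral_const_mul' _ _ (ENNReal.mul_ne_top ENNReal.ofReal_ne_top
            (by unfold Wt; exact ENNReal.ofReal_ne_top))]
      _ ≤ ENNReal.ofReal (volB d) * ∫⁻ w, Wt d n β (Function.update x k w) ∂(uniformBall d 0) := by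
          refine mul_le_mul_right (lintegral_mono_ae ?_) _
          filter_upwards [ae_uniformBall d] with w hw
          have h1 := ham_update d hd n hn x k y w hw
          unfold Wt
          rw [hE, ← ENNReal.ofReal_mul (Real.exp_pos _).le, ← Real.exp_add,
            ← ENNReal.ofReal_mul (Real.exp_pos _).le, ← Real.exp_add]
          apply ENNReal.ofReal_le_ofReal
          apply Real.exp_le_exp.2
          have hβ0 : 0 ≤ β := by linarith
          have h2 := mul_le_mul_of_nonneg_left h1 hβ0
          have h3 : β * ((1 / (n:ℝ)) * (r ^ 2 - 2 * r - 3 - 2 * Gx w)) =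
            β / n * (r ^ 2 - 2 * r - 3) - 2 * (β / n) * Gx w := by field_simp
          simp only [hGx] at h3 ⊢
          rw [mul_add, h3] at h2
          linarith
      _ ≤ _ := by
          rw [lintegral_uniformBall, ← mul_assoc, ENNReal.mul_inv_cancel hvne ENNReal.ofReal_ne_top,
            one_mul]
          exact setLIntegral_le_lintegral _ _
  calc Wt d n β (Function.update x k y)
      = ENNReal.ofReal ((volB d)⁻¹ * Real.exp (-(1/4) * r ^ 2)) *
        (ENNReal.ofReal (volB d * Real.exp ((1/4) * r ^ 2)) * Wt d n β (Function.update x k y)) := by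
        rw [← mul_assoc, ← ENNReal.ofReal_mul (by positivity)]
        have : (volB d)⁻¹ * Real.exp (-(1/4) * r ^ 2) * (volB d * Real.exp ((1/4) * r ^ 2)) = 1 := by
          have h : Real.exp (-(1/4) * r ^ 2) * Real.exp ((1/4) * r ^ 2) = 1 := by
            rw [← Real.exp_add]; simp
          calc _ = ((volB d)⁻¹ * volB d) * (Real.exp (-(1/4) * r ^ 2) * Real.exp ((1/4) * r ^ 2)) := by ring
            _ = 1 := by rw [h, inv_mul_cancel₀ hvpos.ne', one_mul]
        rw [this, ENNReal.ofReal_one, one_mul]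
    _ ≤ ENNReal.ofReal ((volB d)⁻¹ * Real.exp (-(1/4) * r ^ 2)) *
        (ENNReal.ofReal (volB d * (E * Real.exp (-(2 * (β / n) * CP d)))) *
          Wt d n β (Function.update x k y)) := by
        gcongr
        rw [hE, ← Real.exp_add]
        apply Real.exp_le_exp.2
        have : r ^ 2 / 4 ≤ β / n * (r ^ 2 - 2 * r - 3 - 2 * CP d) := by
          have h0 : 0 ≤ r ^ 2 - 2 * r - 3 - 2 * CP d := le_trans (by positivity) hrr
          nlinarith
        linarith
    _ ≤ _ := by gcongr

lemma lint_coord {d n : ℕ} (F G : (Fin n → Euc d) → ℝ≥0∞) (hF : Measurable F) (hG : Measurable G)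
    (k : Fin n) (h : ∀ x, ∫⁻ y, F (Function.update x k y) ≤ ∫⁻ y, G (Function.update x k y)) :
    ∫⁻ x, F x ∂(LamN d n) ≤ ∫⁻ x, G x ∂(LamN d n) := by
  rw [lintegral_eq_lmarginal_univ (μ := fun _ : Fin n => (volume : Measure (Euc d))) (f := F) (fun _ => 0),
    lintegral_eq_lmarginal_univ (μ := fun _ : Fin n => (volume : Measure (Euc d))) (f := G) (fun _ => 0),
    lmarginal_erase' F hF (Finset.mem_univ k), lmarginal_erase' G hG (Finset.mem_univ k)]
  exact lmarginal_mono (fun x => h x) _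

/-- one-particle moment functional -/
def MF (d : ℕ) (f : Euc d → ℝ≥0∞) : ℝ≥0∞ :=
  ∫⁻ y, f y * ENNReal.ofReal ((volB d)⁻¹ * Real.exp (-(1/4) * ‖y‖ ^ 2))

lemma lint_one (d : ℕ) (hd : 2 ≤ d) (n : ℕ) (hn : 1 ≤ n) (β : ℝ) (hβ : n ≤ β)
    (f : Euc d → ℝ≥0∞) (hf : Measurable f) (hf0 : ∀ y, ‖y‖ < 4 + 2 * CP d → f y = 0)
    (hM : MF d f ≠ ⊤)
    (Q : (Fin n → Euc d) → ℝ≥0∞) (hQ : Measurable Q) (k : Fin n)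
    (hQk : ∀ x y, Q (Function.update x k y) = Q x) :
    ∫⁻ x, f (x k) * (Wt d n β x * Q x) ∂(LamN d n) ≤
      MF d f * ∫⁻ x, Wt d n β x * Q x ∂(LamN d n) := by
  have hW := measurable_Wt d n β
  rw [← lintegral_const_mul' _ _ hM]
  refine lint_coord _ _ ((hf.comp (measurable_pi_apply k)).mul (hW.mul hQ))
    ((hW.mul hQ).const_mul _) k fun x => ?_
  have hu : Measurable (fun y : Euc d => Wt d n β (Function.update x k y)) :=
    hW.comp (measurable_update x)
  simp only [Function.update_self, hQk]
  rw [lintegral_const_mul' _ _ hM, lintegral_mul_const _ hu, ← mul_assoc]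
  have e : ∀ y, f y * (Wt d n β (Function.update x k y) * Q x)
      = (f y * Wt d n β (Function.update x k y)) * Q x := fun y => by ring
  simp only [e]
  rw [lintegral_mul_const (f := fun y => f y * Wt d n β (Function.update x k y)) _ (hf.mul hu)]
  gcongr
  unfold MF
  rw [← lintegral_mul_const _ (by fun_prop)]
  refine lintegral_mono fun y => ?_
  beta_reduce
  by_cases hy : ‖y‖ < 4 + 2 * CP d
  · rw [hf0 y hy]; simp
  · rw [mul_assoc]
    gcongr
    exact Wt_update d hd n hn β hβ x k y (not_lt.1 hy)

lemma lint_prod (d : ℕ) (hd : 2 ≤ d) (n : ℕ) (hn : 1 ≤ n) (β : ℝ) (hβ : n ≤ β)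
    (f : Euc d → ℝ≥0∞) (hf : Measurable f) (hf0 : ∀ y, ‖y‖ < 4 + 2 * CP d → f y = 0)
    (hM : MF d f ≠ ⊤) (s : Finset (Fin n)) :
    ∫⁻ x, Wt d n β x * ∏ i ∈ s, (1 + f (x i)) ∂(LamN d n) ≤ (1 + MF d f) ^ s.card * ZZ d n β := by
  have hW := measurable_Wt d n β
  have hmi : ∀ i : Fin n, Measurable (fun x : Fin n → Euc d => 1 + f (x i)) :=
    fun i => (hf.comp (measurable_pi_apply i)).const_add 1
  induction s using Finset.induction_on with
  | empty => simp [ZZ]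
  | insert k s hk ih =>
    have hQ : Measurable (fun x : Fin n → Euc d => ∏ i ∈ s, (1 + f (x i))) :=
      Finset.measurable_fun_prod _ (fun i _ => hmi i)
    have h1 := lint_one d hd n hn β hβ f hf hf0 hM _ hQ k (fun x y => by
      refine Finset.prod_congr rfl fun i hi => ?_
      have hik : i ≠ k := fun h => hk (h ▸ hi)
      rw [Function.update_of_ne hik])
    have e : ∀ x : Fin n → Euc d, Wt d n β x * ∏ i ∈ insert k s, (1 + f (x i)) =
        Wt d n β x * ∏ i ∈ s, (1 + f (x i)) + f (x k) * (Wt d n β x * ∏ i ∈ s, (1 + f (x i))) := by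
      intro x; rw [Finset.prod_insert hk]; ring
    simp only [e]
    rw [lintegral_add_left (f := fun x : Fin n → Euc d => Wt d n β x * ∏ i ∈ s, (1 + f (x i))) (hW.mul hQ), Finset.card_insert_of_notMem hk]
    calc _ ≤ ∫⁻ x, Wt d n β x * ∏ i ∈ s, (1 + f (x i)) ∂(LamN d n) +
          MF d f * ∫⁻ x, Wt d n β x * ∏ i ∈ s, (1 + f (x i)) ∂(LamN d n) := by gcongr
      _ = (1 + MF d f) * ∫⁻ x, Wt d n β x * ∏ i ∈ s, (1 + f (x i)) ∂(LamN d n) := by ring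
      _ ≤ (1 + MF d f) * ((1 + MF d f) ^ s.card * ZZ d n β) := by gcongr
      _ = _ := by ring

lemma lint_gib (d n : ℕ) (β : ℝ) (F : (Fin n → Euc d) → ℝ≥0∞) (hF : Measurable F) :
    ∫⁻ x, F x ∂(gib d n β) = (ZZ d n β)⁻¹ * ∫⁻ x, Wt d n β x * F x ∂(LamN d n) := by
  rw [gib_eq, lintegral_smul_measure, lintegral_withDensity_eq_lintegral_mul _ (measurable_Wt d n β) hF,
    smul_eq_mul]
  rfl

lemma gib_one (d : ℕ) (hd : 2 ≤ d) (n : ℕ) (hn : 1 ≤ n) (β : ℝ) (hβ : n ≤ β)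
    (f : Euc d → ℝ≥0∞) (hf : Measurable f) (hf0 : ∀ y, ‖y‖ < 4 + 2 * CP d → f y = 0)
    (hM : MF d f ≠ ⊤) (k : Fin n) :
    ∫⁻ x, f (x k) ∂(gib d n β) ≤ MF d f := by
  have h := lint_one d hd n hn β hβ f hf hf0 hM (fun _ => 1) measurable_const k (fun _ _ => rfl)
  simp only [mul_one] at h
  rw [lint_gib d n β (fun x => f (x k)) (hf.comp (measurable_pi_apply k))]
  calc _ ≤ (ZZ d n β)⁻¹ * (MF d f * ZZ d n β) := by
        gcongr
        refine le_trans (le_of_eq ?_) h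
        congr 1; ext x; ring
    _ = MF d f * ((ZZ d n β)⁻¹ * ZZ d n β) := by ring
    _ = MF d f := by
        rw [ENNReal.inv_mul_cancel (ZZ_ne_zero d hd n hn β) (ZZ_ne_top d hd n hn β hβ), mul_one]

lemma gib_prod (d : ℕ) (hd : 2 ≤ d) (n : ℕ) (hn : 1 ≤ n) (β : ℝ) (hβ : n ≤ β)
    (f : Euc d → ℝ≥0∞) (hf : Measurable f) (hf0 : ∀ y, ‖y‖ < 4 + 2 * CP d → f y = 0)
    (hM : MF d f ≠ ⊤) :
    ∫⁻ x, ∏ i, (1 + f (x i)) ∂(gib d n β) ≤ (1 + MF d f) ^ n := by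
  have h := lint_prod d hd n hn β hβ f hf hf0 hM Finset.univ
  have hmi : ∀ i : Fin n, Measurable (fun x : Fin n → Euc d => 1 + f (x i)) :=
    fun i => (hf.comp (measurable_pi_apply i)).const_add 1
  rw [Finset.card_univ, Fintype.card_fin] at h
  rw [lint_gib d n β _ (Finset.measurable_fun_prod _ (fun i _ => hmi i))]
  calc _ ≤ (ZZ d n β)⁻¹ * ((1 + MF d f) ^ n * ZZ d n β) := by gcongr
    _ = (1 + MF d f) ^ n * ((ZZ d n β)⁻¹ * ZZ d n β) := by ring
    _ = (1 + MF d f) ^ n := by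
        rw [ENNReal.inv_mul_cancel (ZZ_ne_zero d hd n hn β) (ZZ_ne_top d hd n hn β hβ), mul_one]

/-- Gaussian-type moments -/
def Mm (d q : ℕ) : ℝ := ∫ y : Euc d, ‖y‖ ^ q * ((volB d)⁻¹ * Real.exp (-(1/4) * ‖y‖ ^ 2))

lemma integrable_Mm (d q : ℕ) :
    Integrable (fun y : Euc d => ‖y‖ ^ q * ((volB d)⁻¹ * Real.exp (-(1/4) * ‖y‖ ^ 2))) := by
  have hv := volB_pos d
  have h := (integrable_gauss d (1/8) (by norm_num)).const_mul
    ((1 + 8 ^ q * (q.factorial : ℝ)) * (volB d)⁻¹)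
  refine h.mono' (by fun_prop) (ae_of_all _ fun y => ?_)
  rw [Real.norm_of_nonneg (by positivity)]
  have h1 := Real.pow_div_factorial_le_exp (‖y‖ ^ 2 / 8) (by positivity) q
  have h2 : ‖y‖ ^ q ≤ 1 + ‖y‖ ^ (2 * q) := by
    have : ‖y‖ ^ (2 * q) = (‖y‖ ^ q) ^ 2 := by rw [← pow_mul, mul_comm]
    rw [this]
    nlinarith [sq_nonneg (‖y‖ ^ q - 1), sq_nonneg (‖y‖ ^ q)]
  have h3 : ‖y‖ ^ (2 * q) ≤ 8 ^ q * q.factorial * Real.exp (‖y‖ ^ 2 / 8) := by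
    rw [div_le_iff₀ (by positivity), div_pow, div_le_iff₀ (by positivity), ← pow_mul] at h1
    linarith
  have h4 : 1 ≤ Real.exp (‖y‖ ^ 2 / 8) := Real.one_le_exp (by positivity)
  have h5 : ‖y‖ ^ q ≤ (1 + 8 ^ q * (q.factorial : ℝ)) * Real.exp (‖y‖ ^ 2 / 8) := by linarith
  have h6 : Real.exp (-(1/8) * ‖y‖ ^ 2) = Real.exp (‖y‖ ^ 2 / 8) * Real.exp (-(1/4) * ‖y‖ ^ 2) := by
    rw [← Real.exp_add]; congr 1; ring
  rw [h6]
  calc ‖y‖ ^ q * ((volB d)⁻¹ * Real.exp (-(1/4) * ‖y‖ ^ 2))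
      ≤ ((1 + 8 ^ q * (q.factorial : ℝ)) * Real.exp (‖y‖ ^ 2 / 8)) *
        ((volB d)⁻¹ * Real.exp (-(1/4) * ‖y‖ ^ 2)) := by gcongr
    _ = _ := by ring

lemma Mm_nonneg (d q : ℕ) : 0 ≤ Mm d q := by
  have hv := volB_pos d
  exact integral_nonneg fun y => by positivity

lemma MF_le (d q : ℕ) (s : ℝ) (hs : 0 < s) (f : Euc d → ℝ≥0∞)
    (hf : ∀ y, f y ≤ ENNReal.ofReal (‖y‖ ^ q / s)) : MF d f ≤ ENNReal.ofReal (Mm d q / s) := by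
  have hv := volB_pos d
  have : Mm d q / s = ∫ y : Euc d, s⁻¹ * (‖y‖ ^ q * ((volB d)⁻¹ * Real.exp (-(1/4) * ‖y‖ ^ 2))) := by
    rw [integral_const_mul, div_eq_inv_mul]; rfl
  rw [this, ofReal_integral_eq_lintegral_ofReal ((integrable_Mm d q).const_mul _)
    (ae_of_all _ fun y => by positivity)]
  refine lintegral_mono fun y => ?_
  beta_reduce
  calc _ ≤ ENNReal.ofReal (‖y‖ ^ q / s) * ENNReal.ofReal ((volB d)⁻¹ * Real.exp (-(1/4) * ‖y‖ ^ 2)) := by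
        gcongr; exact hf y
    _ = _ := by
        rw [← ENNReal.ofReal_mul (by positivity)]; congr 1; ring

lemma exp_neg_sqrt_le (n : ℕ) (hn : 1 ≤ n) : Real.exp (-√(n:ℝ)) ≤ 24 / (n:ℝ) ^ 2 := by
  have hn0 : (0 : ℝ) < n := by exact_mod_cast hn
  have h1 := Real.pow_div_factorial_le_exp (√(n:ℝ)) (by positivity) 4
  have h2 : √(n:ℝ) ^ 4 = (n:ℝ) ^ 2 := by
    rw [show (4:ℕ) = 2 * 2 from rfl, pow_mul, Real.sq_sqrt hn0.le]
  have h3 : ((4 : ℕ).factorial : ℝ) = 24 := by norm_num [Nat.factorial]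
  rw [h2, h3] at h1
  rw [Real.exp_neg, inv_le_comm₀ (Real.exp_pos _) (by positivity)]
  refine le_trans (le_of_eq ?_) h1
  field_simp

lemma exp_half_le (h : ℝ) (h0 : 0 ≤ h) (h1 : h ≤ 1) : Real.exp (h / 2) ≤ 1 + h := by
  have h2 := Real.add_one_le_exp (-(h / 2))
  have h3 : Real.exp (h / 2) * Real.exp (-(h / 2)) = 1 := by rw [← Real.exp_add]; simp
  have h4 := Real.exp_pos (h / 2)
  nlinarith

lemma gib_max (d : ℕ) (hd : 2 ≤ d) (n : ℕ) (hn : 1 ≤ n) (β : ℝ) (hβ : n ≤ β) (p : ℕ)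
    (_hp : 1 ≤ p) (hR : (4 + 2 * CP d) ^ p ≤ √(n:ℝ)) :
    gib d n β {x | ∃ k, √(n:ℝ) < ‖x k‖ ^ p} ≤ ENNReal.ofReal (Mm d (6 * p) / (n:ℝ) ^ 2) := by
  have hn0 : (0 : ℝ) < n := by exact_mod_cast hn
  have hc := CP_nonneg d
  set S : Set (Euc d) := {y | √(n:ℝ) < ‖y‖ ^ p} with hS
  have hSm : MeasurableSet S := measurableSet_lt measurable_const (by fun_prop)
  set f : Euc d → ℝ≥0∞ := S.indicator (fun _ => 1) with hf
  have hfm : Measurable f := measurable_const.indicator hSm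
  have hfle : ∀ y, f y ≤ ENNReal.ofReal (‖y‖ ^ (6 * p) / (n:ℝ) ^ 3) := by
    intro y
    by_cases hy : y ∈ S
    · rw [hf, Set.indicator_of_mem hy, ← ENNReal.ofReal_one]
      apply ENNReal.ofReal_le_ofReal
      rw [le_div_iff₀ (by positivity), one_mul]
      have hy' : √(n:ℝ) ≤ ‖y‖ ^ p := le_of_lt hy
      calc (n:ℝ) ^ 3 = √(n:ℝ) ^ 6 := by
            rw [show (6:ℕ) = 2 * 3 from rfl, pow_mul, Real.sq_sqrt hn0.le]
        _ ≤ (‖y‖ ^ p) ^ 6 := by gcongr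
        _ = ‖y‖ ^ (6 * p) := by rw [← pow_mul, mul_comm]
    · rw [hf, Set.indicator_of_notMem hy]; exact zero_le
  have hf0 : ∀ y, ‖y‖ < 4 + 2 * CP d → f y = 0 := by
    intro y hy
    refine Set.indicator_of_notMem (fun hyS => ?_) _
    have h1 : ‖y‖ ^ p ≤ (4 + 2 * CP d) ^ p := by gcongr
    have h2 : √(n:ℝ) < ‖y‖ ^ p := hyS
    linarith
  have hMF := MF_le d (6 * p) ((n:ℝ) ^ 3) (by positivity) f hfle
  have hMt : MF d f ≠ ⊤ := ne_top_of_le_ne_top ENNReal.ofReal_ne_top hMF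
  have hk : ∀ k : Fin n, gib d n β {x | √(n:ℝ) < ‖x k‖ ^ p} ≤
      ENNReal.ofReal (Mm d (6 * p) / (n:ℝ) ^ 3) := by
    intro k
    refine le_trans ?_ ((gib_one d hd n hn β hβ f hfm hf0 hMt k).trans hMF)
    have hm : MeasurableSet {x : Fin n → Euc d | √(n:ℝ) < ‖x k‖ ^ p} :=
      hSm.preimage (measurable_pi_apply k)
    rw [← lintegral_indicator_one hm]
    exact le_of_eq rfl
  have hU : {x : Fin n → Euc d | ∃ k, √(n:ℝ) < ‖x k‖ ^ p} = ⋃ k, {x | √(n:ℝ) < ‖x k‖ ^ p} := by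
    ext x; simp
  rw [hU]
  calc _ ≤ ∑ k : Fin n, gib d n β {x | √(n:ℝ) < ‖x k‖ ^ p} := measure_iUnion_fintype_le _ _
    _ ≤ ∑ k : Fin n, ENNReal.ofReal (Mm d (6 * p) / (n:ℝ) ^ 3) := Finset.sum_le_sum fun k _ => hk k
    _ = _ := by
      rw [Finset.sum_const, Finset.card_univ, Fintype.card_fin, nsmul_eq_mul,
        ← ENNReal.ofReal_natCast, ← ENNReal.ofReal_mul hn0.le]
      congr 1
      field_simp

lemma gib_cher (d : ℕ) (hd : 2 ≤ d) (n : ℕ) (hn : 1 ≤ n) (β : ℝ) (hβ : n ≤ β) (p : ℕ) :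
    gib d n β {x | (∀ k, ‖x k‖ ^ p ≤ √(n:ℝ)) ∧
      (4 + 2 * CP d) ^ p + 2 * Mm d p + 2 < (n:ℝ)⁻¹ * ∑ i, ‖x i‖ ^ p} ≤
      ENNReal.ofReal (Real.exp (-√(n:ℝ))) := by
  have hn0 : (0 : ℝ) < n := by exact_mod_cast hn
  set s := √(n:ℝ) with hs
  have hs0 : 0 < s := Real.sqrt_pos.2 hn0
  have hss : s * s = n := Real.mul_self_sqrt hn0.le
  have hc := CP_nonneg d
  have hM0 := Mm_nonneg d p
  set R := 4 + 2 * CP d with hR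
  set S : Set (Euc d) := {y | R ≤ ‖y‖ ∧ ‖y‖ ^ p ≤ s} with hS
  have hSm : MeasurableSet S :=
    MeasurableSet.inter (s₁ := {y : Euc d | R ≤ ‖y‖}) (s₂ := {y : Euc d | ‖y‖ ^ p ≤ s})
      (measurableSet_le measurable_const (by fun_prop))
      (measurableSet_le (by fun_prop) measurable_const)
  set h : Euc d → ℝ := S.indicator (fun y => ‖y‖ ^ p / s) with hh
  have hhm : Measurable h := Measurable.indicator (by fun_prop) hSm
  have hh0 : ∀ y, 0 ≤ h y := fun y => Set.indicator_nonneg (fun y _ => by positivity) y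
  have hh1 : ∀ y, h y ≤ 1 := by
    intro y
    refine Set.indicator_apply_le' (fun hy => ?_) (fun _ => zero_le_one)
    rw [div_le_one hs0]; exact hy.2
  set f : Euc d → ℝ≥0∞ := fun y => ENNReal.ofReal (h y) with hf
  have hfm : Measurable f := ENNReal.measurable_ofReal.comp hhm
  have hfle : ∀ y, f y ≤ ENNReal.ofReal (‖y‖ ^ p / s) := fun y =>
    ENNReal.ofReal_le_ofReal (Set.indicator_apply_le' (fun _ => le_rfl) (fun _ => by positivity))
  have hf0 : ∀ y, ‖y‖ < R → f y = 0 := by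
    intro y hy
    have : h y = 0 := Set.indicator_of_notMem (fun hyS => absurd hyS.1 (not_le.2 hy)) _
    simp [hf, this]
  have hMF := MF_le d p s hs0 f hfle
  have hMt : MF d f ≠ ⊤ := ne_top_of_le_ne_top ENNReal.ofReal_ne_top hMF
  have hprod := gib_prod d hd n hn β hβ f hfm hf0 hMt
  have hub : (1 + MF d f) ^ n ≤ ENNReal.ofReal (Real.exp (Mm d p * s)) := by
    calc (1 + MF d f) ^ n ≤ (ENNReal.ofReal (Real.exp (Mm d p / s))) ^ n := by
          gcongr
          calc 1 + MF d f ≤ ENNReal.ofReal 1 + ENNReal.ofReal (Mm d p / s) := by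
                rw [ENNReal.ofReal_one]; gcongr
            _ = ENNReal.ofReal (1 + Mm d p / s) :=
                (ENNReal.ofReal_add zero_le_one (by positivity)).symm
            _ ≤ _ := by
                apply ENNReal.ofReal_le_ofReal
                have := Real.add_one_le_exp (Mm d p / s)
                linarith
      _ = _ := by
          rw [← ENNReal.ofReal_pow (Real.exp_pos _).le, ← Real.exp_nat_mul]
          congr 2
          rw [← hss]; field_simp
  set a := (Mm d p + 1) * s with ha
  have hsub : ∀ x ∈ {x : Fin n → Euc d | (∀ k, ‖x k‖ ^ p ≤ s) ∧
      R ^ p + 2 * Mm d p + 2 < (n:ℝ)⁻¹ * ∑ i, ‖x i‖ ^ p},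
      ENNReal.ofReal (Real.exp a) ≤ ∏ i, (1 + f (x i)) := by
    rintro x ⟨hx1, hx2⟩
    have h1 : ∀ i, ‖x i‖ ^ p ≤ R ^ p + s * h (x i) := by
      intro i
      by_cases hi : R ≤ ‖x i‖
      · have : h (x i) = ‖x i‖ ^ p / s := Set.indicator_of_mem (s := S) ⟨hi, hx1 i⟩ _
        rw [this, mul_div_cancel₀ _ hs0.ne']
        have : 0 ≤ R ^ p := by positivity
        linarith
      · have h3 : ‖x i‖ ^ p ≤ R ^ p := by gcongr; exact (not_le.1 hi).le
        have := mul_nonneg hs0.le (hh0 (x i))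
        linarith
    have h2 : ∑ i, ‖x i‖ ^ p ≤ n * R ^ p + s * ∑ i, h (x i) := by
      calc _ ≤ ∑ i, (R ^ p + s * h (x i)) := Finset.sum_le_sum fun i _ => h1 i
        _ = _ := by rw [Finset.sum_add_distrib, ← Finset.mul_sum]; simp
    rw [inv_mul_eq_div, lt_div_iff₀ hn0] at hx2
    have h3 : s * (2 * a) ≤ s * ∑ i, h (x i) := by
      have : s * (2 * a) = (2 * Mm d p + 2) * n := by rw [ha, ← hss]; ring
      rw [this]; linarith
    have h4 : 2 * a ≤ ∑ i, h (x i) := le_of_mul_le_mul_left h3 hs0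
    calc ENNReal.ofReal (Real.exp a) ≤ ENNReal.ofReal (∏ i, (1 + h (x i))) := by
          apply ENNReal.ofReal_le_ofReal
          calc Real.exp a ≤ Real.exp (∑ i, h (x i) / 2) := by
                apply Real.exp_le_exp.2
                rw [← Finset.sum_div]; linarith
            _ = ∏ i, Real.exp (h (x i) / 2) := Real.exp_sum _ _
            _ ≤ ∏ i, (1 + h (x i)) :=
                Finset.prod_le_prod (fun i _ => (Real.exp_pos _).le)
                  (fun i _ => exp_half_le _ (hh0 _) (hh1 _))
      _ = ∏ i, (1 + f (x i)) := by
          rw [ENNReal.ofReal_prod_of_nonneg (fun i _ => by have := hh0 (x i); positivity)]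
          refine Finset.prod_congr rfl fun i _ => ?_
          rw [ENNReal.ofReal_add zero_le_one (hh0 _), ENNReal.ofReal_one]
  have hpm : Measurable (fun x : Fin n → Euc d => ∏ i, (1 + f (x i))) :=
    Finset.measurable_fun_prod _ (fun i _ => (hfm.comp (measurable_pi_apply i)).const_add 1)
  have hmark := mul_meas_ge_le_lintegral (μ := gib d n β) hpm (ENNReal.ofReal (Real.exp a))
  have h5 : ENNReal.ofReal (Real.exp a) * gib d n β {x | (∀ k, ‖x k‖ ^ p ≤ s) ∧
      R ^ p + 2 * Mm d p + 2 < (n:ℝ)⁻¹ * ∑ i, ‖x i‖ ^ p} ≤ ENNReal.ofReal (Real.exp (Mm d p * s)) :=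
    le_trans (mul_le_mul_right (measure_mono hsub) _) (hmark.trans (hprod.trans hub))
  set P := gib d n β {x | (∀ k, ‖x k‖ ^ p ≤ s) ∧
      R ^ p + 2 * Mm d p + 2 < (n:ℝ)⁻¹ * ∑ i, ‖x i‖ ^ p}
  calc P = ENNReal.ofReal (Real.exp (-a)) * (ENNReal.ofReal (Real.exp a) * P) := by
        rw [← mul_assoc, ← ENNReal.ofReal_mul (Real.exp_pos _).le, ← Real.exp_add]
        simp
    _ ≤ ENNReal.ofReal (Real.exp (-a)) * ENNReal.ofReal (Real.exp (Mm d p * s)) := by gcongr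
    _ = _ := by
        rw [← ENNReal.ofReal_mul (Real.exp_pos _).le, ← Real.exp_add]
        congr 2; rw [ha]; ring

lemma gib_moment (d : ℕ) (hd : 2 ≤ d) (β : ℕ → ℝ) (hβ : Tendsto (fun n => β n / n) atTop atTop)
    (p : ℕ) (hp : 1 ≤ p) : ∃ K A : ℝ, 0 ≤ K ∧ ∀ᶠ n : ℕ in atTop,
      gib d n (β n) {x | K < (n:ℝ)⁻¹ * ∑ i, ‖x i‖ ^ p} ≤ ENNReal.ofReal (A / (n:ℝ) ^ 2) := by
  have hc := CP_nonneg d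
  have hM := Mm_nonneg d p
  refine ⟨(4 + 2 * CP d) ^ p + 2 * Mm d p + 2, Mm d (6 * p) + 24, by positivity, ?_⟩
  have h1 : Tendsto (fun n : ℕ => √(n:ℝ)) atTop atTop :=
    Real.tendsto_sqrt_atTop.comp tendsto_natCast_atTop_atTop
  filter_upwards [hβ.eventually_ge_atTop 1, h1.eventually_ge_atTop ((4 + 2 * CP d) ^ p),
    eventually_ge_atTop 1] with n hb hs hn
  have hn0 : (0 : ℝ) < n := by exact_mod_cast hn
  rw [le_div_iff₀ hn0, one_mul] at hb
  have hsub : {x : Fin n → Euc d | (4 + 2 * CP d) ^ p + 2 * Mm d p + 2 < (n:ℝ)⁻¹ * ∑ i, ‖x i‖ ^ p} ⊆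
      {x | ∃ k, √(n:ℝ) < ‖x k‖ ^ p} ∪ {x | (∀ k, ‖x k‖ ^ p ≤ √(n:ℝ)) ∧
      (4 + 2 * CP d) ^ p + 2 * Mm d p + 2 < (n:ℝ)⁻¹ * ∑ i, ‖x i‖ ^ p} := by
    intro x hx
    by_cases h : ∃ k, √(n:ℝ) < ‖x k‖ ^ p
    · exact Or.inl h
    · push Not at h
      exact Or.inr ⟨h, hx⟩
  calc _ ≤ _ := measure_mono hsub
    _ ≤ _ := measure_union_le _ _
    _ ≤ ENNReal.ofReal (Mm d (6 * p) / (n:ℝ) ^ 2) + ENNReal.ofReal (24 / (n:ℝ) ^ 2) :=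
        add_le_add (gib_max d hd n hn _ hb p hp hs) ((gib_cher d hd n hn _ hb p).trans
          (ENNReal.ofReal_le_ofReal (exp_neg_sqrt_le n hn)))
    _ = _ := by
        have := Mm_nonneg d (6 * p)
        rw [← ENNReal.ofReal_add (by positivity) (by positivity), add_div]

lemma gib_inj (d : ℕ) (hd : 2 ≤ d) (n : ℕ) (β : ℝ) :
    gib d n β {x | ¬ Function.Injective x} = 0 := by
  have hnt := nontrivial_Euc d hd
  have h1 : LamN d n {x | ¬ Function.Injective x} = 0 := by
    have hsub : {x : Fin n → Euc d | ¬ Function.Injective x} ⊆ ⋃ i : Fin n, ⋃ j : Fin n, ⋃ _ : i ≠ j,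
        ((LinearMap.ker (LinearMap.proj (R := ℝ) (φ := fun _ : Fin n => Euc d) i - LinearMap.proj j) :
          Submodule ℝ (Fin n → Euc d)) : Set (Fin n → Euc d)) := by
      intro x hx
      simp only [Set.mem_ofPred_eq, Function.Injective, not_forall] at hx
      obtain ⟨i, j, hij, hne⟩ := hx
      simp only [Set.mem_iUnion]
      exact ⟨i, j, hne, by simp [hij]⟩
    refine measure_mono_null hsub ?_
    refine measure_iUnion_null fun i => measure_iUnion_null fun j => measure_iUnion_null fun hij => ?_
    refine Measure.addHaar_submodule _ _ ?_
    intro h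
    obtain ⟨e, he⟩ := exists_ne (0 : Euc d)
    have : (Pi.single i e : Fin n → Euc d) ∈ (⊤ : Submodule ℝ (Fin n → Euc d)) := trivial
    rw [← h] at this
    simp [hij.symm] at this
    exact he this
  rw [gib_eq, Measure.smul_apply, smul_eq_mul]
  rw [withDensity_absolutelyContinuous (LamN d n) (Wt d n β) h1, mul_zero]

/-- the linear statistics -/
def mv (d n : ℕ) (v : Euc d) (c : ℝ) (x : Fin n → Euc d) : ℝ :=
  (1 / (n : ℝ)) * ∑ i, (⟪(x i), v⟫ - c)

/-- the shift onto the constraint -/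
def tau (d n : ℕ) (v : Euc d) (c : ℝ) (x : Fin n → Euc d) : Fin n → Euc d :=
  fun i => x i - mv d n v c x • v

lemma continuous_mv (d n : ℕ) (v : Euc d) (c : ℝ) : Continuous (mv d n v c) := by
  unfold mv; fun_prop

lemma continuous_tau (d n : ℕ) (v : Euc d) (c : ℝ) : Continuous (tau d n v c) := by
  have := continuous_mv d n v c
  unfold tau; fun_prop

lemma mv_shift (d n : ℕ) (hn : 1 ≤ n) (v : Euc d) (hv : ‖v‖ = 1) (c : ℝ) (x : Fin n → Euc d) (t : ℝ) :
    mv d n v c (fun i => x i - t • v) = mv d n v c x - t := by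
  have hn0 : (0 : ℝ) < n := by exact_mod_cast hn
  unfold mv
  have : ∀ i, ⟪x i - t • v, v⟫ - c = (⟪x i, v⟫ - c) - t := fun i => by
    rw [inner_sub_left, real_inner_smul_left, real_inner_self_eq_norm_sq, hv]; ring
  simp only [this]
  rw [Finset.sum_sub_distrib]
  simp only [Finset.sum_const, Finset.card_univ, Fintype.card_fin, nsmul_eq_mul]
  field_simp

lemma tau_shift (d n : ℕ) (hn : 1 ≤ n) (v : Euc d) (hv : ‖v‖ = 1) (c : ℝ) (x : Fin n → Euc d) (t : ℝ) :
    tau d n v c (fun i => x i - t • v) = tau d n v c x := by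
  unfold tau
  ext1 i
  rw [mv_shift d n hn v hv]; module

lemma sum_inner_eq (d n : ℕ) (hn : 1 ≤ n) (v : Euc d) (c : ℝ) (x : Fin n → Euc d) :
    ∑ i, ⟪x i, v⟫ = n * (mv d n v c x + c) := by
  have hn0 : (0 : ℝ) < n := by exact_mod_cast hn
  unfold mv
  rw [Finset.sum_sub_distrib]
  simp only [Finset.sum_const, Finset.card_univ, Fintype.card_fin, nsmul_eq_mul]
  field_simp
  ring

lemma ham_shift (d n : ℕ) (hn : 1 ≤ n) (v : Euc d) (hv : ‖v‖ = 1) (c : ℝ) (x : Fin n → Euc d) (s : ℝ) :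
    ham d n x = ham d n (fun i => x i - s • v) + (2 * s * (mv d n v c x + c) - s ^ 2) := by
  have hn0 : (0 : ℝ) < n := by exact_mod_cast hn
  unfold ham hamiltonian
  have h1 : ∀ i, ‖x i - s • v‖ ^ 2 = ‖x i‖ ^ 2 - 2 * s * ⟪x i, v⟫ + s ^ 2 := fun i => by
    rw [norm_sub_sq_real, real_inner_smul_right, norm_smul, hv, mul_one, Real.norm_eq_abs, sq_abs]
    ring
  simp only [h1, sub_sub_sub_cancel_right]
  rw [Finset.sum_add_distrib, Finset.sum_sub_distrib, ← Finset.mul_sum, sum_inner_eq d n hn v c x]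
  simp only [Finset.sum_const, Finset.card_univ, Fintype.card_fin, nsmul_eq_mul]
  field_simp
  ring

/-- the weight of the linear statistics -/
def ew (β c z : ℝ) : ℝ≥0∞ := ENNReal.ofReal (Real.exp (-β * (z ^ 2 + 2 * z * c)))

lemma measurable_ew (β c : ℝ) : Measurable (ew β c) := by unfold ew; fun_prop

lemma Wt_split (d n : ℕ) (hn : 1 ≤ n) (β : ℝ) (v : Euc d) (hv : ‖v‖ = 1) (c : ℝ)
    (x : Fin n → Euc d) : Wt d n β x = Wt d n β (tau d n v c x) * ew β c (mv d n v c x) := by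
  unfold Wt ew
  rw [← ENNReal.ofReal_mul (Real.exp_pos _).le, ← Real.exp_add,
    ham_shift d n hn v hv c x (mv d n v c x)]
  congr 2
  unfold tau
  ring

lemma tonelli_shift (d n : ℕ) (hn : 1 ≤ n) (v : Euc d) (hv : ‖v‖ = 1) (c : ℝ)
    (Φ : (Fin n → Euc d) → ℝ≥0∞) (hΦ : Measurable Φ) (k : ℝ → ℝ≥0∞) (hk : Measurable k) :
    ∫⁻ x, Φ (tau d n v c x) * k (mv d n v c x) ∂(LamN d n) =
      (∫⁻ x, Φ (tau d n v c x) * (Set.Icc (0:ℝ) 1).indicator 1 (mv d n v c x) ∂(LamN d n)) *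
        ∫⁻ t, k t := by
  set ρ : ℝ → ℝ≥0∞ := (Set.Icc (0:ℝ) 1).indicator 1 with hρ
  have hρm : Measurable ρ := measurable_one.indicator measurableSet_Icc
  have hρ1 : ∫⁻ t, ρ t = 1 := by
    rw [hρ, lintegral_indicator_one measurableSet_Icc]; simp
  have hm := (continuous_mv d n v c).measurable
  have hΦτ : Measurable (fun x => Φ (tau d n v c x)) := hΦ.comp (continuous_tau d n v c).measurable
  calc ∫⁻ x, Φ (tau d n v c x) * k (mv d n v c x) ∂(LamN d n)
      = ∫⁻ x, (∫⁻ t : ℝ, Φ (tau d n v c x) * k (mv d n v c x) * ρ (mv d n v c x + t)) ∂(LamN d n) := by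
        refine lintegral_congr fun x => ?_
        rw [lintegral_const_mul _ (by fun_prop), lintegral_add_left_eq_self, hρ1, mul_one]
    _ = ∫⁻ t, ∫⁻ x, Φ (tau d n v c x) * k (mv d n v c x) * ρ (mv d n v c x + t) ∂(LamN d n) := by
        refine lintegral_lintegral_swap (Measurable.aemeasurable ?_)
        exact ((hΦτ.comp measurable_fst).mul (hk.comp (hm.comp measurable_fst))).mul
          (hρm.comp ((hm.comp measurable_fst).add measurable_snd))
    _ = ∫⁻ t, ∫⁻ x, Φ (tau d n v c x) * k (mv d n v c x - t) * ρ (mv d n v c x) ∂(LamN d n) := by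
        refine lintegral_congr fun t => ?_
        rw [← lintegral_sub_right_eq_self _ (fun _ : Fin n => t • v)]
        refine lintegral_congr fun x => ?_
        have e : (x - fun _ : Fin n => t • v) = fun i => x i - t • v := rfl
        rw [e, tau_shift d n hn v hv, mv_shift d n hn v hv, sub_add_cancel]
    _ = ∫⁻ x, (∫⁻ t : ℝ, Φ (tau d n v c x) * k (mv d n v c x - t) * ρ (mv d n v c x)) ∂(LamN d n) := by
        refine lintegral_lintegral_swap (Measurable.aemeasurable ?_)
        exact ((hΦτ.comp measurable_snd).mul (hk.comp ((hm.comp measurable_snd).sub measurable_fst))).mul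
          (hρm.comp (hm.comp measurable_snd))
    _ = ∫⁻ x, Φ (tau d n v c x) * ρ (mv d n v c x) * (∫⁻ t, k t) ∂(LamN d n) := by
        refine lintegral_congr fun x => ?_
        have e : ∀ t, Φ (tau d n v c x) * k (mv d n v c x - t) * ρ (mv d n v c x) =
          Φ (tau d n v c x) * ρ (mv d n v c x) * k (mv d n v c x - t) := fun t => by ring
        simp only [e]
        rw [lintegral_const_mul _ (by fun_prop), lintegral_sub_left_eq_self]
    _ = _ := lintegral_mul_const _ (hΦτ.mul (hρm.comp hm))

/-- factor constant -/
def Ef (d n : ℕ) (β : ℝ) (v : Euc d) (c : ℝ) (f : (Fin n → Euc d) → ℝ≥0∞) : ℝ≥0∞ :=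
  (ZZ d n β)⁻¹ * ∫⁻ x, (Wt d n β (tau d n v c x) * f (tau d n v c x)) *
    (Set.Icc (0:ℝ) 1).indicator 1 (mv d n v c x) ∂(LamN d n)

lemma gib_factor (d n : ℕ) (hn : 1 ≤ n) (β : ℝ) (v : Euc d) (hv : ‖v‖ = 1) (c : ℝ)
    (f : (Fin n → Euc d) → ℝ≥0∞) (hf : Measurable f) (k : ℝ → ℝ≥0∞) (hk : Measurable k) :
    ∫⁻ x, f (tau d n v c x) * k (mv d n v c x) ∂(gib d n β) =
      Ef d n β v c f * ∫⁻ z, ew β c z * k z := by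
  have hm := (continuous_mv d n v c).measurable
  have hτ := (continuous_tau d n v c).measurable
  have hF : Measurable (fun x => f (tau d n v c x) * k (mv d n v c x)) :=
    (hf.comp hτ).mul (hk.comp hm)
  rw [lint_gib d n β _ hF]
  have h := tonelli_shift d n hn v hv c (fun x => Wt d n β x * f x) ((measurable_Wt d n β).mul hf)
    (fun z => ew β c z * k z) ((measurable_ew β c).mul hk)
  unfold Ef
  rw [mul_assoc, ← h]
  congr 1
  refine lintegral_congr fun x => ?_
  rw [Wt_split d n hn β v hv c x]
  ring

lemma gib_indep (d : ℕ) (hd : 2 ≤ d) (n : ℕ) (hn : 1 ≤ n) (β : ℝ) (hβ : n ≤ β) (v : Euc d)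
    (hv : ‖v‖ = 1) (c : ℝ)
    (f : (Fin n → Euc d) → ℝ≥0∞) (hf : Measurable f) (k : ℝ → ℝ≥0∞) (hk : Measurable k) :
    ∫⁻ x, f (tau d n v c x) * k (mv d n v c x) ∂(gib d n β) =
      (∫⁻ x, f (tau d n v c x) ∂(gib d n β)) * ∫⁻ x, k (mv d n v c x) ∂(gib d n β) := by
  have hP := gib_prob d hd n hn β hβ
  have h1 := gib_factor d n hn β v hv c f hf k hk
  have h2 := gib_factor d n hn β v hv c f hf (fun _ => 1) measurable_const
  have h3 := gib_factor d n hn β v hv c (fun _ => 1) measurable_const k hk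
  have h4 := gib_factor d n hn β v hv c (fun _ => 1) measurable_const (fun _ => 1) measurable_const
  simp only [mul_one, one_mul, lintegral_const, measure_univ] at h2 h3 h4
  rw [h1, h2, h3]
  set A := Ef d n β v c fun _ => 1
  calc _ = Ef d n β v c f * 1 * ∫⁻ z, ew β c z * k z := by rw [mul_one]
    _ = _ := by nth_rewrite 1 [h4]; ring

lemma gib_openpos (d : ℕ) (hd : 2 ≤ d) (n : ℕ) (hn : 1 ≤ n) (β : ℝ) (hβ : n ≤ β) (v : Euc d)
    (hv : ‖v‖ = 1) (c : ℝ) : ((gib d n β).map (mv d n v c)).IsOpenPosMeasure := by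
  have hP := gib_prob d hd n hn β hβ
  have hm := (continuous_mv d n v c).measurable
  constructor
  intro U hU hne h0
  have h4 := gib_factor d n hn β v hv c (fun _ => 1) measurable_const (fun _ => 1) measurable_const
  have h3 := gib_factor d n hn β v hv c (fun _ => 1) measurable_const (U.indicator 1)
    (measurable_one.indicator hU.measurableSet)
  simp only [mul_one, one_mul, lintegral_const, measure_univ] at h3 h4
  have h5 : ∫⁻ x, U.indicator 1 (mv d n v c x) ∂(gib d n β) = 0 := by
    rw [← lintegral_map (f := U.indicator 1) (measurable_one.indicator hU.measurableSet) hm,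
      lintegral_indicator_one hU.measurableSet, h0]
  rw [h5] at h3
  have h6 : ∫⁻ z, ew β c z * U.indicator 1 z = 0 := by
    rcases mul_eq_zero.1 h3.symm with h | h
    · rw [h, zero_mul] at h4; exact absurd h4 one_ne_zero
    · exact h
  rw [lintegral_eq_zero_iff (f := fun z => ew β c z * U.indicator 1 z) ((measurable_ew β c).mul (measurable_one.indicator hU.measurableSet))] at h6
  have h7 : volume U = 0 := by
    rw [measure_eq_zero_iff_ae_notMem]
    filter_upwards [h6] with z hz hzU
    simp only [Pi.zero_apply, Set.indicator_of_mem hzU, Pi.one_apply, mul_one] at hz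
    unfold ew at hz
    rw [ENNReal.ofReal_eq_zero] at hz
    exact absurd (Real.exp_pos _) (not_lt.2 hz)
  exact hU.measure_ne_zero volume hne h7

lemma kappa_zero (d : ℕ) (hd : 2 ≤ d) (n : ℕ) (hn : 1 ≤ n) (β : ℝ) (hβ : n ≤ β) (v : Euc d)
    (hv : ‖v‖ = 1) (c : ℝ) (κ : ℝ → Measure (Fin n → Euc d)) (hκm : Measurable κ)
    (hκp : ∀ z, IsProbabilityMeasure (κ z))
    (hκs : ∀ z : ℝ, κ z {x | mv d n v c x ≠ z} = 0)
    (hκc : ∀ f : BoundedContinuousFunction (Fin n → Euc d) ℝ, Continuous fun z => ∫ x, f x ∂(κ z))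
    (hκd : gib d n β = ((gib d n β).map (mv d n v c)).bind κ) :
    κ 0 = (gib d n β).map (tau d n v c) := by
  have hP := gib_prob d hd n hn β hβ
  have hop := gib_openpos d hd n hn β hβ v hv c
  have hm := (continuous_mv d n v c).measurable
  have hτc := continuous_tau d n v c
  have hτ := hτc.measurable
  have hae : ∀ z, ∀ᵐ x ∂(κ z), mv d n v c x = z := fun z => by
    rw [ae_iff]; exact hκs z
  have hprob : IsProbabilityMeasure ((gib d n β).map (mv d n v c)) :=
    Measure.isProbabilityMeasure_map hm.aemeasurable
  refine ext_of_forall_lintegral_eq_of_IsFiniteMeasure (fun f => ?_)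
  have hfm : Measurable (fun x => (f x : ℝ≥0∞)) :=
    (ENNReal.continuous_coe.comp f.continuous).measurable
  have hFm : Measurable (fun x => (f (tau d n v c x) : ℝ≥0∞)) := hfm.comp hτ
  rw [lintegral_map hfm hτ]
  set C : ℝ≥0∞ := ∫⁻ x, (f (tau d n v c x) : ℝ≥0∞) ∂(gib d n β) with hC
  set b : ℝ → ℝ≥0∞ := fun z => ∫⁻ x, (f (tau d n v c x) : ℝ≥0∞) ∂(κ z) with hb
  have hbm : Measurable b := (Measure.measurable_lintegral hFm).comp hκm
  let g : BoundedContinuousFunction (Fin n → Euc d) ℝ≥0 := f.compContinuous ⟨tau d n v c, hτc⟩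
  have hgv : ∀ x, g x = f (tau d n v c x) := fun x => rfl
  have hbtop : ∀ z, b z < ∞ := fun z => by
    have := BoundedContinuousFunction.lintegral_lt_top_of_nnreal (κ z) g
    simpa [hb, hgv] using this
  have hCtop : C < ∞ := by
    have := BoundedContinuousFunction.lintegral_lt_top_of_nnreal (gib d n β) g
    simpa [hC, hgv] using this
  have hbc : Continuous (fun z => (b z).toReal) := by
    have h1 := hκc ⟨⟨fun x => (g x : ℝ), NNReal.continuous_coe.comp g.continuous⟩, g.map_bounded'⟩
    convert h1 using 2 with z
    exact BoundedContinuousFunction.toReal_lintegral_coe_eq_integral g (κ z)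
  have hbae : b =ᵐ[(gib d n β).map (mv d n v c)] fun _ => C := by
    refine ae_eq_of_forall_setLIntegral_eq_of_sigmaFinite hbm measurable_const (fun A hA _ => ?_)
    have hk : Measurable (A.indicator (1 : ℝ → ℝ≥0∞)) := measurable_one.indicator hA
    have h2 := gib_indep d hd n hn β hβ v hv c (fun x => (f x : ℝ≥0∞)) hfm (A.indicator 1) hk
    have h3 : ∫⁻ x, (f (tau d n v c x) : ℝ≥0∞) * A.indicator 1 (mv d n v c x) ∂(gib d n β) =
        ∫⁻ z in A, b z ∂((gib d n β).map (mv d n v c)) := by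
      conv_lhs => rw [hκd]
      rw [Measure.lintegral_bind (f := fun x => (f (tau d n v c x) : ℝ≥0∞) * A.indicator 1 (mv d n v c x))
        hκm.aemeasurable (hFm.mul (hk.comp hm)).aemeasurable,
        ← lintegral_indicator hA]
      refine lintegral_congr (fun z => ?_)
      have : ∫⁻ x, (f (tau d n v c x) : ℝ≥0∞) * A.indicator 1 (mv d n v c x) ∂(κ z) =
          ∫⁻ x, (f (tau d n v c x) : ℝ≥0∞) * A.indicator 1 z ∂(κ z) := by
        refine lintegral_congr_ae ?_
        filter_upwards [hae z] with x hx
        rw [hx]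
      rw [this, lintegral_mul_const _ hFm]
      by_cases hz : z ∈ A <;> simp [hz, hb]
    rw [← h3, h2, setLIntegral_const, Measure.map_apply hm hA]
    congr 1
    have : (fun x => A.indicator (1 : ℝ → ℝ≥0∞) (mv d n v c x)) =
        (mv d n v c ⁻¹' A).indicator 1 := by
      ext x; simp [Set.indicator]
    rw [this, lintegral_indicator_one (hm hA)]
  have hre : (fun z => (b z).toReal) = fun _ => C.toReal := by
    refine (Continuous.ae_eq_iff_eq ((gib d n β).map (mv d n v c)) hbc continuous_const).1 ?_
    filter_upwards [hbae] with z hz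
    rw [hz]
  have h0 : b 0 = C :=
    (ENNReal.toReal_eq_toReal_iff' (hbtop 0).ne hCtop.ne).1 (congrFun hre 0)
  rw [← h0]
  refine lintegral_congr_ae ?_
  filter_upwards [hae 0] with x hx
  have : tau d n v c x = x := by
    ext1 i; simp [tau, hx]
  rw [this]

lemma moment_shift (d n : ℕ) (hn : 1 ≤ n) (v : Euc d) (hv : ‖v‖ = 1) (c : ℝ) (x : Fin n → Euc d)
    (k : ℕ) (hk : 1 ≤ k) :
    (n:ℝ)⁻¹ * ∑ i, ‖x i - (mv d n v c x + c) • v‖ ^ k ≤ 2 ^ k * ((n:ℝ)⁻¹ * ∑ i, ‖x i‖ ^ k) := by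
  have hn0 : (0 : ℝ) < n := by exact_mod_cast hn
  set M : ℝ := ∑ i, (n:ℝ)⁻¹ * ‖x i‖ with hM
  have hM0 : 0 ≤ M := Finset.sum_nonneg (fun i _ => by positivity)
  have hmM : |mv d n v c x + c| ≤ M := by
    have h1 : mv d n v c x + c = ∑ i, (n:ℝ)⁻¹ * ⟪x i, v⟫ := by
      rw [← Finset.mul_sum, sum_inner_eq d n hn v c x]; field_simp
    rw [h1]
    refine (Finset.abs_sum_le_sum_abs _ _).trans (Finset.sum_le_sum fun i _ => ?_)
    rw [abs_mul, abs_of_pos (inv_pos.2 hn0)]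
    have := abs_real_inner_le_norm (x i) v
    rw [hv, mul_one] at this
    gcongr
  have hMk : M ^ k ≤ (n:ℝ)⁻¹ * ∑ i, ‖x i‖ ^ k := by
    rw [Finset.mul_sum]
    refine Real.pow_arith_mean_le_arith_mean_pow Finset.univ (fun _ => (n:ℝ)⁻¹) (fun i => ‖x i‖)
      (fun i _ => by positivity) ?_ (fun i _ => norm_nonneg _) k
    simp [hn0.ne']
  have hi : ∀ i, ‖x i - (mv d n v c x + c) • v‖ ^ k ≤ 2 ^ (k - 1) * (‖x i‖ ^ k + M ^ k) := by
    intro i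
    have h1 : ‖x i - (mv d n v c x + c) • v‖ ≤ ‖x i‖ + M := by
      refine (norm_sub_le _ _).trans ?_
      rw [norm_smul, hv, mul_one, Real.norm_eq_abs]
      gcongr
    exact (pow_le_pow_left₀ (norm_nonneg _) h1 k).trans (add_pow_le (norm_nonneg _) hM0 k)
  have h2 : (2:ℝ) ^ k = 2 ^ (k - 1) * 2 := by
    rw [← pow_succ]; congr 1; omega
  calc (n:ℝ)⁻¹ * ∑ i, ‖x i - (mv d n v c x + c) • v‖ ^ k
      ≤ (n:ℝ)⁻¹ * ∑ i, 2 ^ (k - 1) * (‖x i‖ ^ k + M ^ k) := by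
        gcongr with i; exact hi i
    _ = 2 ^ (k - 1) * ((n:ℝ)⁻¹ * ∑ i, ‖x i‖ ^ k + M ^ k) := by
        rw [← Finset.mul_sum, Finset.sum_add_distrib]
        simp only [Finset.sum_const, Finset.card_univ, Fintype.card_fin, nsmul_eq_mul]
        field_simp
    _ ≤ 2 ^ (k - 1) * ((n:ℝ)⁻¹ * ∑ i, ‖x i‖ ^ k + (n:ℝ)⁻¹ * ∑ i, ‖x i‖ ^ k) := by gcongr
    _ = _ := by rw [h2]; ring

lemma borel_cantelli_sq {Ω : Type*} [MeasurableSpace Ω] (μ : Measure Ω) [IsProbabilityMeasure μ]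
    (s : ℕ → Set Ω) (A : ℝ)
    (h : ∀ᶠ n : ℕ in atTop, μ (s n) ≤ ENNReal.ofReal (A / (n:ℝ) ^ 2)) :
    ∀ᵐ ω ∂μ, ∀ᶠ n in atTop, ω ∉ s n := by
  obtain ⟨N, hN⟩ := eventually_atTop.1 h
  have hsum : (∑' n : ℕ, μ (if N ≤ n then s n else ∅)) ≠ ∞ := by
    have hs : Summable (fun n : ℕ => |A| / (n:ℝ) ^ 2) := by
      have := (Real.summable_one_div_nat_pow (p := 2)).2 (by norm_num)
      simpa [div_eq_mul_inv] using this.mul_left |A|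
    have h1 : (∑' n : ℕ, ENNReal.ofReal (|A| / (n:ℝ) ^ 2)) ≠ ∞ := hs.tsum_ofReal_ne_top
    refine ne_top_of_le_ne_top h1 (ENNReal.tsum_le_tsum fun n => ?_)
    split_ifs with hn
    · refine (hN n hn).trans (ENNReal.ofReal_le_ofReal ?_)
      gcongr; exact le_abs_self A
    · simp
  filter_upwards [ae_eventually_notMem hsum] with ω hω
  filter_upwards [hω, eventually_ge_atTop N] with n hn hNn
  rwa [if_pos hNn] at hn

lemma exp_neg_le_sq (n : ℕ) (hn : 1 ≤ n) : Real.exp (-(n:ℝ)) ≤ 2 / (n:ℝ) ^ 2 := by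
  have hn0 : (0 : ℝ) < n := by exact_mod_cast hn
  have := Real.quadratic_le_exp_of_nonneg hn0.le
  rw [Real.exp_neg, inv_eq_one_div, div_le_div_iff₀ (Real.exp_pos _) (by positivity)]
  nlinarith

lemma final_aux (d : ℕ) (hd : 2 ≤ d) (β : ℕ → ℝ) (hβ : Tendsto (fun n => β n / n) atTop atTop)
    (v : Euc d) (hv : ‖v‖ = 1) (c : ℝ) {Ω : Type} [MeasurableSpace Ω] (μ : Measure Ω)
    [IsProbabilityMeasure μ] (Y : (n : ℕ) → Ω → (Fin n → Euc d)) (hY : ∀ n, Measurable (Y n))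
    (hlaw : ∀ᶠ n in atTop, μ.map (Y n) = (gib d n (β n)).map (tau d n v c)) :
    ∀ᵐ ω ∂μ, ∀ p : ℝ, 1 ≤ p →
      Tendsto (fun n => wassDist d p (empMeas d n (Y n ω)) (uniformBall d (c • v)))
            atTop (𝓝 0) := by
  -- transfer of measurable bad events
  have htr : ∀ (n : ℕ) (S : Set (Fin n → Euc d)), MeasurableSet S →
      μ.map (Y n) = (gib d n (β n)).map (tau d n v c) →
      μ (Y n ⁻¹' S) = gib d n (β n) (tau d n v c ⁻¹' S) := by
    intro n S hS h
    rw [← Measure.map_apply (hY n) hS, h, Measure.map_apply (continuous_tau d n v c).measurable hS]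
  have hty : ∀ (n : ℕ) (x : Fin n → Euc d) (i : Fin n),
      tau d n v c x i - c • v = x i - (mv d n v c x + c) • v := by
    intro n x i; unfold tau; module
  -- energy
  have hE : ∀ j : ℕ, ∀ᵐ ω ∂μ, ∀ᶠ n in atTop,
      ¬ (eqI d + 1 / ((j:ℝ) + 1) ≤ ham d n (fun i => Y n ω i - c • v)) := by
    intro j
    have hδ : (0:ℝ) < 1 / ((j:ℝ) + 1) := by positivity
    refine borel_cantelli_sq μ
      (fun n => Y n ⁻¹' {y | eqI d + 1 / ((j:ℝ) + 1) ≤ ham d n (fun i => y i - c • v)}) 2 ?_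
    filter_upwards [hlaw, gib_tail_ev d hd β hβ _ hδ, eventually_ge_atTop 1] with n h1 h2 hn
    have hms : MeasurableSet {y : Fin n → Euc d |
        eqI d + 1 / ((j:ℝ) + 1) ≤ ham d n (fun i => y i - c • v)} := by
      refine measurableSet_le measurable_const ((measurable_ham d n).comp ?_)
      fun_prop
    rw [htr n _ hms h1]
    refine (measure_mono ?_).trans (h2.trans (ENNReal.ofReal_le_ofReal (exp_neg_le_sq n hn)))
    intro x hx
    simp only [Set.mem_preimage, Set.mem_ofPred_eq, hty] at hx ⊢
    rw [ham_shift d n hn v hv c x (mv d n v c x + c)]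
    nlinarith [sq_nonneg (mv d n v c x + c)]
  -- moments
  have hM : ∀ k : ℕ, ∃ K : ℝ, ∀ᵐ ω ∂μ, ∀ᶠ n : ℕ in atTop,
      (n:ℝ)⁻¹ * ∑ i, ‖Y n ω i - c • v‖ ^ k ≤ K := by
    intro k
    rcases Nat.eq_zero_or_pos k with rfl | hk
    · refine ⟨1, ae_of_all _ fun ω => ?_⟩
      filter_upwards [eventually_ge_atTop 1] with n hn
      have hn0 : (0 : ℝ) < n := by exact_mod_cast hn
      simp [hn0.ne']
    obtain ⟨K, A, hK, hKA⟩ := gib_moment d hd β hβ k hk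
    refine ⟨2 ^ k * K, ?_⟩
    have := borel_cantelli_sq μ
      (fun n => Y n ⁻¹' {y | 2 ^ k * K < (n:ℝ)⁻¹ * ∑ i, ‖y i - c • v‖ ^ k}) A ?_
    · filter_upwards [this] with ω hω
      filter_upwards [hω] with n hn
      simpa only [Set.mem_preimage, Set.mem_ofPred_eq, not_lt] using hn
    filter_upwards [hlaw, hKA, eventually_ge_atTop 1] with n h1 h2 hn
    have hms : MeasurableSet {y : Fin n → Euc d |
        2 ^ k * K < (n:ℝ)⁻¹ * ∑ i, ‖y i - c • v‖ ^ k} := by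
      refine measurableSet_lt measurable_const ?_
      fun_prop
    rw [htr n _ hms h1]
    refine (measure_mono ?_).trans h2
    intro x hx
    simp only [Set.mem_preimage, Set.mem_ofPred_eq, hty] at hx ⊢
    have := hx.trans_le (moment_shift d n hn v hv c x k hk)
    exact lt_of_mul_lt_mul_left this (by positivity)
  -- injectivity
  have hI : ∀ᵐ ω ∂μ, ∀ᶠ n in atTop, Function.Injective (Y n ω) := by
    have := borel_cantelli_sq μ
      (fun n => Y n ⁻¹' {y | ¬ Function.Injective y}) 0 ?_
    · filter_upwards [this] with ω hω
      filter_upwards [hω] with n hn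
      simpa only [Set.mem_preimage, Set.mem_ofPred_eq, not_not] using hn
    filter_upwards [hlaw] with n h1
    have hms : MeasurableSet {y : Fin n → Euc d | ¬ Function.Injective y} := by
      have : {y : Fin n → Euc d | ¬ Function.Injective y} =
          ⋃ i : Fin n, ⋃ j : Fin n, {y | y i = y j ∧ i ≠ j} := by
        ext y; simp [Function.Injective]
      rw [this]
      refine MeasurableSet.iUnion fun i => MeasurableSet.iUnion fun j => ?_
      by_cases hij : i = j
      · simp [hij]
      · simp only [ne_eq, hij, not_false_eq_true, and_true]
        exact measurableSet_eq_fun (measurable_pi_apply i) (measurable_pi_apply j)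
    rw [htr n _ hms h1]
    refine le_trans (measure_mono ?_) ((gib_inj d hd n (β n)).le.trans (by simp))
    intro x hx hx'
    simp only [Set.mem_preimage, Set.mem_ofPred_eq] at hx
    refine hx fun i j hij => hx' ?_
    simpa [tau] using hij
  choose K hK using hM
  filter_upwards [ae_all_iff.2 hE, ae_all_iff.2 hK, hI] with ω h1 h2 h3
  intro p hp
  refine det_final d hd (c • v) (fun n => Y n ω) h3 ?_ (fun k => ⟨K k, h2 k⟩) p hp
  intro ε hε
  obtain ⟨j, hj⟩ := exists_nat_one_div_lt hε
  filter_upwards [h1 j] with n hn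
  have := (not_le.1 hn).le
  unfold ham at this
  linarith

/-- for the quadratic confinement with the linear constraint `φ(x) = x·v - c`,
the empirical measure of the conditioned gas (the conditioning being defined through a
weakly continuous disintegration of `P_n` along `x ↦ (1/n) Σ φ(x_i)`) converges almost
surely, in every `p`-Wasserstein distance, to the translate `δ_{cv} * μ⋆` of the
equilibrium measure, i.e. the uniform measure on the closed unit ball centered at `cv`. -/
theorem stmt3 (d : ℕ) (hd : 2 ≤ d) (V : Euc d → ℝ) (hV : ∀ x, V x = ‖x‖ ^ 2)
    (β : ℕ → ℝ) (hβpos : ∀ n, 0 < β n)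
    (hβ : Tendsto (fun n => β n / n) atTop atTop)
    (v : Euc d) (hv : ‖v‖ = 1) (c : ℝ)
    -- for each `n`, a weakly continuous disintegration of `P_n` along the linear statistics
    (κ : (n : ℕ) → ℝ → Measure (Fin n → Euc d))
    (hκmeas : ∀ n, 2 ≤ n → Measurable (κ n))
    (hκprob : ∀ n, 2 ≤ n → ∀ z, IsProbabilityMeasure (κ n z))
    (hκsupp : ∀ n, 2 ≤ n → ∀ z : ℝ,
      κ n z {x | (1 / (n : ℝ)) * ∑ i, (⟪(x i), v⟫ - c) ≠ z} = 0)
    (hκcont : ∀ n, 2 ≤ n → ∀ f : BoundedContinuousFunction (Fin n → Euc d) ℝ,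
      Continuous fun z => ∫ x, f x ∂(κ n z))
    (hκdisint : ∀ n, 2 ≤ n → gibbs d n (β n) V =
      ((gibbs d n (β n) V).map (fun x => (1 / (n : ℝ)) * ∑ i, (⟪(x i), v⟫ - c))).bind (κ n)) :
    -- the conditioned gas, realized on any probability space
    ∀ (Ω : Type) (_ : MeasureSpace Ω), IsProbabilityMeasure (ℙ : Measure Ω) →
      ∀ Y : (n : ℕ) → Ω → (Fin n → Euc d),
        (∀ n, Measurable (Y n)) →
        (∀ n, 2 ≤ n → Measure.map (Y n) ℙ = κ n 0) →
        ∀ᵐ ω ∂(ℙ : Measure Ω), ∀ p : ℝ, 1 ≤ p →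
          Tendsto (fun n => wassDist d p (empMeas d n (Y n ω)) (uniformBall d (c • v)))
            atTop (𝓝 0) := by
  obtain rfl : V = fun x => ‖x‖ ^ 2 := funext hV
  intro Ω _ hP Y hY hlaw
  refine final_aux d hd β hβ v hv c ℙ Y hY ?_
  filter_upwards [hβ.eventually_ge_atTop 1, eventually_ge_atTop 2] with n h1 hn
  have hn0 : (0 : ℝ) < n := by exact_mod_cast (by omega : 0 < n)
  rw [hlaw n hn]
  refine kappa_zero d hd n (by omega) (β n) ?_ v hv c (κ n) (hκmeas n hn) (hκprob n hn)
    (hκsupp n hn) (hκcont n hn) (hκdisint n hn)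
  rwa [le_div_iff₀ hn0, one_mul] at h1

end
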